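/- arXiv:2203.11017 — 5 statements merged into one kernel-verified Lean document; each statement's English description precedes it below -/
import Mathlib

section
/- Let {a, b} be a 2-element generating set of a finite abelian group G, let m be the order of a, let n = |G|/m, and let e be the unique integer with 0 ≤ e < m and n·b = e·a. Assume m ≥ 2 and n ≥ e. Then for every integer k with n−1 ≤ k ≤ m(n−1), there is a hamiltonian path P in Cay(G; a, b) such that k ≤ δ_b(P) ≤ k + 2⌊(mn−1)/(m+n−e)⌋. -/
/-- `v : Fin N → G` is a hamiltonian path of the Cayley digraph `Cay(G; a, b)`. -/
def IsHamPath {G : Type*} [AddCommGroup G] (a b : G) (N : ℕ) (v : Fin N → G) : Prop :=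
  Function.Bijective v ∧
    ∀ (i : ℕ) (h : i + 1 < N),
      v ⟨i + 1, h⟩ - v ⟨i, Nat.lt_of_succ_lt h⟩ ∈ ({a, b} : Set G)

/-- The number of indices `i` with `v (i+1) - v i = s`. -/
noncomputable def delta {G : Type*} [AddCommGroup G] (N : ℕ) (v : Fin N → G) (s : G) : ℕ :=
  Nat.card {i : ℕ // ∃ h : i + 1 < N, v ⟨i + 1, h⟩ - v ⟨i, Nat.lt_of_succ_lt h⟩ = s}

namespace CayleyHamPath

open Equiv Equiv.Perm

lemma mul_swap_apply_of_ne {α : Type*} [DecidableEq α] {σ : Perm α} {p q v : α}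
    (h1 : v ≠ p) (h2 : v ≠ q) : (σ * swap p q) v = σ v := by
  rw [Perm.mul_apply, swap_apply_of_ne_of_ne h1 h2]

section Orbits

variable {α : Type*} [Finite α] {σ : Perm α} {o p q v y : α}

/-- Forward induction along the orbit of a permutation of a finite type. -/
lemma sameCycle_induction {motive : α → Prop} (base : motive v)
    (step : ∀ z, σ.SameCycle v z → motive z → motive (σ z)) (h : σ.SameCycle v y) :
    motive y := by
  obtain ⟨i, rfl⟩ := h.exists_nat_pow_eq
  induction i with
  | zero => simpa using base
  | succ i ih =>
    rw [pow_succ', Perm.mul_apply]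
    exact step _ ⟨i, by simp⟩ (ih ⟨i, by simp⟩)

/-- The orbit of `v` under `σ`, as a finset. -/
noncomputable def orbit [Fintype α] (σ : Perm α) (v : α) : Finset α := by
  classical exact Finset.univ.filter (σ.SameCycle v)

lemma mem_orbit {α : Type*} [Fintype α] {σ : Perm α} {v y : α} :
    y ∈ orbit σ v ↔ σ.SameCycle v y := by
  simp [orbit]

variable [DecidableEq α]

lemma sameCycle_mul_swap_iff_of_not (h1 : ¬ σ.SameCycle v p) (h2 : ¬ σ.SameCycle v q) :
    (σ * swap p q).SameCycle v y ↔ σ.SameCycle v y := by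
  have key : ∀ z, σ.SameCycle v z → (σ * swap p q) z = σ z := fun z hz =>
    mul_swap_apply_of_ne (fun h => h1 (h ▸ hz)) (fun h => h2 (h ▸ hz))
  constructor
  · refine sameCycle_induction (SameCycle.refl _ _) fun z _ hz => ?_
    rw [key z hz]
    exact sameCycle_apply_right.2 hz
  · refine sameCycle_induction (SameCycle.refl _ _) fun z hz hz' => ?_
    rw [← key z hz]
    exact sameCycle_apply_right.2 hz'

/-- Composing with a transposition merges two distinct orbits. -/
lemma sameCycle_mul_swap_iff_or (hp : σ p = o) (hq : ¬ σ.SameCycle o q) :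
    (σ * swap p q).SameCycle o v ↔ σ.SameCycle o v ∨ σ.SameCycle q v := by
  have hp' : (σ * swap p q) p = σ q := by simp
  have hq' : (σ * swap p q) q = o := by simp [hp]
  have hop : σ.SameCycle o p := by
    rw [← hp]; exact sameCycle_apply_left.2 (SameCycle.refl _ _)
  constructor
  · refine sameCycle_induction (motive := fun z => σ.SameCycle o z ∨ σ.SameCycle q z)
      (Or.inl (SameCycle.refl _ _)) fun z _ hz => ?_
    by_cases h1 : z = p
    · subst h1; rw [hp']; exact Or.inr (sameCycle_apply_right.2 (SameCycle.refl _ _))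
    by_cases h2 : z = q
    · subst h2; rw [hq']; exact Or.inl (SameCycle.refl _ _)
    rw [mul_swap_apply_of_ne h1 h2]
    simpa only [sameCycle_apply_right] using hz
  · have hO : ∀ {z}, σ.SameCycle o z → (σ * swap p q).SameCycle o z := by
      intro z
      refine sameCycle_induction (SameCycle.refl _ _) fun z hz hz' => ?_
      by_cases h1 : z = p
      · rw [h1, hp]
      rw [← mul_swap_apply_of_ne (q := q) h1 (fun h => hq (h ▸ hz))]
      exact sameCycle_apply_right.2 hz'
    rintro (h | h)
    · exact hO h
    · have hσq : (σ * swap p q).SameCycle o (σ q) := by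
        rw [← hp']; exact sameCycle_apply_right.2 (hO hop)
      refine sameCycle_induction (σ := σ) (v := σ q) hσq (fun z hz hz' => ?_)
        (sameCycle_apply_left.2 h)
      by_cases h2 : z = q
      · rw [h2]; exact hσq
      have h1 : z ≠ p := by
        rintro rfl
        exact hq (hop.trans (sameCycle_apply_left.1 hz).symm)
      rw [← mul_swap_apply_of_ne h1 h2]
      exact sameCycle_apply_right.2 hz'

/-- Composing with a transposition splits an orbit. -/
lemma not_sameCycle_mul_swap (hpq : p ≠ q) (hp : σ p = o) (hq : σ.SameCycle o q) :
    ¬ (σ * swap p q).SameCycle o p := by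
  classical
  have hex := hq.exists_nat_pow_eq
  set i := Nat.find hex with hi
  have hiq : (σ ^ i) o = q := Nat.find_spec hex
  have hmin : ∀ l < i, (σ ^ l) o ≠ q := fun l hl => Nat.find_min hex hl
  have hnp : ∀ l ≤ i, (σ ^ l) o ≠ p := by
    intro l hl h
    rcases hl.eq_or_lt with rfl | hl
    · exact hpq (h.symm.trans hiq)
    · have h1 : (σ ^ (l + 1)) o = o := by rw [pow_succ', Perm.mul_apply, h, hp]
      refine hmin (i - (l + 1)) (by omega) ?_
      rw [← hiq]
      conv_rhs => rw [show i = (i - (l + 1)) + (l + 1) by omega, pow_add, Perm.mul_apply, h1]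
  intro hcon
  obtain ⟨l, hl, h⟩ := sameCycle_induction (motive := fun z => ∃ l ≤ i, (σ ^ l) o = z)
    ⟨0, Nat.zero_le _, by simp⟩ (fun z _ => by
      rintro ⟨l, hl, rfl⟩
      rcases hl.eq_or_lt with rfl | hl'
      · exact ⟨0, Nat.zero_le _, by rw [hiq]; simp [hp]⟩
      · refine ⟨l + 1, hl', ?_⟩
        rw [mul_swap_apply_of_ne (hnp l hl) (hmin l hl'), pow_succ', Perm.mul_apply]) hcon
  exact hnp l hl h

end Orbits

section Configuration

variable {G : Type*} [AddCommGroup G] (a b : G)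

/-- The vertices of the terminal coset of `⟨b - a⟩`, in antidiagonal order. -/
def antidiag (i : ℕ) : G := i • (b - a) - a

lemma antidiag_succ (i : ℕ) : antidiag a b (i + 1) = antidiag a b i + (b - a) := by
  simp only [antidiag, succ_nsmul]; abel

lemma antidiag_succ_add (i : ℕ) : antidiag a b (i + 1) + a = antidiag a b i + b := by
  rw [antidiag_succ]; abel

lemma antidiag_zero_add : antidiag a b 0 + a = 0 := by simp [antidiag]

lemma antidiag_addOrderOf : antidiag a b (addOrderOf (b - a)) = antidiag a b 0 := by
  simp [antidiag, addOrderOf_nsmul_eq_zero]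

variable {a b}

lemma antidiag_injOn {i j : ℕ} (hi : i < addOrderOf (b - a)) (hj : j < addOrderOf (b - a))
    (h : antidiag a b i = antidiag a b j) : i = j :=
  nsmul_injOn_Iio_addOrderOf hi hj (sub_left_injective h)

/-- The class of a vertex modulo the arc-forcing subgroup `⟨b - a⟩`. -/
abbrev cls (a b v : G) : G ⧸ AddSubgroup.zmultiples (b - a) := QuotientAddGroup.mk v

lemma cls_eq_iff {v w : G} : cls a b v = cls a b w ↔ v - w ∈ AddSubgroup.zmultiples (b - a) := by
  rw [eq_comm, QuotientAddGroup.eq, neg_add_eq_sub]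

lemma cls_add_left (v : G) : cls a b (v + a) = cls a b (v + b) := by
  rw [cls_eq_iff]
  exact ⟨-1, by simp⟩

lemma cls_antidiag (i : ℕ) : cls a b (antidiag a b i) = cls a b (-a) := by
  rw [cls_eq_iff]
  exact ⟨i, by simp [antidiag]⟩

lemma cls_add_sub (v : G) : cls a b (v + (b - a)) = cls a b v := by
  rw [cls_eq_iff]
  exact ⟨1, by simp⟩

lemma cls_add (v w : G) : cls a b (v + w) = cls a b v + cls a b w := rfl

lemma exists_antidiag [Finite G] {v : G} (h : cls a b v = cls a b (-a)) :
    ∃ i < addOrderOf (b - a), v = antidiag a b i := by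
  classical
  rw [cls_eq_iff, mem_zmultiples_iff_mem_range_addOrderOf] at h
  simp only [Finset.mem_image, Finset.mem_range] at h
  obtain ⟨i, hi, h⟩ := h
  exact ⟨i, hi, by rw [antidiag, h]; abel⟩

/-- The vertices that travel by `b`. -/
def MovesB (a b : G) (S : Finset (G ⧸ AddSubgroup.zmultiples (b - a))) (t : ℕ) (v : G) : Prop :=
  cls a b v ∈ S ∨ ∃ i < t, v = antidiag a b i

variable {S : Finset (G ⧸ AddSubgroup.zmultiples (b - a))} {t : ℕ}

lemma not_movesB_antidiag (hS : cls a b (-a) ∉ S) {i : ℕ} (hti : t ≤ i)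
    (hi : i < addOrderOf (b - a)) : ¬ MovesB a b S t (antidiag a b i) := by
  rintro (h | ⟨j, hj, h⟩)
  · rw [cls_antidiag] at h; exact hS h
  · have := antidiag_injOn hi (by omega) h; omega

variable [Fintype G]

open Classical in
/-- The permutation that moves by `b` on the cosets in `S` and by `a` elsewhere. -/
noncomputable def cosetPerm (a b : G) (S : Finset (G ⧸ AddSubgroup.zmultiples (b - a))) :
    Perm G :=
  Equiv.ofBijective (fun v => if cls a b v ∈ S then v + b else v + a) <| by
    refine Finite.injective_iff_bijective.1 fun v w h => ?_
    have hc : cls a b v = cls a b w := by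
      have : cls a b (v + a) = cls a b (w + a) := by
        have h' := congrArg (cls a b) h
        split_ifs at h' <;> simpa only [← cls_add_left] using h'
      rw [cls_eq_iff] at this ⊢
      simpa using this
    rw [hc] at h
    split_ifs at h <;> simpa using h

open Classical in
/-- The closed-up configuration whose terminal vertex is `antidiag a b t`: the vertices
`antidiag a b i` with `i < t` and the cosets in `S` move by `b`, the terminal vertex moves to
`0`, and all other vertices move by `a`. -/
noncomputable def config (a b : G) (S : Finset (G ⧸ AddSubgroup.zmultiples (b - a))) :
    ℕ → Perm G
  | 0 => cosetPerm a b S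
  | t + 1 => config a b S t * swap (antidiag a b t) (antidiag a b (t + 1))

open Classical in
lemma config_apply (hS : cls a b (-a) ∉ S) (ht : t < addOrderOf (b - a)) (v : G) :
    config a b S t v = if v = antidiag a b t then 0 else
      if MovesB a b S t v then v + b else v + a := by
  induction t generalizing v with
  | zero =>
    by_cases hv : v = antidiag a b 0
    · subst hv
      rw [if_pos rfl]
      have : cls a b (antidiag a b 0) ∉ S := by rwa [cls_antidiag]
      simp [config, cosetPerm, this, antidiag_zero_add]
    · simp [config, cosetPerm, hv, MovesB]
  | succ t ih =>
    have ht' : t < addOrderOf (b - a) := by omega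
    have hne : antidiag a b (t + 1) ≠ antidiag a b t := fun h => by
      have := antidiag_injOn ht ht' h; omega
    rw [config, Perm.mul_apply]
    by_cases h1 : v = antidiag a b t
    · subst h1
      rw [swap_apply_left, ih ht', if_neg hne,
        if_neg (not_movesB_antidiag hS (by omega) ht), if_neg hne.symm,
        if_pos (show MovesB a b S (t + 1) _ from Or.inr ⟨t, by omega, rfl⟩), antidiag_succ_add]
    by_cases h2 : v = antidiag a b (t + 1)
    · subst h2
      rw [swap_apply_right, ih ht', if_pos rfl, if_pos rfl]
    rw [swap_apply_of_ne_of_ne h1 h2, ih ht', if_neg h1, if_neg h2]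
    have : MovesB a b S (t + 1) v ↔ MovesB a b S t v := by
      refine or_congr_right ⟨?_, ?_⟩
      · rintro ⟨i, hi, rfl⟩
        refine ⟨i, ?_, rfl⟩
        rcases Nat.lt_succ_iff_lt_or_eq.1 hi with h | rfl
        · exact h
        · exact absurd rfl h1
      · rintro ⟨i, hi, rfl⟩
        exact ⟨i, by omega, rfl⟩
    simp only [this]

lemma config_apply_terminal (hS : cls a b (-a) ∉ S) (ht : t < addOrderOf (b - a)) :
    config a b S t (antidiag a b t) = 0 := by
  rw [config_apply hS ht, if_pos rfl]

lemma config_apply_of_movesB (hS : cls a b (-a) ∉ S) (ht : t < addOrderOf (b - a)) {v : G}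
    (hv : MovesB a b S t v) : config a b S t v = v + b := by
  have : v ≠ antidiag a b t := by
    rintro rfl
    exact not_movesB_antidiag hS le_rfl ht hv
  rw [config_apply hS ht, if_neg this, if_pos hv]

lemma config_apply_of_not_movesB (hS : cls a b (-a) ∉ S) (ht : t < addOrderOf (b - a)) {v : G}
    (hv : ¬ MovesB a b S t v) (hvt : v ≠ antidiag a b t) : config a b S t v = v + a := by
  rw [config_apply hS ht, if_neg hvt, if_neg hv]

lemma config_apply_eq_or (hS : cls a b (-a) ∉ S) (ht : t < addOrderOf (b - a)) {v : G}
    (hvt : v ≠ antidiag a b t) :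
    config a b S t v = v + a ∨ config a b S t v = v + b := by
  rw [config_apply hS ht, if_neg hvt]
  split_ifs <;> simp

lemma sameCycle_terminal (hS : cls a b (-a) ∉ S) (ht : t < addOrderOf (b - a)) :
    (config a b S t).SameCycle 0 (antidiag a b t) := by
  rw [← config_apply_terminal hS ht]
  exact sameCycle_apply_left.2 (SameCycle.refl _ _)

lemma ne_terminal (hS : cls a b (-a) ∉ S) (ht : t < addOrderOf (b - a)) {v : G}
    (hv : ¬ (config a b S t).SameCycle 0 v) : v ≠ antidiag a b t := by
  rintro rfl
  exact hv (sameCycle_terminal hS ht)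

lemma cls_config (hS : cls a b (-a) ∉ S) (ht : t < addOrderOf (b - a)) (v : G) :
    cls a b (config a b S t v) = cls a b (v + a) := by
  by_cases hv : v = antidiag a b t
  · subst hv
    rw [config_apply_terminal hS ht, cls_add, cls_antidiag, ← cls_add, neg_add_cancel]
  · rcases config_apply_eq_or hS ht hv with h | h <;> rw [h]
    exact (cls_add_left v).symm

/-- Away from the ends of the terminal coset, the configuration commutes with the translation
by `b - a`. -/
lemma config_add (hS : cls a b (-a) ∉ S) (ht : t < addOrderOf (b - a)) {v : G}
    (h1 : v ≠ antidiag a b t) (h2 : v + (b - a) ≠ antidiag a b t)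
    (h3 : v + (b - a) ≠ antidiag a b 0) :
    config a b S t (v + (b - a)) = config a b S t v + (b - a) := by
  have key : MovesB a b S t (v + (b - a)) ↔ MovesB a b S t v := by
    rw [MovesB, MovesB, cls_add_sub]
    refine or_congr_right ⟨?_, ?_⟩
    · rintro ⟨i, hi, h⟩
      cases i with
      | zero => exact absurd h h3
      | succ i =>
        rw [antidiag_succ] at h
        exact ⟨i, by omega, add_right_cancel h⟩
    · rintro ⟨i, hi, rfl⟩
      rw [← antidiag_succ] at h2 ⊢
      refine ⟨i + 1, ?_, rfl⟩
      rcases Nat.lt_or_ge (i + 1) t with h | h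
      · exact h
      · exact absurd (by rw [show i + 1 = t by omega]) h2
  by_cases hv : MovesB a b S t v
  · rw [config_apply_of_movesB hS ht hv, config_apply_of_movesB hS ht (key.2 hv)]; abel
  · rw [config_apply_of_not_movesB hS ht hv h1,
      config_apply_of_not_movesB hS ht (mt key.1 hv) h2]; abel

lemma exists_sameCycle_cls (hgen : AddSubgroup.closure {a, b} = ⊤) (hS : cls a b (-a) ∉ S)
    (ht : t < addOrderOf (b - a)) (v w : G) :
    ∃ y, (config a b S t).SameCycle v y ∧ cls a b y = cls a b w := by
  have key : ∀ i : ℕ, ∃ y, (config a b S t).SameCycle v y ∧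
      cls a b y = cls a b v + i • cls a b a := by
    intro i
    induction i with
    | zero => exact ⟨v, SameCycle.refl _ _, by simp⟩
    | succ i ih =>
      obtain ⟨y, hy, h⟩ := ih
      refine ⟨_, sameCycle_apply_right.2 hy, ?_⟩
      rw [cls_config hS ht, cls_add, h, succ_nsmul, add_assoc]
  have hba : cls a b b = cls a b a := by simpa using (cls_add_left (a := a) (b := b) 0).symm
  have hmem : cls a b (w - v) ∈ AddSubgroup.zmultiples (cls a b a) := by
    have : w - v ∈ AddSubgroup.closure {a, b} := hgen ▸ AddSubgroup.mem_top _
    obtain ⟨x, y, h⟩ := AddSubgroup.mem_closure_pair.1 this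
    refine ⟨x + y, ?_⟩
    rw [← h, cls_add]
    change (x + y) • cls a b a = x • cls a b a + y • cls a b b
    rw [hba, add_zsmul]
  classical
  rw [mem_zmultiples_iff_mem_range_addOrderOf] at hmem
  simp only [Finset.mem_image, Finset.mem_range] at hmem
  obtain ⟨i, -, hi⟩ := hmem
  obtain ⟨y, hy, h⟩ := key i
  refine ⟨y, hy, ?_⟩
  rw [h, hi, ← cls_add, add_sub_cancel]

/-- If translation by a generator `d` of `⟨b - a⟩` commutes with the configuration off the orbit
of `0`, and the translate of the terminal vertex lies on that orbit, there is no other orbit. -/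
lemma sameCycle_of_translation (hgen : AddSubgroup.closure {a, b} = ⊤)
    (hS : cls a b (-a) ∉ S) (ht : t < addOrderOf (b - a)) {d : G}
    (hd : b - a ∈ AddSubgroup.zmultiples d)
    (hcomm : ∀ y, ¬ (config a b S t).SameCycle 0 y →
      config a b S t (y + d) = config a b S t y + d)
    (hterm : (config a b S t).SameCycle 0 (antidiag a b t - d)) (v : G) :
    (config a b S t).SameCycle 0 v := by
  have hclosed : ∀ v, ¬ (config a b S t).SameCycle 0 v →
      ¬ (config a b S t).SameCycle 0 (v + d) := by
    intro v hv hcon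
    refine hv (hterm.trans (SameCycle.symm ?_))
    refine sameCycle_induction (motive := fun z => (config a b S t).SameCycle v (z - d))
      (by rw [add_sub_cancel_right]) (fun z _ hz => ?_)
      (hcon.symm.trans (sameCycle_terminal hS ht))
    have := hcomm (z - d) (fun h => hv (h.trans hz.symm))
    rw [sub_add_cancel] at this
    rw [this, add_sub_cancel_right]
    exact sameCycle_apply_right.2 hz
  by_contra hv
  obtain ⟨y, hy, hc⟩ := exists_sameCycle_cls hgen hS ht v (antidiag a b t)
  have hy0 : ¬ (config a b S t).SameCycle 0 y := fun h0 => hv (h0.trans hy.symm)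
  have hmem : antidiag a b t - y ∈ AddSubgroup.zmultiples d := by
    have := cls_eq_iff.1 hc.symm
    exact (AddSubgroup.zmultiples_le_of_mem hd) this
  classical
  rw [mem_zmultiples_iff_mem_range_addOrderOf] at hmem
  simp only [Finset.mem_image, Finset.mem_range] at hmem
  obtain ⟨i, -, hi⟩ := hmem
  have key : ∀ i : ℕ, ¬ (config a b S t).SameCycle 0 (y + i • d) := by
    intro i
    induction i with
    | zero => simpa using hy0
    | succ i ih => rw [succ_nsmul, ← add_assoc]; exact hclosed _ ih
  refine key i ?_
  rw [hi, add_sub_cancel]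
  exact sameCycle_terminal hS ht

lemma sameCycle_of_right (hgen : AddSubgroup.closure {a, b} = ⊤)
    (hS : cls a b (-a) ∉ S) (ht : t < addOrderOf (b - a))
    (h0 : (config a b S t).SameCycle 0 (antidiag a b 0 - (b - a)))
    (h1 : (config a b S t).SameCycle 0 (antidiag a b t - (b - a))) (v : G) :
    (config a b S t).SameCycle 0 v := by
  refine sameCycle_of_translation hgen hS ht (AddSubgroup.mem_zmultiples _) (fun y hy => ?_) h1 v
  refine config_add hS ht (ne_terminal hS ht hy) (fun h => ?_) (fun h => ?_)
  · rw [← h, add_sub_cancel_right] at h1; exact hy h1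
  · rw [← h, add_sub_cancel_right] at h0; exact hy h0

lemma sameCycle_of_left (hgen : AddSubgroup.closure {a, b} = ⊤)
    (hS : cls a b (-a) ∉ S) (ht : t < addOrderOf (b - a))
    (h0 : (config a b S t).SameCycle 0 (antidiag a b 0))
    (h1 : (config a b S t).SameCycle 0 (antidiag a b t + (b - a))) (v : G) :
    (config a b S t).SameCycle 0 v := by
  refine sameCycle_of_translation hgen hS ht (d := -(b - a))
    (by simpa using neg_mem (AddSubgroup.mem_zmultiples (-(b - a)))) (fun y hy => ?_)
    (by rwa [sub_neg_eq_add]) v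
  have := config_add hS ht (v := y - (b - a)) (fun h => ?_) ?_ ?_
  · rw [sub_add_cancel] at this
    rw [← sub_eq_add_neg, ← sub_eq_add_neg, this, add_sub_cancel_right]
  · rw [← h, sub_add_cancel] at h1; exact hy h1
  · rw [sub_add_cancel]; exact ne_terminal hS ht hy
  · rw [sub_add_cancel]; rintro rfl; exact hy h0

/-- If both neighbors of the terminal vertex lie on the path, the path is hamiltonian. -/
lemma sameCycle_of_neighbors (hgen : AddSubgroup.closure {a, b} = ⊤)
    (hS : cls a b (-a) ∉ S) (ht : t < addOrderOf (b - a))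
    (hl : (config a b S t).SameCycle 0 (antidiag a b t - (b - a)))
    (hr : (config a b S t).SameCycle 0 (antidiag a b t + (b - a))) (v : G) :
    (config a b S t).SameCycle 0 v := by
  by_cases h0 : (config a b S t).SameCycle 0 (antidiag a b 0 - (b - a))
  · exact sameCycle_of_right hgen hS ht h0 hl v
  refine sameCycle_of_left hgen hS ht ?_ hr v
  have hz : config a b S t (antidiag a b 0 - (b - a)) = -(b - a) := by
    have hlast : antidiag a b 0 - (b - a) = antidiag a b (addOrderOf (b - a) - 1) := by
      rw [sub_eq_iff_eq_add, ← antidiag_succ, Nat.sub_add_cancel (by omega), antidiag_addOrderOf]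
    rw [config_apply_of_not_movesB hS ht _ (ne_terminal hS ht h0), antidiag]
    · rw [zero_nsmul]; abel
    · rw [hlast]
      exact not_movesB_antidiag hS (by omega) (by omega)
  have key := sameCycle_induction (σ := config a b S t) (v := -(b - a))
    (y := antidiag a b 0 - (b - a))
    (motive := fun y => (config a b S t).SameCycle 0 (y + (b - a)) ∨
      (config a b S t).SameCycle 0 (antidiag a b 0))
    (Or.inl (by rw [neg_add_cancel])) (fun y hy ih => ?_)
    (by rw [← hz]; exact sameCycle_apply_left.2 (SameCycle.refl _ _))
  · rw [sub_add_cancel] at key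
    exact key.elim id id
  refine ih.elim (fun ih => ?_) Or.inr
  by_cases hy0 : y + (b - a) = antidiag a b 0
  · right; rwa [hy0] at ih
  left
  have hyP : ¬ (config a b S t).SameCycle 0 y := by
    rw [← hz, sameCycle_apply_left] at hy
    exact fun h => h0 (h.trans hy.symm)
  rw [← config_add hS ht (ne_terminal hS ht hyP) (fun h => ?_) hy0]
  · exact sameCycle_apply_right.2 ih
  · rw [← h, add_sub_cancel_right] at hl; exact hyP hl

/-- The orbit of `v` has both an arc by `a` and an arc by `b`. -/
def Mixed (a b : G) (σ : Perm G) (v : G) : Prop :=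
  (∃ y, σ.SameCycle v y ∧ σ y = y + a) ∧ ∃ y, σ.SameCycle v y ∧ σ y = y + b

lemma sameCycle_add_of_pure {σ : Perm G} {w c z : G} (h : ∀ y, σ.SameCycle w y → σ y = y + c)
    (hz : z ∈ AddSubgroup.zmultiples c) : σ.SameCycle w (w + z) := by
  classical
  rw [mem_zmultiples_iff_mem_range_addOrderOf] at hz
  simp only [Finset.mem_image, Finset.mem_range] at hz
  obtain ⟨i, -, rfl⟩ := hz
  induction i with
  | zero => simpa using SameCycle.refl _ _
  | succ i ih =>
    rw [succ_nsmul, ← add_assoc, ← h _ ih]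
    exact sameCycle_apply_right.2 ih

lemma exists_nsmul_add_mem_zmultiples {c d : G} (hgen : AddSubgroup.closure {c, d} = ⊤) (v : G) :
    ∃ i : ℕ, v - i • d ∈ AddSubgroup.zmultiples c := by
  obtain ⟨x, y, h⟩ := AddSubgroup.mem_closure_pair.1
    (show v ∈ AddSubgroup.closure {c, d} from hgen ▸ AddSubgroup.mem_top _)
  have hy : y • d ∈ AddSubgroup.zmultiples d := ⟨y, rfl⟩
  classical
  rw [mem_zmultiples_iff_mem_range_addOrderOf] at hy
  simp only [Finset.mem_image, Finset.mem_range] at hy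
  obtain ⟨i, -, hi⟩ := hy
  refine ⟨i, x, ?_⟩
  rw [hi, ← h]
  simp

/-- An orbit with arcs by `c` only meets every orbit having an arc by `d`. -/
lemma sameCycle_of_pure {σ : Perm G} {c d v w : G} (hgen : AddSubgroup.closure {c, d} = ⊤)
    (hw : ∀ y, σ.SameCycle w y → σ y = y + c)
    (hv : ∀ y, σ.SameCycle v y → σ y = y + c ∨ σ y = y + d)
    (hd : ∃ y, σ.SameCycle v y ∧ σ y = y + d) : σ.SameCycle v w := by
  obtain ⟨y, hy, hyd⟩ := hd
  have key : ∀ i : ℕ, ∃ z, σ.SameCycle v z ∧ z - (v + i • d) ∈ AddSubgroup.zmultiples c := by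
    intro i
    induction i with
    | zero => exact ⟨v, SameCycle.refl _ _, by simp [zero_mem]⟩
    | succ i ih =>
      obtain ⟨z, hz, hzi⟩ := ih
      by_contra! hcon
      have hstay := sameCycle_induction (σ := σ) (v := z) (y := y)
        (motive := fun u => u - (v + i • d) ∈ AddSubgroup.zmultiples c) hzi
        (fun u hu ih => by
          have hu' := hz.trans hu
          rcases hv u hu' with h | h
          · rw [h, add_sub_right_comm]
            exact add_mem ih (AddSubgroup.mem_zmultiples c)
          · refine absurd ?_ (hcon _ (sameCycle_apply_right.2 hu'))
            rw [h, succ_nsmul, ← add_assoc, add_sub_add_right_eq_sub]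
            exact ih) (hz.symm.trans hy)
      refine hcon _ (sameCycle_apply_right.2 hy) ?_
      rw [hyd, succ_nsmul, ← add_assoc, add_sub_add_right_eq_sub]
      exact hstay
  obtain ⟨i, hi⟩ := exists_nsmul_add_mem_zmultiples hgen (w - v)
  obtain ⟨z, hz, hzi⟩ := key i
  refine hz.trans (SameCycle.symm ?_)
  have := sameCycle_add_of_pure hw (sub_mem hzi hi)
  rwa [show w + (z - (v + i • d) - (w - v - i • d)) = z by abel] at this

lemma Mixed.of_not_sameCycle {σ : Perm G} {v w : G} (hgen : AddSubgroup.closure {a, b} = ⊤)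
    (hv : ∀ y, σ.SameCycle v y → σ y = y + a ∨ σ y = y + b)
    (hw : ∀ y, σ.SameCycle w y → σ y = y + a ∨ σ y = y + b)
    (hmix : Mixed a b σ v) : Mixed a b σ w := by
  by_cases hvw : σ.SameCycle v w
  · obtain ⟨⟨y, hy, h⟩, z, hz, h'⟩ := hmix
    exact ⟨⟨y, hvw.symm.trans hy, h⟩, z, hvw.symm.trans hz, h'⟩
  constructor
  · by_contra! hcon
    exact hvw (sameCycle_of_pure (c := b) (d := a) (by rwa [Set.pair_comm])
      (fun y hy => (hw y hy).resolve_left (hcon y hy)) (fun y hy => (hv y hy).symm) hmix.1)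
  · by_contra! hcon
    exact hvw (sameCycle_of_pure (c := a) (d := b) hgen
      (fun y hy => (hw y hy).resolve_right (hcon y hy)) hv hmix.2)

lemma dvd_of_nsmul_mem_zmultiples (hgen : AddSubgroup.closure {a, b} = ⊤) {q : ℕ}
    (hq : q • b ∈ AddSubgroup.zmultiples a) : Fintype.card G / addOrderOf a ∣ q := by
  have hcard : Nat.card (G ⧸ AddSubgroup.zmultiples a) = Fintype.card G / addOrderOf a := by
    have := AddSubgroup.card_eq_card_quotient_mul_card_addSubgroup (AddSubgroup.zmultiples a)
    rw [Nat.card_zmultiples, Nat.card_eq_fintype_card] at this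
    rw [this, Nat.mul_div_cancel _ (addOrderOf_pos a)]
  have hord : addOrderOf (QuotientAddGroup.mk b : G ⧸ AddSubgroup.zmultiples a)
      = Nat.card (G ⧸ AddSubgroup.zmultiples a) := by
    refine addOrderOf_eq_card_of_forall_mem_zmultiples fun z => ?_
    obtain ⟨z, rfl⟩ := QuotientAddGroup.mk_surjective z
    obtain ⟨i, hi⟩ := exists_nsmul_add_mem_zmultiples hgen z
    refine ⟨i, ?_⟩
    change QuotientAddGroup.mk ((i : ℤ) • b) = _
    rw [QuotientAddGroup.eq, natCast_zsmul, neg_add_eq_sub]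
    exact hi
  rw [← hcard, ← hord]
  apply addOrderOf_dvd_of_nsmul_eq_zero
  change QuotientAddGroup.mk (q • b) = _
  rwa [QuotientAddGroup.eq_zero_iff]

lemma le_card_orbit_of_mixed (hab : a ≠ b) (hgen : AddSubgroup.closure {a, b} = ⊤) {e : ℕ}
    (heb : (Fintype.card G / addOrderOf a) • b = e • a) (hne : e ≤ Fintype.card G / addOrderOf a)
    {σ : Perm G} {v : G} (hv : ∀ y, σ.SameCycle v y → σ y = y + a ∨ σ y = y + b)
    (hmix : Mixed a b σ v) :
    addOrderOf a + Fintype.card G / addOrderOf a - e ≤ (orbit σ v).card := by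
  classical
  set n := Fintype.card G / addOrderOf a
  set m := addOrderOf a
  set A := (orbit σ v).filter (fun y => σ y = y + a)
  set B := (orbit σ v).filter (fun y => ¬ σ y = y + a)
  have hcard : A.card + B.card = (orbit σ v).card := Finset.card_filter_add_card_filter_not _
  have hsum : ∑ y ∈ orbit σ v, σ y = ∑ y ∈ orbit σ v, y :=
    Finset.sum_equiv σ (fun y => by simp [mem_orbit]) (fun _ _ => rfl)
  have hsum' : ∑ y ∈ orbit σ v, (σ y - y) = 0 := by
    rw [Finset.sum_sub_distrib, hsum, sub_self]
  have hrel : A.card • a + B.card • b = 0 := by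
    rw [← hsum', ← Finset.sum_filter_add_sum_filter_not (orbit σ v) (fun y => σ y = y + a)]
    congr 1
    · refine (Finset.sum_eq_card_nsmul fun y hy => ?_).symm
      rw [(Finset.mem_filter.1 hy).2, add_sub_cancel_left]
    · refine (Finset.sum_eq_card_nsmul fun y hy => ?_).symm
      obtain ⟨h1, h2⟩ := Finset.mem_filter.1 hy
      rw [(hv y (mem_orbit.1 h1)).resolve_left h2, add_sub_cancel_left]
  have hA : 0 < A.card := by
    obtain ⟨y, hy, h⟩ := hmix.1
    exact Finset.card_pos.2 ⟨y, Finset.mem_filter.2 ⟨mem_orbit.2 hy, h⟩⟩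
  have hB : 0 < B.card := by
    obtain ⟨y, hy, h⟩ := hmix.2
    refine Finset.card_pos.2 ⟨y, Finset.mem_filter.2 ⟨mem_orbit.2 hy, fun h' => hab ?_⟩⟩
    exact add_left_cancel (h'.symm.trans h)
  obtain ⟨y, hy⟩ : n ∣ B.card := dvd_of_nsmul_mem_zmultiples hgen <| by
    rw [eq_neg_of_add_eq_zero_right hrel]
    exact neg_mem (AddSubgroup.nsmul_mem_zmultiples _ _)
  obtain ⟨x, hx⟩ : m ∣ A.card + y * e := by
    apply addOrderOf_dvd_of_nsmul_eq_zero
    rw [add_nsmul, mul_nsmul', ← heb, ← mul_nsmul', mul_comm y, ← hy, hrel]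
  have hy1 : 1 ≤ y := Nat.one_le_iff_ne_zero.2 fun h => by rw [h, mul_zero] at hy; omega
  have hx1 : 1 ≤ x := Nat.one_le_iff_ne_zero.2 fun h => by rw [h, mul_zero] at hx; omega
  obtain ⟨d, hd⟩ := Nat.exists_eq_add_of_le hne
  have : m * x ≥ m := Nat.le_mul_of_pos_right _ hx1
  have : d * y ≥ d := Nat.le_mul_of_pos_right _ hy1
  have : n * y = y * e + d * y := by rw [hd]; ring
  omega

/-- Off the path, every orbit is mixed, provided enough vertices travel by each generator. -/
lemma mixed_of_not_sameCycle (hgen : AddSubgroup.closure {a, b} = ⊤)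
    (hS : cls a b (-a) ∉ S) (ht : t < addOrderOf (b - a))
    (hb : S.Nonempty ∨ Fintype.card G / addOrderOf a ≤ t + 1)
    (ha : (∃ q, q ∉ S ∧ q ≠ cls a b (-a)) ∨ t = 0 ∨ addOrderOf a + t ≤ addOrderOf (b - a))
    {e : ℕ} (heb : (Fintype.card G / addOrderOf a) • b = e • a)
    {v : G} (hv : ¬ (config a b S t).SameCycle 0 v) : Mixed a b (config a b S t) v := by
  have hP : ∀ y, (config a b S t).SameCycle v y → ¬ (config a b S t).SameCycle 0 y :=
    fun y hy h => hv (h.trans hy.symm)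
  have hstep : ∀ y, (config a b S t).SameCycle v y →
      config a b S t y = y + a ∨ config a b S t y = y + b :=
    fun y hy => config_apply_eq_or hS ht (ne_terminal hS ht (hP y hy))
  constructor
  · by_cases hq : ∃ q, q ∉ S ∧ q ≠ cls a b (-a)
    · obtain ⟨q, hqS, hq⟩ := hq
      obtain ⟨q, rfl⟩ := QuotientAddGroup.mk_surjective q
      obtain ⟨y, hy, hc⟩ := exists_sameCycle_cls hgen hS ht v q
      refine ⟨y, hy, config_apply_of_not_movesB hS ht ?_ (ne_terminal hS ht (hP y hy))⟩
      rintro (h | ⟨i, -, rfl⟩)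
      · rw [hc] at h; exact hqS h
      · rw [cls_antidiag] at hc; exact hq hc.symm
    rcases ha.resolve_left hq with rfl | ha
    · obtain ⟨y, hy, hc⟩ := exists_sameCycle_cls hgen hS ht v (-a)
      refine ⟨y, hy, config_apply_of_not_movesB hS ht ?_ (ne_terminal hS ht (hP y hy))⟩
      rintro (h | ⟨i, hi, -⟩)
      · exact hS (hc ▸ h)
      · omega
    by_contra! hcon
    obtain ⟨i, hi⟩ := exists_nsmul_add_mem_zmultiples (c := b) (d := a)
      (by rwa [Set.pair_comm]) (-v - (t + 1) • a)
    set l := i % addOrderOf a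
    have hl : l < addOrderOf a := Nat.mod_lt _ (addOrderOf_pos a)
    have hil : i • a = l • a := (mod_addOrderOf_nsmul a i).symm
    have hmem : antidiag a b (t + l) - v ∈ AddSubgroup.zmultiples b := by
      have := add_mem hi (AddSubgroup.nsmul_mem_zmultiples b (t + l))
      rw [hil] at this
      convert this using 1
      simp only [antidiag, nsmul_sub, add_nsmul, one_nsmul]
      abel
    have hcyc := sameCycle_add_of_pure
      (fun y hy => (hstep y hy).resolve_left (hcon y hy)) hmem
    rw [add_sub_cancel] at hcyc
    exact hcon _ hcyc (config_apply_of_not_movesB hS ht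
      (not_movesB_antidiag hS (by omega) (by omega)) (ne_terminal hS ht (hP _ hcyc)))
  · rcases hb with ⟨q, hq⟩ | hb
    · obtain ⟨q, rfl⟩ := QuotientAddGroup.mk_surjective q
      obtain ⟨y, hy, hc⟩ := exists_sameCycle_cls hgen hS ht v q
      exact ⟨y, hy, config_apply_of_movesB hS ht (Or.inl (by rw [hc]; exact hq))⟩
    by_contra! hcon
    set n := Fintype.card G / addOrderOf a
    have hn : 0 < n := Nat.div_pos (addOrderOf_le_card_univ) (addOrderOf_pos a)
    obtain ⟨i, hi⟩ := exists_nsmul_add_mem_zmultiples (c := a) (d := b) hgen v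
    set l := i % n with hl'
    have hl : l < n := Nat.mod_lt _ hn
    have hmem : antidiag a b l - v ∈ AddSubgroup.zmultiples a := by
      have h1 : i • b - l • b ∈ AddSubgroup.zmultiples a := by
        have : i • b = (i / n) • (n • b) + l • b := by
          rw [← mul_nsmul, ← add_nsmul, hl', Nat.div_add_mod]
        rw [this, heb, add_sub_cancel_right]
        exact nsmul_mem (AddSubgroup.nsmul_mem_zmultiples _ _) _
      have := neg_mem (add_mem (add_mem hi h1) (AddSubgroup.nsmul_mem_zmultiples a (l + 1)))
      convert this using 1
      simp only [antidiag, nsmul_sub, add_nsmul, one_nsmul]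
      abel
    have hcyc := sameCycle_add_of_pure
      (fun y hy => (hstep y hy).resolve_right (hcon y hy)) hmem
    rw [add_sub_cancel] at hcyc
    rcases Nat.lt_or_ge l t with h | h
    · exact hcon _ hcyc (config_apply_of_movesB hS ht (Or.inr ⟨l, h, rfl⟩))
    · refine ne_terminal hS ht (hP _ hcyc) ?_
      rw [show l = t by omega]

/-- The configuration is absorbing: it is a hamiltonian path, or the next step lengthens the
path. -/
def Absorbing (a b : G) (S : Finset (G ⧸ AddSubgroup.zmultiples (b - a))) (t : ℕ) : Prop :=
  (∀ v, (config a b S t).SameCycle 0 v) ∨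
    (t + 1 < addOrderOf (b - a) ∧ ¬ (config a b S t).SameCycle 0 (antidiag a b (t + 1)))

lemma absorbing_zero (hab : a ≠ b) (hgen : AddSubgroup.closure {a, b} = ⊤)
    (hS : cls a b (-a) ∉ S) : Absorbing a b S 0 := by
  have hN : 0 < addOrderOf (b - a) := addOrderOf_pos _
  have hN1 : addOrderOf (b - a) ≠ 1 := by
    rw [Ne, AddMonoid.addOrderOf_eq_one_iff, sub_eq_zero]; exact hab.symm
  by_cases h : (config a b S 0).SameCycle 0 (antidiag a b (0 + 1))
  · left
    rw [antidiag_succ] at h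
    exact sameCycle_of_left hgen hS hN (sameCycle_terminal hS hN) h
  · exact Or.inr ⟨by omega, h⟩

lemma absorb_iff (hS : cls a b (-a) ∉ S) (ht : t + 1 < addOrderOf (b - a))
    (hq : ¬ (config a b S t).SameCycle 0 (antidiag a b (t + 1))) {v : G} :
    (config a b S (t + 1)).SameCycle 0 v ↔ (config a b S t).SameCycle 0 v ∨
      (config a b S t).SameCycle (antidiag a b (t + 1)) v := by
  classical
  exact sameCycle_mul_swap_iff_or (config_apply_terminal hS (by omega)) hq

lemma absorbing_succ (hgen : AddSubgroup.closure {a, b} = ⊤)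
    (hS : cls a b (-a) ∉ S) (ht : t + 1 < addOrderOf (b - a))
    (hq : ¬ (config a b S t).SameCycle 0 (antidiag a b (t + 1))) :
    Absorbing a b S (t + 1) := by
  have hl : (config a b S (t + 1)).SameCycle 0 (antidiag a b (t + 1) - (b - a)) := by
    rw [sub_eq_of_eq_add (antidiag_succ a b t), absorb_iff hS ht hq]
    exact Or.inl (sameCycle_terminal hS (by omega))
  by_cases hr : (config a b S (t + 1)).SameCycle 0 (antidiag a b (t + 1 + 1))
  · left
    rw [antidiag_succ a b (t + 1)] at hr
    exact sameCycle_of_neighbors hgen hS ht hl hr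
  · refine Or.inr ⟨?_, hr⟩
    by_contra hlt
    rw [show t + 1 + 1 = addOrderOf (b - a) by omega, antidiag_addOrderOf] at hr
    apply hr
    have hlast : antidiag a b 0 - (b - a) = antidiag a b (t + 1) := by
      rw [sub_eq_iff_eq_add, ← antidiag_succ, show t + 1 + 1 = addOrderOf (b - a) by omega,
        antidiag_addOrderOf]
    exact sameCycle_of_right hgen hS ht (hlast ▸ sameCycle_terminal hS ht) hl _

/-- From an absorbing configuration the path grows until it is hamiltonian. -/
lemma exists_hamiltonian_of_absorbing (hgen : AddSubgroup.closure {a, b} = ⊤)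
    (hS : cls a b (-a) ∉ S) {L : ℕ} (ht : t < addOrderOf (b - a)) (hA : Absorbing a b S t)
    (hL : ∀ v, ¬ (config a b S t).SameCycle 0 v → L ≤ (orbit (config a b S t) v).card) :
    ∃ y, t + y < addOrderOf (b - a) ∧ (∀ v, (config a b S (t + y)).SameCycle 0 v) ∧
      y * L + (orbit (config a b S t) 0).card ≤ Fintype.card G := by
  classical
  induction hd : addOrderOf (b - a) - t generalizing t with
  | zero => omega
  | succ d ih =>
    rcases hA with hA | ⟨ht', hq⟩
    · exact ⟨0, ht, hA, by rw [zero_mul, zero_add]; exact Finset.card_le_univ _⟩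
    have hunion : orbit (config a b S (t + 1)) 0 =
        orbit (config a b S t) 0 ∪ orbit (config a b S t) (antidiag a b (t + 1)) := by
      ext v
      simp only [Finset.mem_union, mem_orbit, absorb_iff hS ht' hq]
    have hdisj : Disjoint (orbit (config a b S t) 0)
        (orbit (config a b S t) (antidiag a b (t + 1))) := by
      rw [Finset.disjoint_left]
      intro v hv hv'
      rw [mem_orbit] at hv hv'
      exact hq (hv.trans hv'.symm)
    obtain ⟨y, hy, hfull, hcard⟩ := ih ht' (absorbing_succ hgen hS ht' hq)
      (fun v hv => by
        rw [absorb_iff hS ht' hq, not_or] at hv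
        have hsame : orbit (config a b S (t + 1)) v = orbit (config a b S t) v := by
          ext w
          rw [mem_orbit, mem_orbit]
          exact sameCycle_mul_swap_iff_of_not
            (fun h => hv.1 ((sameCycle_terminal hS ht).trans h.symm)) (fun h => hv.2 h.symm)
        rw [hsame]
        exact hL v hv.1) (by omega)
    refine ⟨y + 1, by omega, by rwa [show t + (y + 1) = t + 1 + y by omega], ?_⟩
    rw [hunion, Finset.card_union_of_disjoint hdisj] at hcard
    have := hL _ hq
    rw [add_mul, one_mul]
    omega

/-- While the next step splits the path, mixed orbits persist; the process ends at the end of the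
terminal coset or at an absorbing configuration. -/
lemma exists_end_of_splitting (hgen : AddSubgroup.closure {a, b} = ⊤)
    (hS : cls a b (-a) ∉ S) {L : ℕ} (ht : t < addOrderOf (b - a))
    (hmix : ∃ v, ¬ (config a b S t).SameCycle 0 v ∧ Mixed a b (config a b S t) v)
    (hL : ∀ t < addOrderOf (b - a), ∀ v, ¬ (config a b S t).SameCycle 0 v →
      Mixed a b (config a b S t) v → L ≤ (orbit (config a b S t) v).card) :
    ∃ y, t + y < addOrderOf (b - a) ∧ (t + y + 1 = addOrderOf (b - a) ∨
        Absorbing a b S (t + y)) ∧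
      (∃ v, ¬ (config a b S (t + y)).SameCycle 0 v ∧ Mixed a b (config a b S (t + y)) v) ∧
      y * L + (orbit (config a b S (t + y)) 0).card ≤ (orbit (config a b S t) 0).card := by
  classical
  induction hd : addOrderOf (b - a) - t generalizing t with
  | zero => omega
  | succ d ih =>
    by_cases ht' : t + 1 = addOrderOf (b - a)
    · exact ⟨0, ht, Or.inl ht', hmix, by simp⟩
    by_cases hq : (config a b S t).SameCycle 0 (antidiag a b (t + 1))
    swap
    · exact ⟨0, ht, Or.inr (Or.inr ⟨by omega, hq⟩), hmix, by simp⟩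
    replace ht' : t + 1 < addOrderOf (b - a) := by omega
    have hpq : antidiag a b t ≠ antidiag a b (t + 1) := fun h => by
      have := antidiag_injOn ht ht' h; omega
    have hp : ¬ (config a b S (t + 1)).SameCycle 0 (antidiag a b t) :=
      not_sameCycle_mul_swap hpq (config_apply_terminal hS ht) hq
    have hback : config a b S t =
        config a b S (t + 1) * swap (antidiag a b (t + 1)) (antidiag a b t) := by
      rw [config, swap_comm (antidiag a b (t + 1)), mul_assoc, swap_mul_self, mul_one]
    have hiff : ∀ v, (config a b S t).SameCycle 0 v ↔ (config a b S (t + 1)).SameCycle 0 v ∨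
        (config a b S (t + 1)).SameCycle (antidiag a b t) v := fun v => by
      rw [hback]
      exact sameCycle_mul_swap_iff_or (config_apply_terminal hS ht') hp
    have hunion : orbit (config a b S t) 0 =
        orbit (config a b S (t + 1)) 0 ∪ orbit (config a b S (t + 1)) (antidiag a b t) := by
      ext v
      simp only [Finset.mem_union, mem_orbit, hiff]
    have hdisj : Disjoint (orbit (config a b S (t + 1)) 0)
        (orbit (config a b S (t + 1)) (antidiag a b t)) := by
      rw [Finset.disjoint_left]
      intro v hv hv'
      rw [mem_orbit] at hv hv'
      exact hp (hv.trans hv'.symm)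
    obtain ⟨v, hv, ⟨y, hy, hya⟩, z, hz, hzb⟩ := hmix
    have hvp : ∀ w, (config a b S t).SameCycle v w → ¬ (config a b S t).SameCycle 0 w :=
      fun w hw h => hv (h.trans hw.symm)
    have hsame : ∀ w, (config a b S t).SameCycle v w →
        (config a b S (t + 1)).SameCycle v w := fun w hw =>
      (sameCycle_mul_swap_iff_of_not (fun h => hvp _ h (sameCycle_terminal hS ht))
        (fun h => hvp _ h hq)).2 hw
    have happly : ∀ w, (config a b S t).SameCycle v w →
        config a b S (t + 1) w = config a b S t w := fun w hw => by
      refine mul_swap_apply_of_ne ?_ ?_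
      · rintro rfl; exact hvp _ hw (sameCycle_terminal hS ht)
      · rintro rfl; exact hvp _ hw hq
    have hv' : ¬ (config a b S (t + 1)).SameCycle 0 v := fun h => hv ((hiff v).2 (Or.inl h))
    have hmix' : Mixed a b (config a b S (t + 1)) v :=
      ⟨⟨y, hsame y hy, by rw [happly y hy, hya]⟩, z, hsame z hz, by rw [happly z hz, hzb]⟩
    have harc : ∀ w, ¬ (config a b S (t + 1)).SameCycle 0 w →
        ∀ u, (config a b S (t + 1)).SameCycle w u →
        config a b S (t + 1) u = u + a ∨ config a b S (t + 1) u = u + b := fun w hw u hu =>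
      config_apply_eq_or hS ht' (ne_terminal hS ht' fun h => hw (h.trans hu.symm))
    have hlen := hL _ ht' _ hp (Mixed.of_not_sameCycle hgen (harc v hv') (harc _ hp) hmix')
    obtain ⟨y, hy, hend, hm, hcard⟩ := ih ht' ⟨v, hv', hmix'⟩ (by omega)
    have hadd : t + (y + 1) = t + 1 + y := by omega
    refine ⟨y + 1, by omega, ?_, ?_, ?_⟩
    · rwa [hadd]
    · rwa [hadd]
    · rw [hadd, hunion, Finset.card_union_of_disjoint hdisj, add_mul, one_mul]
      omega

lemma card_movesB (hS : cls a b (-a) ∉ S) (ht : t < addOrderOf (b - a)) :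
    Nat.card {v // MovesB a b S t v} = S.card * addOrderOf (b - a) + t := by
  classical
  have h1 : {v | MovesB a b S t v} =
      (QuotientAddGroup.mk ⁻¹' (S : Set (G ⧸ AddSubgroup.zmultiples (b - a)))) ∪
        antidiag a b '' Set.Iio t := by
    ext v
    simp only [MovesB, Set.mem_ofPred_eq, Set.mem_union, Set.mem_preimage, Finset.mem_coe,
      Set.mem_image, Set.mem_Iio, eq_comm (a := v)]
  have h2 : Disjoint (QuotientAddGroup.mk ⁻¹' (S : Set (G ⧸ AddSubgroup.zmultiples (b - a))))
      (antidiag a b '' Set.Iio t) := by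
    rw [Set.disjoint_left]
    rintro v hv ⟨i, -, rfl⟩
    change cls a b (antidiag a b i) ∈ S at hv
    rw [cls_antidiag] at hv
    exact hS hv
  have h3 : (antidiag a b '' Set.Iio t).ncard = t := by
    rw [Set.InjOn.ncard_image]
    · rw [← Finset.coe_Iio, Set.ncard_coe_finset, Nat.card_Iio]
    · intro i hi j hj h
      exact antidiag_injOn (lt_trans hi ht) (lt_trans hj ht) h
  have h4 := Nat.card_congr (QuotientAddGroup.preimageMkEquivAddSubgroupProdSet
    (AddSubgroup.zmultiples (b - a)) (S : Set (G ⧸ AddSubgroup.zmultiples (b - a))))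
  rw [Nat.card_prod, Nat.card_zmultiples] at h4
  change Nat.card {v | MovesB a b S t v} = _
  rw [Nat.card_coe_set_eq, h1, Set.ncard_union_eq h2, h3, ← Nat.card_coe_set_eq, h4,
    Nat.card_coe_set_eq, Set.ncard_coe_finset, mul_comm]

lemma exists_isHamPath (hab : a ≠ b) (hS : cls a b (-a) ∉ S) (ht : t < addOrderOf (b - a))
    (hfull : ∀ v, (config a b S t).SameCycle 0 v) :
    ∃ v : Fin (Fintype.card G) → G, IsHamPath a b (Fintype.card G) v ∧
      delta (Fintype.card G) v b = S.card * addOrderOf (b - a) + t := by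
  set σ := config a b S t
  have hon : σ.IsCycleOn ((Finset.univ : Finset G) : Set G) := by
    refine ⟨by simp, fun x _ y _ => (hfull x).symm.trans (hfull y)⟩
  set v : Fin (Fintype.card G) → G := fun i => (σ ^ (i : ℕ)) 0 with hvdef
  have hsurj : Function.Surjective v := fun y => by
    obtain ⟨i, hi, h⟩ := hon.exists_pow_eq (Finset.mem_univ 0) (Finset.mem_univ y)
    exact ⟨⟨i, hi⟩, h⟩
  have hbij : Function.Bijective v :=
    (Fintype.bijective_iff_surjective_and_card v).2 ⟨hsurj, by simp⟩
  have hne : ∀ (i : ℕ) (h : i + 1 < Fintype.card G), v ⟨i, by omega⟩ ≠ antidiag a b t := by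
    intro i h hi
    have : v ⟨i + 1, h⟩ = v ⟨0, by omega⟩ := by
      have h1 : v ⟨i + 1, h⟩ = σ (v ⟨i, by omega⟩) := by
        simp only [hvdef, pow_succ', Perm.mul_apply]
      rw [h1, hi, config_apply_terminal hS ht]
      simp [hvdef]
    have := hbij.1 this
    simp at this
  have hsucc : ∀ (i : ℕ) (h : i + 1 < Fintype.card G), v ⟨i + 1, h⟩ = σ (v ⟨i, by omega⟩) := by
    intro i h
    simp only [hvdef, pow_succ', Perm.mul_apply]
  have hdiff : ∀ (i : ℕ) (h : i + 1 < Fintype.card G),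
      v ⟨i + 1, h⟩ - v ⟨i, by omega⟩ = b ↔ MovesB a b S t (v ⟨i, by omega⟩) := by
    intro i h
    rw [hsucc i h]
    by_cases hB : MovesB a b S t (v ⟨i, by omega⟩)
    · simp only [hB, iff_true]
      rw [config_apply_of_movesB hS ht hB, add_sub_cancel_left]
    · simp only [hB, iff_false]
      rw [config_apply_of_not_movesB hS ht hB (hne i h), add_sub_cancel_left]
      exact hab
  refine ⟨v, ⟨hbij, fun i h => ?_⟩, ?_⟩
  · rw [hsucc i h]
    rcases config_apply_eq_or hS ht (hne i h) with h' | h' <;> simp [σ, h']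
  · rw [← card_movesB hS ht, delta]
    refine Nat.card_congr (Equiv.ofBijective
      (fun i => ⟨v ⟨i.1, Nat.lt_of_succ_lt i.2.fst⟩, (hdiff i.1 i.2.fst).1 i.2.snd⟩) ⟨?_, ?_⟩)
    · rintro ⟨i, hi⟩ ⟨j, hj⟩ h
      have := hbij.1 (Subtype.ext_iff.1 h)
      simpa using this
    · rintro ⟨y, hy⟩
      obtain ⟨⟨i, hi⟩, rfl⟩ := hsurj y
      have hi' : i + 1 < Fintype.card G := by
        by_contra hcon
        obtain ⟨⟨j, hj⟩, hjt⟩ := hsurj (antidiag a b t)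
        have hji : ¬ j + 1 < Fintype.card G := fun h => hne j h hjt
        have : i = j := by omega
        subst this
        rw [hjt] at hy
        exact not_movesB_antidiag hS le_rfl ht hy
      exact ⟨⟨i, hi', (hdiff i hi').2 hy⟩, rfl⟩

end Configuration

end CayleyHamPath

open CayleyHamPath

/-- Let `m = o(a)`, `n = |G|/m`, and `0 ≤ e < m` with `n·b = e·a`. Assume `m ≥ 2` and
`n ≥ e`. Then for every `k` with `n−1 ≤ k ≤ m(n−1)` there is a hamiltonian path `P` of
`Cay(G; a, b)` with `k ≤ δ_b(P) ≤ k + 2⌊(mn−1)/(m+n−e)⌋`. -/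
theorem delta_gap_hamiltonian_paths {G : Type*} [AddCommGroup G] [Fintype G] (a b : G)
    (hab : a ≠ b) (hgen : AddSubgroup.closure {a, b} = ⊤)
    (m n e : ℕ) (hma : m = addOrderOf a) (hn : n = Fintype.card G / m)
    (he : e < m) (heb : n • b = e • a)
    (hm : 2 ≤ m) (hne : e ≤ n)
    (k : ℕ) (hk1 : n - 1 ≤ k) (hk2 : k ≤ m * (n - 1)) :
    ∃ v : Fin (Fintype.card G) → G,
      IsHamPath a b (Fintype.card G) v ∧
      k ≤ delta (Fintype.card G) v b ∧
      delta (Fintype.card G) v b ≤ k + 2 * ((m * n - 1) / (m + n - e)) := by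
  classical
  subst hma hn
  set m := addOrderOf a with hm_def
  set n := Fintype.card G / m with hn_def
  set N := addOrderOf (b - a) with hN_def
  set r := Nat.card (G ⧸ AddSubgroup.zmultiples (b - a)) with hr_def
  set L := m + n - e with hL_def
  have hmn : m * n = Fintype.card G := Nat.mul_div_cancel' addOrderOf_dvd_card
  have hrN : r * N = Fintype.card G := by
    have := AddSubgroup.card_eq_card_quotient_mul_card_addSubgroup
      (AddSubgroup.zmultiples (b - a))
    rw [Nat.card_zmultiples, Nat.card_eq_fintype_card] at this
    exact this.symm
  have hGpos : 0 < Fintype.card G := Fintype.card_pos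
  have hnpos : 0 < n := Nat.pos_of_ne_zero fun h => by rw [h, mul_zero] at hmn; omega
  have hNpos : 0 < N := addOrderOf_pos _
  have hmk : m + k ≤ r * N := by
    rw [hrN, ← hmn]
    obtain ⟨n', hn'⟩ := Nat.exists_eq_succ_of_ne_zero hnpos.ne'
    rw [hn'] at hk2 ⊢
    rw [Nat.mul_succ]
    simp only [Nat.succ_sub_one] at hk2
    omega
  have hcardq : (Finset.univ.erase (cls a b (-a))).card = r - 1 := by
    rw [Finset.card_erase_of_mem (Finset.mem_univ _), Finset.card_univ, hr_def,
      Nat.card_eq_fintype_card]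
  have hchoose : ∀ s < r, ∃ S : Finset (G ⧸ AddSubgroup.zmultiples (b - a)),
      S.card = s ∧ cls a b (-a) ∉ S ∧ (s + 1 < r → ∃ q, q ∉ S ∧ q ≠ cls a b (-a)) := by
    intro s hs
    obtain ⟨S, hsub, hcard⟩ := Finset.exists_subset_card_eq
      (show s ≤ (Finset.univ.erase (cls a b (-a))).card by omega)
    refine ⟨S, hcard, fun h => Finset.notMem_erase _ _ (hsub h), fun hs' => ?_⟩
    obtain ⟨q, hq, hqS⟩ := Finset.exists_mem_notMem_of_card_lt_card
      (show S.card < (Finset.univ.erase (cls a b (-a))).card by omega)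
    exact ⟨q, hqS, Finset.ne_of_mem_erase hq⟩
  have hlen : ∀ S : Finset (G ⧸ AddSubgroup.zmultiples (b - a)), cls a b (-a) ∉ S →
      ∀ t < N, ∀ v, ¬ (config a b S t).SameCycle 0 v → Mixed a b (config a b S t) v →
      L ≤ (orbit (config a b S t) v).card := fun S hS t ht v hv hmix =>
    le_card_orbit_of_mixed hab hgen heb hne (fun y hy =>
      config_apply_eq_or hS ht (ne_terminal hS ht fun h => hv (h.trans hy.symm))) hmix
  have hpos : ∀ S t, 0 < (orbit (config a b S t) 0).card := fun S t =>
    Finset.card_pos.2 ⟨0, mem_orbit.2 (Equiv.Perm.SameCycle.refl _ _)⟩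
  have hF : ∀ y, y * L + 1 ≤ Fintype.card G → y ≤ (m * n - 1) / L := fun y hy =>
    (Nat.le_div_iff_mul_le (by omega)).2 (by omega)
  have hfinish : ∀ (S : Finset (G ⧸ AddSubgroup.zmultiples (b - a))) (t : ℕ),
      cls a b (-a) ∉ S → t < N → (∀ v, (config a b S t).SameCycle 0 v) →
      k ≤ S.card * N + t → S.card * N + t ≤ k + 2 * ((m * n - 1) / L) →
      ∃ v : Fin (Fintype.card G) → G, IsHamPath a b (Fintype.card G) v ∧
        k ≤ delta (Fintype.card G) v b ∧
        delta (Fintype.card G) v b ≤ k + 2 * ((m * n - 1) / L) := by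
    intro S t hS ht hfull h1 h2
    obtain ⟨v, hv, hd⟩ := exists_isHamPath hab hS ht hfull
    exact ⟨v, hv, hd ▸ h1, hd ▸ h2⟩
  have hkdiv : k / N * N + k % N = k := Nat.div_add_mod' k N
  have hs : k / N < r := Nat.div_lt_of_lt_mul (by rw [mul_comm]; omega)
  have ht : k % N < N := Nat.mod_lt _ hNpos
  generalize k / N = s at hkdiv hs
  generalize k % N = t at hkdiv ht
  obtain ⟨S, rfl, hS, hSq⟩ := hchoose s hs
  by_cases hfull : ∀ v, (config a b S t).SameCycle 0 v
  · exact hfinish S t hS ht hfull (by omega) (by omega)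
  push Not at hfull
  obtain ⟨v, hv⟩ := hfull
  have hb : S.Nonempty ∨ n ≤ t + 1 := by
    rcases S.eq_empty_or_nonempty with rfl | h
    · rw [Finset.card_empty, zero_mul] at hkdiv
      omega
    · exact Or.inl h
  have ha : (∃ q, q ∉ S ∧ q ≠ cls a b (-a)) ∨ t = 0 ∨ m + t ≤ N := by
    by_cases h : S.card + 1 < r
    · exact Or.inl (hSq h)
    · rw [show r = S.card + 1 by omega, add_mul, one_mul] at hmk
      omega
  obtain ⟨x, hx, hend, ⟨w, hw, hwmix⟩, hcard⟩ := exists_end_of_splitting hgen hS ht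
    ⟨v, hv, mixed_of_not_sameCycle hgen hS ht hb ha heb hv⟩ (hlen S hS)
  have hxF : x + 1 ≤ (m * n - 1) / L := by
    refine hF _ ?_
    have hdisj : Disjoint (orbit (config a b S t) 0) (orbit (config a b S t) v) := by
      rw [Finset.disjoint_left]
      intro u hu hu'
      rw [mem_orbit] at hu hu'
      exact hv (hu.trans hu'.symm)
    have h1 := Finset.card_le_univ (orbit (config a b S t) 0 ∪ orbit (config a b S t) v)
    rw [Finset.card_union_of_disjoint hdisj] at h1
    have h2 := hlen S hS t ht v hv (mixed_of_not_sameCycle hgen hS ht hb ha heb hv)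
    have h3 := hpos S (t + x)
    rw [add_mul, one_mul]
    omega
  by_cases hA : Absorbing a b S (t + x)
  · obtain ⟨y, hy, hfull, hcard'⟩ := exists_hamiltonian_of_absorbing hgen hS (L := L) hx hA
      (fun u hu => hlen S hS _ hx u hu (Mixed.of_not_sameCycle hgen
        (fun z hz => config_apply_eq_or hS hx (ne_terminal hS hx fun h => hw (h.trans hz.symm)))
        (fun z hz => config_apply_eq_or hS hx (ne_terminal hS hx fun h => hu (h.trans hz.symm)))
        hwmix))
    have hyF := hF y (by have := hpos S (t + x); omega)
    exact hfinish S (t + x + y) hS hy hfull (by omega) (by omega)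
  replace hend := hend.resolve_right hA
  have hs' : S.card + 1 < r := by
    by_contra hcon
    obtain ⟨z, hz, hza⟩ := hwmix.1
    have hz0 := ne_terminal hS hx fun h => hw (h.trans hz.symm)
    have hzB : MovesB a b S (t + x) z := by
      by_cases hc : cls a b z = cls a b (-a)
      · obtain ⟨i, hi, rfl⟩ := exists_antidiag hc
        refine Or.inr ⟨i, ?_, rfl⟩
        have : i ≠ t + x := fun h => hz0 (by rw [h])
        omega
      · left
        have hSeq : S = Finset.univ.erase (cls a b (-a)) :=
          Finset.eq_of_subset_of_card_le
            (fun q hq => Finset.mem_erase.2 ⟨fun h => hS (h ▸ hq), Finset.mem_univ _⟩) (by omega)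
        rw [hSeq]
        exact Finset.mem_erase.2 ⟨hc, Finset.mem_univ _⟩
    rw [config_apply_of_movesB hS hx hzB] at hza
    exact hab (add_left_cancel hza).symm
  obtain ⟨S', hcS', hS', -⟩ := hchoose _ hs'
  have hne' : S'.Nonempty := Finset.card_pos.1 (by omega)
  obtain ⟨y, hy, hfull, hcard'⟩ := exists_hamiltonian_of_absorbing hgen hS' (L := L) hNpos
    (absorbing_zero hab hgen hS') (fun u hu => hlen S' hS' 0 hNpos u hu
      (mixed_of_not_sameCycle hgen hS' hNpos (Or.inl hne') (Or.inr (Or.inl rfl)) heb hu))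
  have hyF := hF y (by have := hpos S' 0; omega)
  have hjump : S'.card * N = S.card * N + N := by rw [hcS', add_mul, one_mul]
  exact hfinish S' (0 + y) hS' hy hfull (by omega) (by omega)
end

section
/- Let e₁ = (1,0) and e₂ = (0,1) be the standard generators of ℤ_m × ℤ_n, and assume 2 ≤ m ≤ n. For every integer k with 1 ≤ k ≤ m(n−1), there is a hamiltonian path P in Cay(ℤ_m × ℤ_n; e₁, e₂) such that k ≤ δ_{e₂}(P) ≤ k + 2⌊(n−1)/2⌋. -/
/-- One step of the walk that leaves the vertices of `S` along `b` and all others along `a`. -/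
noncomputable def walkStep {G : Type*} [AddCommGroup G] (a b : G) (S : Set G) (v : G) : G :=
  open Classical in if v ∈ S then v + b else v + a

/-- The number of `a`-steps among the first `k` steps of the walk starting at `v`. -/
noncomputable def walkCount {G : Type*} [AddCommGroup G] (a b : G) (S : Set G) (v : G) (k : ℕ) :
    ℤ :=
  open Classical in ∑ i ∈ Finset.range k, if (walkStep a b S)^[i] v ∈ S then 0 else 1

section Walk

variable {G : Type*} [AddCommGroup G] {a b : G} {S T : Set G}

lemma walkCount_succ_of_mem {v : G} {k : ℕ} (h : (walkStep a b S)^[k] v ∈ S) :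
    walkCount a b S v (k + 1) = walkCount a b S v k := by
  simp [walkCount, Finset.sum_range_succ, h]

lemma walkCount_succ_of_notMem {v : G} {k : ℕ} (h : (walkStep a b S)^[k] v ∉ S) :
    walkCount a b S v (k + 1) = walkCount a b S v k + 1 := by
  simp [walkCount, Finset.sum_range_succ, h]

lemma walkCount_zero (v : G) : walkCount a b S v 0 = 0 := by simp [walkCount]

lemma walkCount_mono (v : G) : Monotone (walkCount a b S v) := by
  refine monotone_nat_of_le_succ fun k => ?_
  by_cases h : (walkStep a b S)^[k] v ∈ S
  · rw [walkCount_succ_of_mem h]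
  · rw [walkCount_succ_of_notMem h]; lia

lemma walkCount_le_add (v : G) (k l : ℕ) :
    walkCount a b S v (k + l) ≤ walkCount a b S v k + l := by
  induction l with
  | zero => simp
  | succ l ih =>
    rw [← add_assoc]
    by_cases h : (walkStep a b S)^[k + l] v ∈ S
    · rw [walkCount_succ_of_mem h]; push_cast; lia
    · rw [walkCount_succ_of_notMem h]; push_cast; lia

lemma walkStep_iterate (v : G) (k : ℕ) :
    (walkStep a b S)^[k] v = v + k • b + walkCount a b S v k • (a - b) := by
  induction k with
  | zero => simp [walkCount_zero]
  | succ k ih =>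
    rw [Function.iterate_succ_apply']
    by_cases h : (walkStep a b S)^[k] v ∈ S
    · rw [walkCount_succ_of_mem h, walkStep, if_pos h, ih, succ_nsmul]
      abel
    · rw [walkCount_succ_of_notMem h, walkStep, if_neg h, ih, succ_nsmul, add_zsmul, one_zsmul]
      abel

lemma walkCount_add (v : G) (k l : ℕ) :
    walkCount a b S v (k + l) =
      walkCount a b S v k + walkCount a b S ((walkStep a b S)^[k] v) l := by
  simp only [walkCount, Finset.sum_range_add]
  congr 1
  refine Finset.sum_congr rfl fun i _ => ?_
  rw [Nat.add_comm, Function.iterate_add_apply]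

lemma walkCount_mul_of_periodic {v : G} {p : ℕ} (h : (walkStep a b S)^[p] v = v) (s : ℕ) :
    walkCount a b S v (p * s) = s * walkCount a b S v p := by
  induction s with
  | zero => simp [walkCount_zero]
  | succ s ih =>
    rw [Nat.mul_succ, Nat.add_comm, walkCount_add, h, ih]
    push_cast
    ring

lemma walkStep_iterate_shift (v : G) (z : ℤ) (k : ℕ) :
    (walkStep a b T)^[k] (v + z • (a - b)) = (walkStep a b S)^[k] v +
      (z + walkCount a b T (v + z • (a - b)) k - walkCount a b S v k) • (a - b) := by
  rw [walkStep_iterate, walkStep_iterate, sub_zsmul, add_zsmul]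
  abel

lemma walkCount_le_shift (hTS : T ⊆ S) (v : G) {z : ℤ} (hz : 0 ≤ z) (k : ℕ) :
    walkCount a b S v k ≤ z + walkCount a b T (v + z • (a - b)) k := by
  induction k with
  | zero => simpa [walkCount_zero] using hz
  | succ k ih =>
    have key := walkStep_iterate_shift (a := a) (b := b) (S := S) (T := T) v z k
    by_cases hS : (walkStep a b S)^[k] v ∈ S <;>
    by_cases hT : (walkStep a b T)^[k] (v + z • (a - b)) ∈ T <;>
    simp only [walkCount_succ_of_mem, walkCount_succ_of_notMem, hS, hT, not_false_eq_true] <;>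
    try lia
    by_contra! hlt
    have h0 : z + walkCount a b T (v + z • (a - b)) k - walkCount a b S v k = 0 := by lia
    rw [h0, zero_zsmul, add_zero] at key
    exact hS (hTS (key ▸ hT))

lemma walkCount_lt_shift (hex : ∀ x, x ∉ S → x + (a - b) ∉ T) (v : G) {z : ℤ} (hz : 0 < z)
    (k : ℕ) : walkCount a b S v k < z + walkCount a b T (v + z • (a - b)) k := by
  induction k with
  | zero => simpa [walkCount_zero] using hz
  | succ k ih =>
    have key := walkStep_iterate_shift (a := a) (b := b) (S := S) (T := T) v z k
    by_cases hS : (walkStep a b S)^[k] v ∈ S <;>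
    by_cases hT : (walkStep a b T)^[k] (v + z • (a - b)) ∈ T <;>
    simp only [walkCount_succ_of_mem, walkCount_succ_of_notMem, hS, hT, not_false_eq_true] <;>
    try lia
    by_contra! hlt
    have h1 : z + walkCount a b T (v + z • (a - b)) k - walkCount a b S v k = 1 := by lia
    rw [h1, one_zsmul] at key
    exact hex _ hS (key ▸ hT)

/-- Two periodic walks whose starting points differ by a multiple of `a - b` have the same slope
(one inequality). -/
lemma walkCount_slope_le {N : ℕ} (hN : 0 < N) (hd : N • (a - b) = 0) {v u : G} {z : ℤ}
    (hu : u = v + z • (a - b)) {p q : ℕ} (hp : (walkStep a b S)^[p] v = v)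
    (hq : (walkStep a b S)^[q] u = u) :
    walkCount a b S v p * q ≤ walkCount a b S u q * p := by
  have hu' : u = v + (z + N * |z|) • (a - b) := by
    rw [hu, add_zsmul, mul_comm, mul_zsmul, natCast_zsmul, hd, zsmul_zero, add_zero]
  have hz : 0 ≤ z + N * |z| := by
    have := neg_abs_le z
    have : (1 : ℤ) ≤ N := by exact_mod_cast hN
    nlinarith [abs_nonneg z]
  set C := z + N * |z|
  by_contra! hlt
  have h := walkCount_le_shift (a := a) (b := b) (subset_refl S) v hz (p * (q * (C.toNat + 1)))
  rw [← hu', walkCount_mul_of_periodic hp,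
    show p * (q * (C.toNat + 1)) = q * (p * (C.toNat + 1)) by ring,
    walkCount_mul_of_periodic hq] at h
  push_cast at h
  rw [Int.toNat_of_nonneg hz] at h
  nlinarith

lemma walkCount_slope_eq {N : ℕ} (hN : 0 < N) (hd : N • (a - b) = 0) {v u : G} {z : ℤ}
    (hu : u = v + z • (a - b)) {p q : ℕ} (hp : (walkStep a b S)^[p] v = v)
    (hq : (walkStep a b S)^[q] u = u) :
    walkCount a b S v p * q = walkCount a b S u q * p :=
  le_antisymm (walkCount_slope_le hN hd hu hp hq)
    (walkCount_slope_le (z := -z) hN hd (by rw [hu, neg_zsmul]; abel) hq hp)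

/-- If the walks for `S` and `T = S \ {t}` share a closed orbit avoiding `t`, then `t` is not
periodic for both of them. -/
lemma not_periodic_both {N : ℕ} (hN : 0 < N) (hd : N • (a - b) = 0) {t u : G} {z : ℤ}
    (htS : t ∈ S) (htT : t ∉ T) (hST : ∀ x, x ≠ t → (x ∈ S ↔ x ∈ T))
    (hex : ∀ x, x ∉ S → x + (a - b) ∉ T) (hu : u = t + z • (a - b))
    {p q r : ℕ} (hp : 0 < p) (hq : 0 < q) (hr : 0 < r)
    (hpS : (walkStep a b S)^[p] t = t) (hqT : (walkStep a b T)^[q] t = t)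
    (hrS : (walkStep a b S)^[r] u = u) (hav : ∀ k, (walkStep a b S)^[k] u ≠ t) : False := by
  have hit : ∀ k, (walkStep a b T)^[k] u = (walkStep a b S)^[k] u := by
    intro k
    induction k with
    | zero => rfl
    | succ k ih =>
      rw [Function.iterate_succ_apply', Function.iterate_succ_apply', ih]
      classical exact if_congr (hST _ (hav k)).symm rfl rfl
  have hcnt : walkCount a b T u r = walkCount a b S u r := by
    refine Finset.sum_congr rfl fun k _ => ?_
    rw [hit]
    classical exact if_congr (hST _ (hav k)).symm rfl rfl
  have h1 := walkCount_slope_eq hN hd hu hpS hrS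
  have h2 := walkCount_slope_eq hN hd hu hqT (by rw [hit, hrS])
  rw [hcnt] at h2
  have h3 : walkCount a b S t (p * q) < walkCount a b T t (p * q) := by
    obtain ⟨k, hk⟩ : ∃ k, p * q = 1 + k := ⟨p * q - 1, by have := Nat.mul_pos hp hq; lia⟩
    rw [hk, walkCount_add, walkCount_add]
    have e1 : walkCount a b S t 1 = 0 := by
      rw [← zero_add 1, walkCount_succ_of_mem (by simpa using htS), walkCount_zero]
    have e2 : walkCount a b T t 1 = 1 := by
      rw [← zero_add 1, walkCount_succ_of_notMem (by simpa using htT), walkCount_zero, zero_add]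
    have e3 := walkCount_lt_shift hex (t + b) zero_lt_one k
    rw [e1, e2, Function.iterate_one, Function.iterate_one, walkStep, walkStep, if_pos htS,
      if_neg htT]
    rw [one_zsmul, show t + b + (a - b) = t + a by abel] at e3
    lia
  rw [walkCount_mul_of_periodic hpS, Nat.mul_comm, walkCount_mul_of_periodic hqT] at h3
  have : (0 : ℤ) < r := by exact_mod_cast hr
  nlinarith

end Walk

section Merge

variable {α : Type*}

lemma iterate_eq_pow_of_not_sameCycle {π : Equiv.Perm α} {f : α → α} {t u : α}
    (hf : ∀ v, v ≠ t → f v = π v) (hu : ¬ π.SameCycle t u) (k : ℕ) : f^[k] u = (π ^ k) u := by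
  induction k with
  | zero => rfl
  | succ k ih =>
    rw [Function.iterate_succ_apply', ih, pow_succ', Equiv.Perm.mul_apply]
    refine hf _ fun h => hu ?_
    rw [← h]
    exact (Equiv.Perm.sameCycle_pow_left.2 (Equiv.Perm.SameCycle.refl _ _))

lemma exists_iterate_eq_self_of_sameCycle [Finite α] {π : Equiv.Perm α} {f : α → α} {s t : α}
    (hf : ∀ v, v ≠ t → f v = π v) (hts : f t = π s) (h : π.SameCycle s t) :
    ∃ k, 0 < k ∧ f^[k] t = t := by
  classical
  have hex : ∃ i, 0 < i ∧ (π ^ i) s = t := by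
    have := Fintype.ofFinite α
    obtain ⟨i, hi, -, h⟩ := h.exists_pow_eq''
    exact ⟨i, hi, h⟩
  obtain ⟨hpos, hfind⟩ := Nat.find_spec hex
  have hmin := fun l => @Nat.find_min _ _ hex l
  set i := Nat.find hex
  have key : ∀ l, l + 1 ≤ i → f^[l + 1] t = (π ^ (l + 1)) s := by
    intro l
    induction l with
    | zero => intro _; simpa using hts
    | succ l ih =>
      intro hl
      rw [Function.iterate_succ_apply', ih (by lia), pow_succ' π (l + 1), Equiv.Perm.mul_apply]
      exact hf _ fun h => hmin (l + 1) (by lia) ⟨by lia, h⟩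
  obtain ⟨l, hl⟩ : ∃ l, i = l + 1 := ⟨i - 1, by lia⟩
  exact ⟨l + 1, by lia, by rw [key l (by lia), ← hl, hfind]⟩

/-- If every point outside `z 0, …, z (q - 1)` moves along `e`, and these points lie on different
`e`-lines such that `z (s + 1)` moves to the line of `z s`, then all points on the lines are in the
cycle of `z 0`. -/
lemma sameCycle_of_lines {G : Type*} [AddCommGroup G] {π : Equiv.Perm G} {e : G} {q : ℕ}
    {z : ℕ → G} (hline : ∀ s < q, ∀ s' < q, ∀ i : ℕ, z s' + i • e = z s → s' = s)
    (hz : ∀ s, s + 1 < q → ∃ i : ℕ, π (z (s + 1)) + i • e = z s)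
    (hπ : ∀ u, (∀ s < q, u ≠ z s) → π u = u + e) (s : ℕ) (hs : s < q) (i : ℕ) (u : G)
    (hu : u + i • e = z s) : π.SameCycle (z 0) u := by
  induction s generalizing i u with
  | zero =>
    induction i generalizing u with
    | zero => rw [← hu, zero_nsmul, add_zero]
    | succ i ih =>
      by_cases h : ∃ s' < q, u = z s'
      · obtain ⟨s', hs', rfl⟩ := h
        rw [hline 0 hs s' hs' _ hu]
      · push Not at h
        refine Equiv.Perm.sameCycle_apply_right.1 (ih _ ?_)
        rw [hπ u h, ← hu, succ_nsmul']
        abel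
  | succ s ih₁ =>
    obtain ⟨l, hl⟩ := hz s hs
    have hbase := Equiv.Perm.sameCycle_apply_right.1 (ih₁ (by lia) l _ hl)
    induction i generalizing u with
    | zero => rwa [← hu, zero_nsmul, add_zero] at hbase
    | succ i ih =>
      by_cases h : ∃ s' < q, u = z s'
      · obtain ⟨s', hs', rfl⟩ := h
        rwa [hline (s + 1) hs s' hs' _ hu]
      · push Not at h
        refine Equiv.Perm.sameCycle_apply_right.1 (ih _ ?_)
        rw [hπ u h, ← hu, succ_nsmul']
        abel

variable [Finite α] [DecidableEq α]

lemma sameCycle_mul_swap {π : Equiv.Perm α} {s t v : α} (h : ¬ π.SameCycle s t)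
    (hv : π.SameCycle t v) : (π * Equiv.swap s t).SameCycle s v := by
  obtain ⟨i, hi, hiv⟩ : ∃ i, 0 < i ∧ (π ^ i) t = v := by
    have := Fintype.ofFinite α
    obtain ⟨i, hi, -, h⟩ := hv.exists_pow_eq''
    exact ⟨i, hi, h⟩
  have hs : (π * Equiv.swap s t) s = π t := by simp
  have key : ∀ l, (π * Equiv.swap s t).SameCycle s ((π ^ (l + 1)) t) := by
    intro l
    induction l with
    | zero =>
      rw [zero_add, pow_one, ← hs]
      exact Equiv.Perm.sameCycle_apply_right.2 (Equiv.Perm.SameCycle.refl _ _)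
    | succ l ih =>
      rw [pow_succ' π (l + 1), Equiv.Perm.mul_apply]
      by_cases ht : (π ^ (l + 1)) t = t
      · rw [ht, ← hs]
        exact Equiv.Perm.sameCycle_apply_right.2 (Equiv.Perm.SameCycle.refl _ _)
      · have hne : (π ^ (l + 1)) t ≠ s := fun hx => h (by
          rw [← hx]
          exact Equiv.Perm.sameCycle_pow_left.2 (Equiv.Perm.SameCycle.refl _ _))
        have e : (π * Equiv.swap s t) ((π ^ (l + 1)) t) = π ((π ^ (l + 1)) t) := by
          rw [Equiv.Perm.mul_apply, Equiv.swap_apply_of_ne_of_ne hne ht]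
        rw [← e]
        exact Equiv.Perm.sameCycle_apply_right.2 ih
  obtain ⟨l, rfl⟩ : ∃ l, i = l + 1 := ⟨i - 1, by lia⟩
  exact hiv ▸ key l

lemma ncard_sameCycle_mul_swap {π : Equiv.Perm α} {s t : α} (h : ¬ π.SameCycle s t) :
    {v | π.SameCycle s v}.ncard + {v | π.SameCycle t v}.ncard ≤
      {v | (π * Equiv.swap s t).SameCycle t v}.ncard := by
  have h' : ¬ π.SameCycle t s := fun hx => h hx.symm
  have hst := sameCycle_mul_swap h (Equiv.Perm.SameCycle.refl _ _)
  rw [← Set.ncard_union_eq]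
  · refine Set.ncard_le_ncard ?_
    rintro v (hv | hv)
    · have := sameCycle_mul_swap h' hv
      rwa [Equiv.swap_comm] at this
    · exact hst.symm.trans (sameCycle_mul_swap h hv)
  · rw [Set.disjoint_left]
    exact fun v h1 h2 => h (Equiv.Perm.SameCycle.trans h1 (Equiv.Perm.SameCycle.symm h2))

end Merge

section Torus

variable {m n : ℕ}

/-- The vertices of `ℤ_m × ℤ_n`, listed along the cosets of the subgroup generated by `(1, -1)`. -/
def diagVertex (m n r : ℕ) : ZMod m × ZMod n :=
  (-(r : ZMod m), ((r / Nat.lcm m n : ℕ) : ZMod n) + (r : ZMod n))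

/-- The first `j` vertices in the diagonal listing. -/
def diagSet (m n j : ℕ) : Set (ZMod m × ZMod n) := diagVertex m n '' Set.Iio j

/-- The walk on the torus that travels by `(0, 1)` exactly from the first `j` vertices. -/
noncomputable abbrev diagStep (m n j : ℕ) : ZMod m × ZMod n → ZMod m × ZMod n :=
  walkStep (1, 0) (0, 1) (diagSet m n j)

/-- The permutation that agrees with `diagStep m n j`, except that it sends `diagVertex m n j` to
the only vertex that is not hit from elsewhere. -/
def diagPerm (m n : ℕ) : ℕ → Equiv.Perm (ZMod m × ZMod n)
  | 0 => Equiv.addRight (1, 0)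
  | j + 1 => if Nat.lcm m n ∣ j + 1 then diagPerm m n j
      else diagPerm m n j * Equiv.swap (diagVertex m n j) (diagVertex m n (j + 1))

lemma diagVertex_add_of_not_dvd {r : ℕ} (h : ¬ Nat.lcm m n ∣ r + 1) :
    diagVertex m n r + (0, 1) = diagVertex m n (r + 1) + (1, 0) := by
  simp only [diagVertex, Nat.succ_div_of_not_dvd h, Prod.mk_add_mk, Prod.mk.injEq]
  push_cast
  constructor <;> ring

lemma natCast_eq_zero_left {r : ℕ} (h : Nat.lcm m n ∣ r) : (r : ZMod m) = 0 :=
  (ZMod.natCast_eq_zero_iff _ _).2 ((Nat.dvd_lcm_left m n).trans h)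

lemma natCast_eq_zero_right {r : ℕ} (h : Nat.lcm m n ∣ r) : (r : ZMod n) = 0 :=
  (ZMod.natCast_eq_zero_iff _ _).2 ((Nat.dvd_lcm_right m n).trans h)

lemma diagVertex_add_of_dvd (hL : 0 < Nat.lcm m n) {r : ℕ} (h : Nat.lcm m n ∣ r + 1) :
    diagVertex m n r + (0, 1) =
      diagVertex m n (Nat.lcm m n * (r / Nat.lcm m n)) + (1, 0) := by
  have h1 := natCast_eq_zero_left h
  have h2 := natCast_eq_zero_right h
  have h3 := natCast_eq_zero_left (Nat.dvd_mul_right (Nat.lcm m n) (r / Nat.lcm m n))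
  have h4 := natCast_eq_zero_right (Nat.dvd_mul_right (Nat.lcm m n) (r / Nat.lcm m n))
  push_cast at h1 h2
  simp only [diagVertex, Nat.mul_div_cancel_left _ hL, Prod.mk_add_mk, Prod.mk.injEq, h3, h4]
  constructor
  · linear_combination -h1
  · linear_combination h2

lemma diagVertex_injOn (hm : 0 < m) (hn : 0 < n) :
    Set.InjOn (diagVertex m n) (Set.Iio (m * n)) := by
  intro r hr s hs h
  have hL := Nat.lcm_pos hm hn
  simp only [Set.mem_Iio] at hr hs
  simp only [diagVertex, Prod.mk.injEq, neg_inj, ← Nat.cast_add, ZMod.natCast_eq_natCast_iff] at h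
  obtain ⟨h1, h2⟩ := h
  rw [← Nat.gcd_mul_lcm] at hr hs
  have h3 : r / Nat.lcm m n ≡ s / Nat.lcm m n [MOD Nat.gcd m n] :=
    Nat.ModEq.add_right_cancel (h1.of_dvd (Nat.gcd_dvd_left m n))
      (h2.of_dvd (Nat.gcd_dvd_right m n))
  have h4 : r / Nat.lcm m n = s / Nat.lcm m n :=
    h3.eq_of_lt_of_lt ((Nat.div_lt_iff_lt_mul hL).2 hr) ((Nat.div_lt_iff_lt_mul hL).2 hs)
  rw [h4] at h2
  have h5 : r ≡ s [MOD Nat.lcm m n] := by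
    have h2' := Nat.ModEq.add_left_cancel' _ h2
    rw [Nat.modEq_iff_dvd, Int.natCast_dvd] at h1 h2' ⊢
    exact Nat.lcm_dvd h1 h2'
  rw [← Nat.div_add_mod r (Nat.lcm m n), ← Nat.div_add_mod s (Nat.lcm m n), h4, h5]

lemma diagVertex_mem_diagSet (hm : 0 < m) (hn : 0 < n) {r j : ℕ} (hr : r < m * n)
    (hj : j ≤ m * n) : diagVertex m n r ∈ diagSet m n j ↔ r < j := by
  refine ⟨?_, fun h => ⟨r, h, rfl⟩⟩
  rintro ⟨s, hs, h⟩
  rw [Set.mem_Iio] at hs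
  rwa [← diagVertex_injOn hm hn (show s < m * n by lia) hr h]

lemma mem_diagSet_succ {j : ℕ} {v : ZMod m × ZMod n} (hv : v ≠ diagVertex m n j) :
    v ∈ diagSet m n (j + 1) ↔ v ∈ diagSet m n j := by
  constructor
  · rintro ⟨r, hr, rfl⟩
    rw [Set.mem_Iio] at hr
    have : r ≠ j := fun h => hv (by rw [h])
    exact ⟨r, show r < j by lia, rfl⟩
  · rintro ⟨r, hr, rfl⟩
    exact ⟨r, Nat.lt_succ_of_lt hr, rfl⟩

lemma add_notMem_diagSet (hL : 0 < Nat.lcm m n) {j : ℕ} {v : ZMod m × ZMod n}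
    (hv : v ∉ diagSet m n (j + 1)) : v + ((1, 0) - (0, 1)) ∉ diagSet m n j := by
  rintro ⟨r, hr, h⟩
  rw [Set.mem_Iio] at hr
  have key : ∀ s, diagVertex m n r + (0, 1) = diagVertex m n s + (1, 0) → v = diagVertex m n s := by
    intro s hs
    rw [h] at hs
    have : v + (1, 0) = diagVertex m n s + (1, 0) := by rw [← hs]; abel
    exact add_right_cancel this
  apply hv
  by_cases hd : Nat.lcm m n ∣ r + 1
  · refine ⟨_, ?_, (key _ (diagVertex_add_of_dvd hL hd)).symm⟩
    have := Nat.mul_div_le r (Nat.lcm m n)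
    rw [Set.mem_Iio]; lia
  · exact ⟨r + 1, by rw [Set.mem_Iio]; lia, (key _ (diagVertex_add_of_not_dvd hd)).symm⟩

lemma diagStep_succ_of_ne {j : ℕ} {v : ZMod m × ZMod n} (hv : v ≠ diagVertex m n j) :
    diagStep m n (j + 1) v = diagStep m n j v := by
  classical exact if_congr (mem_diagSet_succ hv) rfl rfl

lemma diagStep_of_lt {r j : ℕ} (h : r < j) :
    diagStep m n j (diagVertex m n r) = diagVertex m n r + (0, 1) :=
  if_pos ⟨r, h, rfl⟩

lemma diagStep_of_le (hm : 0 < m) (hn : 0 < n) {r j : ℕ} (hr : r < m * n) (h : j ≤ r) :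
    diagStep m n j (diagVertex m n r) = diagVertex m n r + (1, 0) :=
  if_neg (by rw [diagVertex_mem_diagSet hm hn hr (by lia)]; lia)

lemma diagVertex_ne_succ (hm : 0 < m) (hn : 0 < n) {j : ℕ} (hj : j + 1 < m * n) :
    diagVertex m n (j + 1) ≠ diagVertex m n j := fun h => by
  have := diagVertex_injOn hm hn hj (show j < m * n by lia) h
  lia

lemma diagPerm_spec (hm : 0 < m) (hn : 0 < n) (j : ℕ) (hj : j < m * n) :
    (∀ v, v ≠ diagVertex m n j → diagStep m n j v = diagPerm m n j v) ∧
      diagPerm m n j (diagVertex m n j) =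
        diagVertex m n (Nat.lcm m n * (j / Nat.lcm m n)) + (1, 0) := by
  have hL := Nat.lcm_pos hm hn
  induction j with
  | zero =>
    refine ⟨fun v _ => ?_, by simp [diagPerm]⟩
    simp [diagPerm, diagStep, walkStep, diagSet]
  | succ j ih =>
    obtain ⟨ih1, ih2⟩ := ih (by lia)
    have hne := diagVertex_ne_succ hm hn hj
    by_cases hd : Nat.lcm m n ∣ j + 1
    · simp only [diagPerm, if_pos hd]
      refine ⟨fun v _ => ?_, ?_⟩
      · by_cases hvj : v = diagVertex m n j
        · rw [hvj, ih2, diagStep_of_lt (Nat.lt_succ_self j), diagVertex_add_of_dvd hL hd]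
        · rw [diagStep_succ_of_ne hvj, ih1 v hvj]
      · rw [← ih1 _ hne, diagStep_of_le hm hn hj (by lia), Nat.mul_div_cancel' hd]
    · simp only [diagPerm, if_neg hd, Equiv.Perm.mul_apply]
      refine ⟨fun v hv => ?_, ?_⟩
      · by_cases hvj : v = diagVertex m n j
        · rw [hvj, Equiv.swap_apply_left, ← ih1 _ hne, diagStep_of_lt (Nat.lt_succ_self j),
            diagStep_of_le hm hn hj (by lia), diagVertex_add_of_not_dvd hd]
        · rw [Equiv.swap_apply_of_ne_of_ne hvj hv, diagStep_succ_of_ne hvj, ih1 v hvj]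
      · rw [Equiv.swap_apply_right, ih2, Nat.succ_div_of_not_dvd hd]

lemma exists_eq_add_nsmul_add_zsmul [NeZero n] (u v : ZMod m × ZMod n) :
    ∃ (k : ℕ) (z : ℤ),
      v = u + k • ((0, 1) : ZMod m × ZMod n) + z • ((1, 0) - (0, 1) : ZMod m × ZMod n) := by
  obtain ⟨z, hz⟩ := ZMod.intCast_surjective (v.1 - u.1)
  refine ⟨(v.2 - u.2 + z).val, z, ?_⟩
  ext
  · simp [hz]
  · simp
    ring

lemma lcm_nsmul_sub :
    Nat.lcm m n • (((1, 0) : ZMod m × ZMod n) - (0, 1)) = 0 := by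
  ext
  · simp [natCast_eq_zero_left (m := m) (n := n) dvd_rfl]
  · simp [natCast_eq_zero_right (m := m) (n := n) dvd_rfl]

variable [NeZero m] [NeZero n]

/-- If the last vertex of the path is periodic for both walks that extend the path, then the path
is hamiltonian. -/
lemma sameCycle_of_periodic_both {j p q : ℕ} (hj : j < m * n) (hp : 0 < p) (hq : 0 < q)
    (hpj : (diagStep m n (j + 1))^[p] (diagVertex m n j) = diagVertex m n j)
    (hqj : (diagStep m n j)^[q] (diagVertex m n j) = diagVertex m n j) (v : ZMod m × ZMod n) :
    (diagPerm m n j).SameCycle (diagVertex m n j) v := by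
  by_contra hv
  have hm := NeZero.pos m
  have hn := NeZero.pos n
  have hL := Nat.lcm_pos hm hn
  have hspec : ∀ v, v ≠ diagVertex m n j → diagStep m n (j + 1) v = diagPerm m n j v :=
    fun v hv => (diagStep_succ_of_ne hv).trans ((diagPerm_spec hm hn j hj).1 v hv)
  obtain ⟨k, z, hkz⟩ := exists_eq_add_nsmul_add_zsmul v (diagVertex m n j)
  set u := (diagStep m n (j + 1))^[k] v with hu
  have hu' : ¬ (diagPerm m n j).SameCycle (diagVertex m n j) u := by
    rw [hu, iterate_eq_pow_of_not_sameCycle hspec hv]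
    exact fun h => hv (Equiv.Perm.sameCycle_pow_right.1 h)
  have hit := iterate_eq_pow_of_not_sameCycle hspec hu'
  rw [diagStep, walkStep_iterate] at hu
  refine not_periodic_both (S := diagSet m n (j + 1)) (T := diagSet m n j) (u := u)
    (t := diagVertex m n j) (r := orderOf (diagPerm m n j))
    (z := walkCount (1, 0) (0, 1) (diagSet m n (j + 1)) v k - z)
    hL lcm_nsmul_sub ⟨j, Nat.lt_succ_self j, rfl⟩ ?_ (fun x hx => mem_diagSet_succ hx)
    (fun x hx => add_notMem_diagSet hL hx) ?_ hp hq (orderOf_pos _) hpj hqj ?_ ?_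
  · rw [diagVertex_mem_diagSet hm hn hj hj.le]; lia
  · rw [hu, hkz, sub_zsmul]; abel
  · rw [hit, pow_orderOf_eq_one]; rfl
  · intro k hk
    rw [hit] at hk
    exact hu' (by rw [← hk]; exact Equiv.Perm.sameCycle_pow_left.2 (Equiv.Perm.SameCycle.refl _ _))

/-- The endpoint of the path is periodic for the walk that extends the path along `(0, 1)`. -/
def PeriodicNext (m n j : ℕ) : Prop :=
  ∃ p, 0 < p ∧ (diagStep m n (j + 1))^[p] (diagVertex m n j) = diagVertex m n j

/-- The endpoint of the path is periodic for the walk that extends the path along `(1, 0)`. -/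
def PeriodicPrev (m n j : ℕ) : Prop :=
  ∃ p, 0 < p ∧ (diagStep m n j)^[p] (diagVertex m n j) = diagVertex m n j

/-- The path in the configuration `j` visits every vertex. -/
def IsFull (m n j : ℕ) : Prop := ∀ v, (diagPerm m n j).SameCycle (diagVertex m n j) v

/-- The vertices visited by the path in the configuration `j`. -/
def visited (m n j : ℕ) : Set (ZMod m × ZMod n) :=
  {v | (diagPerm m n j).SameCycle (diagVertex m n j) v}

lemma merge_next {j : ℕ} (hj : j < m * n) (h : ¬ PeriodicNext m n j) :
    j + 1 < m * n ∧ PeriodicPrev m n (j + 1) ∧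
      ¬ (diagPerm m n j).SameCycle (diagVertex m n j) (diagVertex m n (j + 1)) ∧
      (visited m n j).ncard +
        {v | (diagPerm m n j).SameCycle (diagVertex m n (j + 1)) v}.ncard ≤
        (visited m n (j + 1)).ncard := by
  have hm := NeZero.pos m
  have hn := NeZero.pos n
  have hL := Nat.lcm_pos hm hn
  obtain ⟨hs1, hs2⟩ := diagPerm_spec hm hn j hj
  have hspec : ∀ v, v ≠ diagVertex m n j → diagStep m n (j + 1) v = diagPerm m n j v :=
    fun v hv => (diagStep_succ_of_ne hv).trans (hs1 v hv)
  have hd : ¬ Nat.lcm m n ∣ j + 1 := fun hd => h <| by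
    refine exists_iterate_eq_self_of_sameCycle hspec ?_ (Equiv.Perm.SameCycle.refl _ _)
    rw [diagStep_of_lt (Nat.lt_succ_self j), hs2, diagVertex_add_of_dvd hL hd]
  have hj' : j + 1 < m * n := by
    refine lt_of_le_of_ne hj fun he => hd ?_
    rw [he, ← Nat.gcd_mul_lcm]
    exact Nat.dvd_mul_left _ _
  have hne := diagVertex_ne_succ hm hn hj'
  have hnot : ¬ (diagPerm m n j).SameCycle (diagVertex m n j) (diagVertex m n (j + 1)) :=
    fun hsame => h <| by
      refine exists_iterate_eq_self_of_sameCycle hspec ?_ hsame.symm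
      rw [diagStep_of_lt (Nat.lt_succ_self j), ← hs1 _ hne, diagStep_of_le hm hn hj' (by lia),
        diagVertex_add_of_not_dvd hd]
  refine ⟨hj', ⟨orderOf (diagPerm m n j), orderOf_pos _, ?_⟩, hnot, ?_⟩
  · rw [iterate_eq_pow_of_not_sameCycle hspec hnot, pow_orderOf_eq_one]; rfl
  · have := ncard_sameCycle_mul_swap hnot
    simpa only [visited, diagPerm, if_neg hd] using this

lemma merge_prev {j : ℕ} (hj : j < m * n) (h : ¬ PeriodicPrev m n j) :
    ∃ i, j = i + 1 ∧ PeriodicNext m n i ∧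
      ¬ (diagPerm m n j).SameCycle (diagVertex m n j) (diagVertex m n i) ∧
      (visited m n j).ncard + {v | (diagPerm m n j).SameCycle (diagVertex m n i) v}.ncard ≤
        (visited m n i).ncard := by
  have hm := NeZero.pos m
  have hn := NeZero.pos n
  have hL := Nat.lcm_pos hm hn
  obtain ⟨hs1, hs2⟩ := diagPerm_spec hm hn j hj
  have hd : ¬ Nat.lcm m n ∣ j := fun hd => h <| by
    refine exists_iterate_eq_self_of_sameCycle hs1 ?_ (Equiv.Perm.SameCycle.refl _ _)
    rw [diagStep_of_le hm hn hj le_rfl, hs2, Nat.mul_div_cancel' hd]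
  obtain ⟨i, rfl⟩ : ∃ i, j = i + 1 := by
    cases j with
    | zero => exact absurd (dvd_zero _) hd
    | succ i => exact ⟨i, rfl⟩
  have hne := diagVertex_ne_succ hm hn hj
  have hnot : ¬ (diagPerm m n (i + 1)).SameCycle (diagVertex m n (i + 1)) (diagVertex m n i) :=
    fun hsame => h <| by
      refine exists_iterate_eq_self_of_sameCycle hs1 ?_ hsame.symm
      rw [← hs1 _ hne.symm, diagStep_of_lt (Nat.lt_succ_self i), diagStep_of_le hm hn hj le_rfl,
        diagVertex_add_of_not_dvd hd]
  refine ⟨i, rfl, ⟨orderOf (diagPerm m n (i + 1)), orderOf_pos _, ?_⟩, hnot, ?_⟩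
  · rw [iterate_eq_pow_of_not_sameCycle hs1 hnot, pow_orderOf_eq_one]; rfl
  · have := ncard_sameCycle_mul_swap hnot
    have e : diagPerm m n (i + 1) * Equiv.swap (diagVertex m n (i + 1)) (diagVertex m n i) =
        diagPerm m n i := by
      rw [diagPerm, if_neg hd, Equiv.swap_comm, mul_assoc, Equiv.swap_mul_self, mul_one]
    simpa only [visited, e] using this

lemma le_lcm_right : n ≤ Nat.lcm m n :=
  Nat.le_of_dvd (Nat.lcm_pos (NeZero.pos m) (NeZero.pos n)) (Nat.dvd_lcm_right m n)

lemma diagVertex_of_lt {r : ℕ} (hr : r < n) : diagVertex m n r = (-(r : ZMod m), (r : ZMod n)) := by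
  simp [diagVertex, Nat.div_eq_of_lt (hr.trans_le (le_lcm_right (m := m)))]

lemma exists_row_vertex (u : ZMod m × ZMod n) :
    ∃ i < m, ∃ r < n, u + i • ((1, 0) : ZMod m × ZMod n) = diagVertex m n r := by
  refine ⟨(-(u.2.val : ZMod m) - u.1).val, ZMod.val_lt _, u.2.val, ZMod.val_lt _, ?_⟩
  rw [diagVertex_of_lt (ZMod.val_lt _)]
  ext <;> simp

lemma exists_column_vertex (u : ZMod m × ZMod n) :
    ∃ i < n, ∃ r, m * (n - 1) ≤ r ∧ r < m * n ∧
      u + i • ((0, 1) : ZMod m × ZMod n) = diagVertex m n r := by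
  have hle : m * (n - 1) + m = m * n := by
    rw [← Nat.mul_succ, Nat.succ_eq_add_one, Nat.sub_add_cancel (NeZero.pos n)]
  have hlt := ZMod.val_lt (-u.1 - ((m * (n - 1) : ℕ) : ZMod m))
  refine ⟨((diagVertex m n (m * (n - 1) + (-u.1 - ((m * (n - 1) : ℕ) : ZMod m)).val)).2 - u.2).val,
    ZMod.val_lt _, m * (n - 1) + (-u.1 - ((m * (n - 1) : ℕ) : ZMod m)).val, by lia, by lia, ?_⟩
  ext
  · simp [diagVertex]
  · simp

/-- A closed orbit that avoids the path uses both kinds of steps, hence is long. -/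
lemma add_le_ncard_of_not_sameCycle {j : ℕ} (h1 : n - 1 ≤ j) (h2 : j ≤ m * (n - 1))
    {u : ZMod m × ZMod n} (hu : ¬ (diagPerm m n j).SameCycle (diagVertex m n j) u) :
    m + n ≤ {v | (diagPerm m n j).SameCycle u v}.ncard := by
  have hm := NeZero.pos m
  have hn := NeZero.pos n
  have hj : j < m * n := h2.trans_lt (Nat.mul_lt_mul_of_pos_left (by lia) hm)
  obtain ⟨hs1, -⟩ := diagPerm_spec hm hn j hj
  have hit := iterate_eq_pow_of_not_sameCycle hs1 hu
  set p := Function.minimalPeriod (diagPerm m n j) u with hp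
  have hp0 : 0 < p := Function.minimalPeriod_pos_of_mem_periodicPts
    ⟨_, orderOf_pos (diagPerm m n j), by
      rw [Function.IsPeriodicPt, Equiv.Perm.iterate_eq_pow, pow_orderOf_eq_one]; rfl⟩
  have hpu : (diagStep m n j)^[p] u = u := by
    rw [hit, ← Equiv.Perm.iterate_eq_pow]
    exact Function.iterate_minimalPeriod
  have hcard : p ≤ {v | (diagPerm m n j).SameCycle u v}.ncard := by
    have hinj : Set.InjOn (fun i => (diagPerm m n j)^[i] u) (Set.Iio p) :=
      Function.iterate_injOn_Iio_minimalPeriod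
    have := hinj.ncard_image
    rw [show (Set.Iio p).ncard = p by simp [Set.ncard_eq_toFinset_card']] at this
    rw [← this]
    refine Set.ncard_le_ncard ?_
    rintro _ ⟨i, -, rfl⟩
    simp only [Set.mem_ofPred_eq, Equiv.Perm.iterate_eq_pow]
    exact Equiv.Perm.sameCycle_pow_right.2 (Equiv.Perm.SameCycle.refl _ _)
  refine le_trans ?_ hcard
  set S := diagSet m n j
  have hclosed := walkStep_iterate (a := ((1, 0) : ZMod m × ZMod n)) (b := (0, 1)) (S := S) u p
  rw [hpu] at hclosed
  have hA1 : (m : ℤ) ∣ walkCount (1, 0) (0, 1) S u p := by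
    rw [← ZMod.intCast_zmod_eq_zero_iff_dvd]
    simpa using congrArg Prod.fst hclosed
  have hA2 : (n : ℤ) ∣ p - walkCount (1, 0) (0, 1) S u p := by
    rw [← ZMod.intCast_zmod_eq_zero_iff_dvd]
    have := congrArg Prod.snd hclosed
    simp only [Prod.snd_add, Prod.smul_snd, Prod.snd_sub, zero_sub] at this
    simp only [nsmul_eq_mul, zsmul_eq_mul] at this
    push_cast
    linear_combination -this
  have hmono := walkCount_mono (a := ((1, 0) : ZMod m × ZMod n)) (b := (0, 1)) (S := S) u
  have hzero := walkCount_zero (a := ((1, 0) : ZMod m × ZMod n)) (b := (0, 1)) (S := S) u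
  have hnn := hmono (Nat.zero_le p)
  have hle := walkCount_le_add (a := ((1, 0) : ZMod m × ZMod n)) (b := (0, 1)) (S := S) u 0 p
  rw [hzero] at hnn hle
  rw [Nat.zero_add, zero_add] at hle
  have hA0 : walkCount (1, 0) (0, 1) S u p ≠ 0 := by
    intro h0
    rw [h0, sub_zero] at hA2
    have hnp : n ≤ p := Nat.le_of_dvd hp0 (by exact_mod_cast hA2)
    obtain ⟨i, hi, r, hr1, hr2, hr⟩ := exists_column_vertex u
    have c1 := hmono (Nat.zero_le i)
    have c2 := hmono (show i + 1 ≤ p by lia)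
    have c3 := hmono (show i ≤ p by lia)
    have hmem : (walkStep (1, 0) (0, 1) S)^[i] u ∈ S := by
      by_contra hc
      have := walkCount_succ_of_notMem hc
      lia
    rw [walkStep_iterate, show walkCount (1, 0) (0, 1) S u i = 0 by lia, zero_zsmul, add_zero, hr,
      diagVertex_mem_diagSet hm hn hr2 hj.le] at hmem
    lia
  have hAp : walkCount (1, 0) (0, 1) S u p ≠ p := by
    intro h0
    rw [h0] at hA1
    have hmp : m ≤ p := Nat.le_of_dvd hp0 (by exact_mod_cast hA1)
    obtain ⟨i, hi, r, hr1, hr⟩ := exists_row_vertex u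
    have c1 := walkCount_le_add (a := ((1, 0) : ZMod m × ZMod n)) (b := (0, 1)) (S := S) u i (p - i)
    have c2 := walkCount_le_add (a := ((1, 0) : ZMod m × ZMod n)) (b := (0, 1)) (S := S) u (i + 1)
      (p - (i + 1))
    have c3 := walkCount_le_add (a := ((1, 0) : ZMod m × ZMod n)) (b := (0, 1)) (S := S) u 0 i
    rw [show i + (p - i) = p by lia] at c1
    rw [show i + 1 + (p - (i + 1)) = p by lia] at c2
    rw [Nat.zero_add] at c3
    have hmem : (walkStep (1, 0) (0, 1) S)^[i] u ∉ S := by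
      intro hc
      have := walkCount_succ_of_mem hc
      lia
    have heq : (walkStep (1, 0) (0, 1) S)^[i] u = diagVertex m n r := by
      rw [walkStep_iterate, show walkCount (1, 0) (0, 1) S u i = i by lia, ← hr, natCast_zsmul,
        nsmul_sub]
      abel
    have hrn : r < m * n := hr1.trans_le (Nat.le_mul_of_pos_left n hm)
    have hrj : r = j := by
      rw [heq, diagVertex_mem_diagSet hm hn hrn hj.le] at hmem
      lia
    apply hu
    have h3 := hit i
    rw [diagStep, heq, hrj] at h3
    rw [h3]
    exact Equiv.Perm.sameCycle_pow_left.2 (Equiv.Perm.SameCycle.refl _ _)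
  have hge1 := Int.le_of_dvd (by lia) hA1
  have hge2 := Int.le_of_dvd (by lia) hA2
  lia

lemma exists_diagVertex_eq (u : ZMod m × ZMod n) : ∃ r < m * n, diagVertex m n r = u := by
  have hinj : Function.Injective fun r : Fin (m * n) => diagVertex m n r := fun r s h =>
    Fin.ext (diagVertex_injOn (NeZero.pos m) (NeZero.pos n) r.2 s.2 h)
  obtain ⟨r, hr⟩ := ((Fintype.bijective_iff_injective_and_card _).2 ⟨hinj, by simp [ZMod.card]⟩).2 u
  exact ⟨r, r.2, hr⟩

lemma isFull_first : IsFull m n (n - 1) := by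
  have hm := NeZero.pos m
  have hn := NeZero.pos n
  have hnm : n ≤ m * n := Nat.le_mul_of_pos_left n hm
  obtain ⟨hs1, -⟩ := diagPerm_spec hm hn (n - 1) (by lia)
  intro u
  obtain ⟨i, -, r, hr, hi⟩ := exists_row_vertex u
  refine sameCycle_of_lines (q := n) (e := (1, 0)) (z := fun s => diagVertex m n (n - 1 - s))
    ?_ ?_ ?_ (n - 1 - r) (by lia) i u ?_
  · intro s hs s' hs' i h
    simp only [diagVertex_of_lt (m := m) (show n - 1 - s < n by lia),
      diagVertex_of_lt (m := m) (show n - 1 - s' < n by lia)] at h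
    have h2 := congrArg Prod.snd h
    simp only [Prod.snd_add, Prod.smul_snd, smul_zero, add_zero, ZMod.natCast_eq_natCast_iff] at h2
    have := h2.eq_of_lt_of_lt (by lia) (by lia)
    lia
  · intro s hs
    have hne : diagVertex m n (n - 1 - (s + 1)) ≠ diagVertex m n (n - 1) := fun h => by
      have := diagVertex_injOn hm hn (show _ < m * n by lia) (show _ < m * n by lia) h
      lia
    rw [← hs1 _ hne, diagStep_of_lt (by lia)]
    simp only [diagVertex_of_lt (m := m) (show n - 1 - s < n by lia),
      diagVertex_of_lt (m := m) (show n - 1 - (s + 1) < n by lia)]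
    refine ⟨(((n - 1 - (s + 1) : ℕ) : ZMod m) - ((n - 1 - s : ℕ) : ZMod m)).val, ?_⟩
    ext
    · simp
      ring
    · simp [← Nat.cast_succ, show n - 1 - (s + 1) + 1 = n - 1 - s by lia]
  · intro u hu
    rw [← hs1 u (by simpa using hu 0 hn)]
    refine if_neg ?_
    rintro ⟨r, hr, rfl⟩
    rw [Set.mem_Iio] at hr
    exact hu (n - 1 - r) (by lia) (by rw [show n - 1 - (n - 1 - r) = r by lia])
  · rw [hi, show n - 1 - (n - 1 - r) = r by lia]

lemma isFull_last : IsFull m n (m * (n - 1)) := by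
  have hm := NeZero.pos m
  have hn := NeZero.pos n
  have hle : m * (n - 1) + m = m * n := by
    rw [← Nat.mul_succ, Nat.succ_eq_add_one, Nat.sub_add_cancel hn]
  obtain ⟨hs1, -⟩ := diagPerm_spec hm hn (m * (n - 1)) (by lia)
  intro u
  obtain ⟨i, -, r, hr, hr', hi⟩ := exists_column_vertex u
  refine sameCycle_of_lines (q := m) (e := (0, 1)) (z := fun s => diagVertex m n (m * (n - 1) + s))
    ?_ ?_ ?_ (r - m * (n - 1)) (by lia) i u ?_
  · intro s hs s' hs' i h
    have h2 := congrArg Prod.fst h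
    simp only [diagVertex, Prod.fst_add, Prod.smul_fst, smul_zero, add_zero, neg_inj,
      ZMod.natCast_eq_natCast_iff] at h2
    exact (Nat.ModEq.add_left_cancel' _ h2).eq_of_lt_of_lt hs' hs
  · intro s hs
    have hne : diagVertex m n (m * (n - 1) + (s + 1)) ≠ diagVertex m n (m * (n - 1)) := fun h => by
      have := diagVertex_injOn hm hn (show _ < m * n by lia) (show _ < m * n by lia) h
      lia
    rw [← hs1 _ hne, diagStep_of_le hm hn (by lia) (by lia)]
    refine ⟨((diagVertex m n (m * (n - 1) + s)).2 -
      (diagVertex m n (m * (n - 1) + (s + 1))).2).val, ?_⟩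
    ext
    · simp [diagVertex]
    · simp
  · intro u hu
    obtain ⟨r, hr, rfl⟩ := exists_diagVertex_eq u
    have hlt : r < m * (n - 1) := by
      by_contra hlt
      exact hu (r - m * (n - 1)) (by lia) (by rw [Nat.add_sub_cancel' (by lia)])
    rw [← hs1 _ (by simpa using hu 0 hm)]
    exact diagStep_of_lt hlt
  · rw [hi, show m * (n - 1) + (r - m * (n - 1)) = r by lia]

lemma not_periodicNext_or_not_periodicPrev {j : ℕ} (hj : j < m * n) (h : ¬ IsFull m n j) :
    ¬ PeriodicNext m n j ∨ ¬ PeriodicPrev m n j := by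
  by_contra! hc
  obtain ⟨⟨p, hp, hpj⟩, q, hq, hqj⟩ := hc
  exact h (sameCycle_of_periodic_both hj hp hq hpj hqj)

lemma one_le_ncard_visited (j : ℕ) : 1 ≤ (visited m n j).ncard :=
  (Set.ncard_pos).2 ⟨diagVertex m n j, Equiv.Perm.SameCycle.refl _ _⟩

lemma ncard_le_mul (s : Set (ZMod m × ZMod n)) : s.ncard ≤ m * n := by
  have := Set.ncard_le_card s
  rwa [Nat.card_prod, Nat.card_zmod, Nat.card_zmod] at this

lemma exists_isFull_of_not_periodicNext {j M : ℕ} (h1 : n - 1 ≤ j) (h2 : j + M ≤ m * (n - 1))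
    (hM : m * n ≤ (M + 1) * (m + n)) (h : ¬ PeriodicNext m n j) :
    ∃ i, j ≤ i ∧ i ≤ j + M ∧ IsFull m n i := by
  by_contra! hc
  have hlt : m * (n - 1) < m * n :=
    Nat.mul_lt_mul_of_pos_left (by have := NeZero.pos n; lia) (NeZero.pos m)
  have key : ∀ r ≤ M, ¬ PeriodicNext m n (j + r) ∧
      1 + r * (m + n) ≤ (visited m n (j + r)).ncard := by
    intro r
    induction r with
    | zero => exact fun _ => ⟨h, by simpa using one_le_ncard_visited j⟩
    | succ r ih =>
      intro hr
      obtain ⟨ih1, ih2⟩ := ih (by lia)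
      obtain ⟨hj', hprev, hnot, hcard⟩ := merge_next (by lia) ih1
      have := add_le_ncard_of_not_sameCycle (by lia) (by lia) hnot
      refine ⟨?_, by rw [← add_assoc]; lia⟩
      have := not_periodicNext_or_not_periodicPrev hj' (hc _ (by lia) (by lia))
      exact this.resolve_right (not_not_intro hprev)
  obtain ⟨hn1, hn2⟩ := key M le_rfl
  obtain ⟨-, -, hnot, hcard⟩ := merge_next (by lia) hn1
  have := add_le_ncard_of_not_sameCycle (by lia) h2 hnot
  have := ncard_le_mul (visited m n (j + M + 1))
  lia

lemma exists_isFull_of_not_periodicPrev {j M : ℕ} (h1 : n - 1 + M ≤ j) (h2 : j ≤ m * (n - 1))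
    (hM : m * n ≤ (M + 1) * (m + n)) (h : ¬ PeriodicPrev m n j) :
    ∃ i, j ≤ i + M ∧ i ≤ j ∧ IsFull m n i := by
  by_contra! hc
  have hlt : m * (n - 1) < m * n :=
    Nat.mul_lt_mul_of_pos_left (by have := NeZero.pos n; lia) (NeZero.pos m)
  have key : ∀ r ≤ M, ¬ PeriodicPrev m n (j - r) ∧
      1 + r * (m + n) ≤ (visited m n (j - r)).ncard := by
    intro r
    induction r with
    | zero => exact fun _ => ⟨h, by simpa using one_le_ncard_visited j⟩
    | succ r ih =>
      intro hr
      obtain ⟨ih1, ih2⟩ := ih (by lia)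
      obtain ⟨i, hi, hnext, hnot, hcard⟩ := merge_prev (by lia) ih1
      have := add_le_ncard_of_not_sameCycle (by lia) (by lia) hnot
      obtain rfl : i = j - (r + 1) := by lia
      refine ⟨?_, by lia⟩
      have := not_periodicNext_or_not_periodicPrev (by lia) (hc (j - (r + 1)) (by lia) (by lia))
      exact this.resolve_left (not_not_intro hnext)
  obtain ⟨hn1, hn2⟩ := key M le_rfl
  obtain ⟨i, -, -, hnot, hcard⟩ := merge_prev (by lia) hn1
  have := add_le_ncard_of_not_sameCycle (by lia) (by lia) hnot
  have := ncard_le_mul (visited m n i)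
  lia

lemma exists_isFull_mem_Icc (hmn : m ≤ n) {k : ℕ} (hk1 : 1 ≤ k) (hk2 : k ≤ m * (n - 1)) :
    ∃ j < m * n, k ≤ j ∧ j ≤ k + 2 * ((n - 1) / 2) ∧ IsFull m n j := by
  have hm := NeZero.pos m
  have hn := NeZero.pos n
  have hnm : n ≤ m * n := Nat.le_mul_of_pos_left n hm
  have hlt : m * (n - 1) < m * n := Nat.mul_lt_mul_of_pos_left (by lia) hm
  by_cases h1 : k ≤ n - 1
  · exact ⟨n - 1, by lia, h1, by lia, isFull_first⟩
  by_cases h2 : m * (n - 1) ≤ k + 2 * ((n - 1) / 2)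
  · exact ⟨m * (n - 1), hlt, hk2, h2, isFull_last⟩
  set M := (n - 1) / 2 with hMdef
  have hM : m * n ≤ (M + 1) * (m + n) := by
    have : n ≤ 2 * (M + 1) := by lia
    nlinarith
  by_cases hfull : IsFull m n (k + M)
  · exact ⟨k + M, by lia, by lia, by lia, hfull⟩
  rcases not_periodicNext_or_not_periodicPrev (by lia) hfull with h | h
  · obtain ⟨i, hi1, hi2, hi⟩ := exists_isFull_of_not_periodicNext (by lia) (by lia) hM h
    exact ⟨i, by lia, by lia, by lia, hi⟩
  · obtain ⟨i, hi1, hi2, hi⟩ := exists_isFull_of_not_periodicPrev (by lia) (by lia) hM h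
    exact ⟨i, by lia, by lia, by lia, hi⟩

lemma ncard_diagSet {j : ℕ} (hj : j ≤ m * n) : (diagSet m n j).ncard = j := by
  have := ((diagVertex_injOn (NeZero.pos m) (NeZero.pos n)).mono
    (Set.Iio_subset_Iio hj)).ncard_image
  rw [diagSet, this]
  simp [Set.ncard_eq_toFinset_card']

lemma IsFull.exists_isHamPath (hm : 2 ≤ m) {j : ℕ} (hj : j < m * n) (h : IsFull m n j) :
    ∃ v : Fin (m * n) → ZMod m × ZMod n,
      IsHamPath ((1, 0) : ZMod m × ZMod n) ((0, 1) : ZMod m × ZMod n) (m * n) v ∧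
      delta (m * n) v ((0, 1) : ZMod m × ZMod n) = j := by
  have hn := NeZero.pos n
  obtain ⟨hs1, -⟩ := diagPerm_spec (NeZero.pos m) hn j hj
  set π := diagPerm m n j
  set t := diagVertex m n j with ht
  set v : Fin (m * n) → ZMod m × ZMod n := fun i => π^[i + 1] t with hv
  have hp0 : 0 < Function.minimalPeriod π t := Function.minimalPeriod_pos_of_mem_periodicPts
    ⟨_, orderOf_pos π, by
      rw [Function.IsPeriodicPt, Equiv.Perm.iterate_eq_pow, pow_orderOf_eq_one]; rfl⟩
  have hp : Function.minimalPeriod π t ≤ m * n := by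
    have hinj : Set.InjOn (fun i => π^[i] t) (Set.Iio (Function.minimalPeriod π t)) :=
      Function.iterate_injOn_Iio_minimalPeriod
    have := hinj.ncard_image
    rw [show (Set.Iio (Function.minimalPeriod π t)).ncard = Function.minimalPeriod π t by
      simp [Set.ncard_eq_toFinset_card']] at this
    rw [← this]
    exact ncard_le_mul _
  have hbij : Function.Bijective v := by
    rw [Fintype.bijective_iff_surjective_and_card]
    refine ⟨fun y => ?_, by simp [ZMod.card]⟩
    obtain ⟨k, -, hk⟩ := (Equiv.Perm.sameCycle_symm_apply_right.2 (h y)).exists_pow_eq'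
    refine ⟨⟨k % Function.minimalPeriod π t, (Nat.mod_lt _ hp0).trans_le hp⟩, ?_⟩
    simp only [hv, Function.iterate_succ_apply', Function.iterate_mod_minimalPeriod_eq]
    rw [Equiv.Perm.iterate_eq_pow, hk, Equiv.apply_symm_apply]
  have hne : ∀ (i : ℕ) (hi : i + 1 < m * n), v ⟨i, Nat.lt_of_succ_lt hi⟩ ≠ t := by
    intro i hi he
    have : v ⟨i + 1, hi⟩ = v ⟨0, by lia⟩ := by
      simp only [hv] at he ⊢
      rw [Function.iterate_succ_apply', he]
      rfl
    simpa using hbij.1 this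
  have hstep : ∀ (i : ℕ) (hi : i + 1 < m * n),
      v ⟨i + 1, hi⟩ = diagStep m n j (v ⟨i, Nat.lt_of_succ_lt hi⟩) := by
    intro i hi
    rw [hs1 _ (hne i hi)]
    simp only [hv, Function.iterate_succ_apply']
  have hab : ((1, 0) : ZMod m × ZMod n) ≠ (0, 1) := fun he => by
    have : Fact (1 < m) := ⟨hm⟩
    exact one_ne_zero (congrArg Prod.fst he)
  have hiff : ∀ (i : ℕ) (hi : i + 1 < m * n),
      v ⟨i + 1, hi⟩ - v ⟨i, Nat.lt_of_succ_lt hi⟩ = (0, 1) ↔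
        v ⟨i, Nat.lt_of_succ_lt hi⟩ ∈ diagSet m n j := by
    intro i hi
    rw [hstep i hi, diagStep, walkStep]
    split_ifs with hmem
    · simp [hmem]
    · simp only [add_sub_cancel_left, hmem, iff_false]
      exact hab
  refine ⟨v, ⟨hbij, fun i hi => ?_⟩, ?_⟩
  · rw [hstep i hi, diagStep, walkStep]
    split_ifs <;> simp
  · rw [← ncard_diagSet hj.le, delta, ← Nat.card_coe_set_eq]
    refine Nat.card_eq_of_bijective
      (fun i => ⟨v ⟨i.1, Nat.lt_of_succ_lt i.2.1⟩, (hiff i.1 i.2.1).1 i.2.2⟩) ⟨?_, ?_⟩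
    · intro x y hxy
      have := hbij.1 (congrArg Subtype.val hxy)
      exact Subtype.ext (by simpa using this)
    · rintro ⟨x, hx⟩
      obtain ⟨i, rfl⟩ := hbij.2 x
      have hi : i.1 + 1 < m * n := by
        by_contra hi
        obtain ⟨l, hl⟩ := hbij.2 t
        have hl' : ¬ l.1 + 1 < m * n := fun hlt => hne l.1 hlt hl
        obtain rfl : l = i := Fin.ext (by lia)
        rw [hl, ht, diagVertex_mem_diagSet (NeZero.pos m) hn hj hj.le] at hx
        exact lt_irrefl _ hx
      exact ⟨⟨i.1, hi, (hiff i.1 hi).2 hx⟩, rfl⟩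

end Torus

/-- For `2 ≤ m ≤ n` and `1 ≤ k ≤ m(n−1)` there is a hamiltonian path `P` in
`Cay(ℤ_m × ℤ_n; e₁, e₂)` with `k ≤ δ_{e₂}(P) ≤ k + 2⌊(n−1)/2⌋`. -/
theorem delta_gap_CmCn (m n : ℕ) (hm : 2 ≤ m) (hmn : m ≤ n)
    (k : ℕ) (hk1 : 1 ≤ k) (hk2 : k ≤ m * (n - 1)) :
    ∃ v : Fin (m * n) → ZMod m × ZMod n,
      IsHamPath ((1, 0) : ZMod m × ZMod n) ((0, 1) : ZMod m × ZMod n) (m * n) v ∧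
      k ≤ delta (m * n) v ((0, 1) : ZMod m × ZMod n) ∧
      delta (m * n) v ((0, 1) : ZMod m × ZMod n) ≤ k + 2 * ((n - 1) / 2) := by
  have : NeZero m := ⟨by lia⟩
  have : NeZero n := ⟨by lia⟩
  obtain ⟨j, hj, hkj, hjk, hfull⟩ := exists_isFull_mem_Icc hmn hk1 hk2
  obtain ⟨v, hv, hdelta⟩ := hfull.exists_isHamPath hm hj
  exact ⟨v, hv, hdelta ▸ hkj, hdelta ▸ hjk⟩
end

section
/- Let {a, b} be a 2-element generating set of a finite abelian group G such that Cay(G; a, b) does not have a hamiltonian cycle, |G| is even, and the index [G : ⟨a − b⟩] is odd. If P and P′ are two arc-disjoint hamiltonian paths in Cay(G; a, b), with initial vertices ι and ι′ and terminal vertices τ and τ′, then ι′ + τ′ = ι + τ. -/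
/-- The arc set of a path `v : Fin N → G`: the pairs `(v i, v (i+1))`. -/
def ArcSet {G : Type*} (N : ℕ) (v : Fin N → G) : Set (G × G) :=
  {p | ∃ (i : ℕ) (h : i + 1 < N), p = (v ⟨i, Nat.lt_of_succ_lt h⟩, v ⟨i + 1, h⟩)}

/-- `Cay(G; a, b)` has a hamiltonian cycle: a cyclic bijective listing of `G`
each of whose steps is by `a` or by `b`. -/
def HasHamCycle (G : Type*) [AddCommGroup G] [Fintype G] (a b : G) : Prop :=
  ∃ u : ZMod (Fintype.card G) → G, Function.Bijective u ∧
    ∀ i : ZMod (Fintype.card G), u (i + 1) - u i ∈ ({a, b} : Set G)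

open Equiv Equiv.Perm in
/-- A hamiltonian path, closed up by an extra arc from its terminal to its initial vertex,
gives a cyclic permutation of the vertices. -/
theorem IsHamPath.exists_perm {G : Type*} [AddCommGroup G] [Fintype G] [DecidableEq G]
    {a b : G} {N : ℕ} (hN : 0 < N) {v : Fin N → G} (hv : IsHamPath a b N v) :
    ∃ σ : Perm G, sign σ = (-1) ^ (N - 1) ∧
      σ (v ⟨N - 1, Nat.sub_lt hN Nat.one_pos⟩) = v ⟨0, hN⟩ ∧
      ∀ x, x ≠ v ⟨N - 1, Nat.sub_lt hN Nat.one_pos⟩ →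
        (x, σ x) ∈ ArcSet N v ∧ (σ x = x + a ∨ σ x = x + b) := by
  obtain ⟨n, rfl⟩ : ∃ n, N = n + 1 := ⟨N - 1, by omega⟩
  set e := Equiv.ofBijective v hv.1
  have he : ∀ i, e.symm (v i) = i := fun i ↦ e.symm_apply_apply i
  refine ⟨e.permCongr (finRotate (n + 1)), ?_, ?_, ?_⟩
  · rw [sign_permCongr, sign_finRotate, Nat.add_sub_cancel]
  · rw [permCongr_apply, he]
    exact congrArg v finRotate_last'
  · intro x hx
    obtain ⟨⟨i, hi⟩, rfl⟩ := hv.1.2 x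
    have hin : i < n := by
      by_contra h
      exact hx (congrArg v (Fin.ext (by simp; omega)))
    have hσ : e.permCongr (finRotate (n + 1)) (v ⟨i, hi⟩) = v ⟨i + 1, by omega⟩ := by
      rw [permCongr_apply, he]
      exact congrArg v (finRotate_of_lt hin)
    rw [hσ]
    refine ⟨⟨i, by omega, rfl⟩, ?_⟩
    simpa [sub_eq_iff_eq_add, add_comm] using hv.2 i (by omega)

/-- A hamiltonian path whose terminal vertex has an arc to its initial vertex closes up. -/
theorem IsHamPath.hasHamCycle {G : Type*} [AddCommGroup G] [Fintype G] {a b : G}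
    {v : Fin (Fintype.card G) → G} (hv : IsHamPath a b (Fintype.card G) v)
    (h : v ⟨0, Fintype.card_pos⟩ -
      v ⟨Fintype.card G - 1, Nat.sub_lt Fintype.card_pos Nat.one_pos⟩ ∈ ({a, b} : Set G)) :
    HasHamCycle G a b := by
  have : NeZero (Fintype.card G) := ⟨Fintype.card_ne_zero⟩
  refine ⟨fun i ↦ v ⟨i.val, ZMod.val_lt i⟩, ?_, fun i ↦ ?_⟩
  · rw [Fintype.bijective_iff_injective_and_card]
    refine ⟨fun i j hij ↦ ZMod.val_injective _ ?_, ZMod.card _⟩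
    simpa using hv.1.1 hij
  · have hval : (i + 1).val = (i.val + 1) % Fintype.card G := by
      rw [← ZMod.val_natCast, Nat.cast_add, ZMod.natCast_zmod_val, Nat.cast_one]
    rcases Nat.lt_or_ge (i.val + 1) (Fintype.card G) with hi | hi
    · rw [Nat.mod_eq_of_lt hi] at hval
      simpa only [hval] using hv.2 i.val hi
    · have hi' : i.val = Fintype.card G - 1 := by
        have := ZMod.val_lt i
        omega
      rw [hi', Nat.sub_add_cancel Fintype.card_pos, Nat.mod_self] at hval
      simpa only [hval, hi'] using h

open Equiv Equiv.Perm in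
/-- Translation by an element generating a subgroup of odd index in a group of even order is
an odd permutation. -/
theorem sign_addRight_of_odd_index {G : Type*} [AddCommGroup G] [Fintype G] [DecidableEq G]
    {g : G} (heven : Even (Fintype.card G)) (hodd : Odd (AddSubgroup.zmultiples g).index) :
    sign (Equiv.addRight g) = -1 := by
  have hcard := (AddSubgroup.zmultiples g).card_mul_index
  rw [Nat.card_zmultiples, Nat.card_eq_fintype_card] at hcard
  have hn : 0 < addOrderOf g := addOrderOf_pos g
  have hg : g ≠ 0 := by
    rintro rfl
    rw [addOrderOf_zero, one_mul] at hcard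
    rw [hcard] at hodd
    exact Nat.not_even_iff_odd.2 hodd heven
  have hsupp : (Equiv.addRight g).support = Finset.univ := by
    ext x
    simp [hg]
  have hrep : ∀ m ∈ (Equiv.addRight g).cycleType, m = addOrderOf g := by
    intro m hm
    rw [cycleType_def, Multiset.mem_map] at hm
    obtain ⟨c, hc, rfl⟩ := hm
    have hc' : c ∈ (Equiv.addRight g).cycleFactorsFinset := hc
    have hcyc := (mem_cycleFactorsFinset_iff.1 hc').1
    obtain ⟨x, hx⟩ := hcyc.nonempty_support
    have hcx := cycle_is_cycleOf hx hc'
    have hpow : ∀ m : ℕ, c ^ m = 1 ↔ m • g = 0 := by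
      intro m
      rw [hcyc.pow_eq_one_iff' (mem_support.1 hx), hcx, cycleOf_pow_apply_self]
      simp [Equiv.nsmul_addRight]
    change c.support.card = _
    rw [← hcyc.orderOf]
    exact Nat.dvd_antisymm
      (orderOf_dvd_of_pow_eq_one ((hpow _).2 (addOrderOf_nsmul_eq_zero g)))
      (addOrderOf_dvd_of_nsmul_eq_zero ((hpow _).1 (pow_orderOf_eq_one c)))
  have hsum := sum_cycleType (Equiv.addRight g)
  rw [hsupp, Finset.card_univ] at hsum
  have hcount : (Equiv.addRight g).cycleType.card = (AddSubgroup.zmultiples g).index := by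
    have h := hsum
    rw [Multiset.eq_replicate_of_mem hrep, Multiset.sum_replicate, smul_eq_mul, ← hcard,
      mul_comm] at h
    exact Nat.eq_of_mul_eq_mul_left hn h
  rw [sign_of_cycleType, hsum, hcount]
  exact (heven.add_odd hodd).neg_one_pow

open Equiv in
/-- Two permutations whose moves from every point other than `τ`, respectively `τ'`, are
complementary choices among staying fixed and subtracting `d` compose to the translation by
`-d`, provided that `τ' = f τ + d` and `τ = f' τ'`. -/
theorem mul_eq_addRight_neg {G : Type*} [AddCommGroup G] {d τ τ' : G} {f f' : Perm G}
    (hf : ∀ x, x ≠ τ → f x = x ∨ f x = x - d) (hf' : ∀ x, x ≠ τ' → f' x = x ∨ f' x = x - d)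
    (hne : ∀ x, x ≠ τ → x ≠ τ' → f x ≠ f' x)
    (h₁ : f τ ≠ τ) (h₂ : f τ ≠ τ - d) (hτ' : τ' = f τ + d) (hτ : τ = f' τ') :
    f * f' = Equiv.addRight (-d) := by
  have hfix : ∀ x, x ≠ f τ → f (x + d) ≠ x → f x = x := by
    intro x hx hxd
    obtain ⟨y, rfl⟩ := f.surjective x
    by_cases hy : y = τ
    · exact absurd (congrArg f hy) hx
    rcases hf y hy with h | h
    · rw [h, h]
    · exact absurd (by rw [h, sub_add_cancel, h]) hxd
  ext x
  rw [Perm.mul_apply, show Equiv.addRight (-d) x = x - d from (sub_eq_add_neg x d).symm]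
  by_cases hx' : x = τ'
  · rw [hx', ← hτ, hτ', add_sub_cancel_right]
  by_cases hx : x = τ
  · subst hx
    have h : f' x = x - d := (hf' x hx').resolve_left fun h ↦
      hx' (f'.injective (h.trans hτ))
    rw [h]
    apply hfix _ h₂.symm
    rw [sub_add_cancel]
    exact h₂
  · have hn := hne x hx hx'
    rcases hf' x hx' with h | h
    · rw [h] at hn ⊢
      exact (hf x hx).resolve_left hn
    · rw [h] at hn ⊢
      apply hfix
      · intro h'
        exact hx' (by rw [hτ', ← h', sub_add_cancel])
      · rwa [sub_add_cancel]

open Equiv in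
/-- Two permutations whose moves from every point other than `τ`, respectively `τ'`, are
complementary choices among staying fixed and subtracting `d` satisfy `τ' = f τ` or
`τ' = f τ + d`. -/
theorem eq_or_eq_add_of_complementary {G : Type*} [AddCommGroup G] {d τ τ' : G}
    {f f' : Perm G} (hd : d ≠ 0)
    (hf : ∀ x, x ≠ τ → f x = x ∨ f x = x - d) (hf' : ∀ x, x ≠ τ' → f' x = x ∨ f' x = x - d)
    (hne : ∀ x, x ≠ τ → x ≠ τ' → f x ≠ f' x)
    (h₁ : f τ ≠ τ) (h₂ : f τ ≠ τ - d) :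
    τ' = f τ ∨ τ' = f τ + d := by
  by_contra! h
  have hp : f τ + d ≠ τ := fun h' ↦ h₂ (eq_sub_of_add_eq h')
  have e₁ : f (f τ) = f τ - d :=
    (hf _ h₁).resolve_left fun h' ↦ h₁ (f.injective h')
  have e₂ : f (f τ + d) = f τ + d := (hf _ hp).resolve_right fun h' ↦
    hp (f.injective (by rw [h', add_sub_cancel_right]))
  have e₁' : f' (f τ) = f τ := (hf' _ h.1.symm).resolve_right fun h' ↦
    hne _ h₁ h.1.symm (e₁.trans h'.symm)
  have e₂' : f' (f τ + d) = f τ := by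
    refine ((hf' _ h.2.symm).resolve_left fun h' ↦
      hne _ hp h.2.symm (e₂.trans h'.symm)).trans (add_sub_cancel_right _ _)
  exact hd (by simpa using f'.injective (e₂'.trans e₁'.symm))

/-- If `Cay(G; a, b)` has no hamiltonian cycle, `|G|` is even, and `[G : ⟨a−b⟩]` is odd,
then any two arc-disjoint hamiltonian paths satisfy `ι' + τ' = ι + τ`. -/
theorem sum_initial_terminal_eq {G : Type*} [AddCommGroup G] [Fintype G]
    (a b : G) (hab : a ≠ b) (hgen : AddSubgroup.closure {a, b} = ⊤)
    (hnc : ¬ HasHamCycle G a b)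
    (heven : Even (Fintype.card G))
    (hodd : Odd (AddSubgroup.zmultiples (a - b)).index)
    (v v' : Fin (Fintype.card G) → G)
    (hv : IsHamPath a b (Fintype.card G) v) (hv' : IsHamPath a b (Fintype.card G) v')
    (hdisj : Disjoint (ArcSet (Fintype.card G) v) (ArcSet (Fintype.card G) v'))
    (ι τ ι' τ' : G)
    (hι : ι = v ⟨0, Fintype.card_pos⟩)
    (hτ : τ = v ⟨Fintype.card G - 1, Nat.sub_lt Fintype.card_pos Nat.one_pos⟩)
    (hι' : ι' = v' ⟨0, Fintype.card_pos⟩)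
    (hτ' : τ' = v' ⟨Fintype.card G - 1, Nat.sub_lt Fintype.card_pos Nat.one_pos⟩) :
    ι' + τ' = ι + τ := by
  classical
  have hd : a - b ≠ 0 := sub_ne_zero.2 hab
  obtain ⟨σ, hs, hcl, hσ⟩ := hv.exists_perm Fintype.card_pos
  obtain ⟨σ', hs', hcl', hσ'⟩ := hv'.exists_perm Fintype.card_pos
  rw [← hτ] at hσ
  rw [← hτ'] at hσ'
  rw [← hτ, ← hι] at hcl
  rw [← hτ', ← hι'] at hcl'
  have hc : ∀ s ∈ ({a, b} : Set G), ι - τ ≠ s := by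
    rintro s hs rfl
    exact hnc (hv.hasHamCycle (by rwa [← hι, ← hτ]))
  have hc' : ∀ s ∈ ({a, b} : Set G), ι' - τ' ≠ s := by
    rintro s hs rfl
    exact hnc (hv'.hasHamCycle (by rwa [← hι', ← hτ']))
  set f : Equiv.Perm G := Equiv.addRight (-a) * σ with hfdef
  set f' : Equiv.Perm G := Equiv.addRight (-a) * σ' with hfdef'
  have fx : ∀ x, f x = σ x - a := fun x ↦ (sub_eq_add_neg _ _).symm
  have fx' : ∀ x, f' x = σ' x - a := fun x ↦ (sub_eq_add_neg _ _).symm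
  have hf : ∀ x, x ≠ τ → f x = x ∨ f x = x - (a - b) := fun x hx ↦ by
    rw [fx]
    rcases (hσ x hx).2 with h | h
    · left; rw [h]; abel
    · right; rw [h]; abel
  have hf' : ∀ x, x ≠ τ' → f' x = x ∨ f' x = x - (a - b) := fun x hx ↦ by
    rw [fx']
    rcases (hσ' x hx).2 with h | h
    · left; rw [h]; abel
    · right; rw [h]; abel
  have hne : ∀ x, x ≠ τ → x ≠ τ' → f x ≠ f' x := fun x hx hx' h ↦ by
    rw [fx, fx', sub_left_inj] at h
    refine Set.disjoint_left.1 hdisj (hσ x hx).1 ?_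
    rw [h]
    exact (hσ' x hx').1
  have fτ : f τ = ι - a := by rw [fx, hcl]
  have fτ' : f' τ' = ι' - a := by rw [fx', hcl']
  have h₁ : f τ ≠ τ := fun h ↦ hc a (by simp) (by
    rw [fτ, sub_eq_iff_eq_add] at h
    rw [h]; abel)
  have h₂ : f τ ≠ τ - (a - b) := fun h ↦ hc b (by simp) (by
    rw [fτ, sub_eq_iff_eq_add] at h
    rw [h]; abel)
  have h₁' : f' τ' ≠ τ' := fun h ↦ hc' a (by simp) (by
    rw [fτ', sub_eq_iff_eq_add] at h
    rw [h]; abel)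
  have h₂' : f' τ' ≠ τ' - (a - b) := fun h ↦ hc' b (by simp) (by
    rw [fτ', sub_eq_iff_eq_add] at h
    rw [h]; abel)
  have hne' : ∀ x, x ≠ τ' → x ≠ τ → f' x ≠ f x := fun x hx' hx ↦ (hne x hx hx').symm
  have hsign : Equiv.Perm.sign f = Equiv.Perm.sign f' := by
    rw [hfdef, hfdef', Equiv.Perm.sign_mul, Equiv.Perm.sign_mul, hs, hs']
  have hshift : Equiv.Perm.sign (Equiv.addRight (-(a - b))) = -1 :=
    sign_addRight_of_odd_index heven (by rwa [AddSubgroup.zmultiples_neg])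
  have hprod : f * f' ≠ Equiv.addRight (-(a - b)) := fun h ↦ by
    have := congrArg Equiv.Perm.sign h
    rw [Equiv.Perm.sign_mul, hshift, hsign, Int.units_mul_self] at this
    exact absurd this (by decide)
  have hprod' : f' * f ≠ Equiv.addRight (-(a - b)) := fun h ↦ by
    have := congrArg Equiv.Perm.sign h
    rw [Equiv.Perm.sign_mul, hshift, hsign, Int.units_mul_self] at this
    exact absurd this (by decide)
  rcases eq_or_eq_add_of_complementary hd hf hf' hne h₁ h₂ with h | h <;>
    rcases eq_or_eq_add_of_complementary hd hf' hf hne' h₁' h₂' with h' | h'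
  · rw [fτ] at h
    rw [fτ'] at h'
    rw [h, h']; abel
  · exact absurd (mul_eq_addRight_neg hf' hf hne' h₁' h₂' h' h) hprod'
  · exact absurd (mul_eq_addRight_neg hf hf' hne h₁ h₂ h h') hprod
  · rw [fτ] at h
    rw [fτ'] at h'
    rw [h, h']; abel
end

section
/- Let {a, b} be a 2-element generating set of a finite abelian group G with a ≠ 0 and b ≠ 0. If the index [G : ⟨a − b⟩] of the subgroup generated by a − b is even, then Cay(G; a, b) has two arc-disjoint hamiltonian paths. -/
/-- The walk from `v₀` whose steps spell the word `((ab)^(R-1) a a)^∞`. -/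
def blockWalk {G : Type*} [AddCommGroup G] (a b : G) (R : ℕ) (v₀ : G) (i : ℕ) : G :=
  v₀ + (i / (2 * R)) • (a - b) + (i % (2 * R) / 2) • (a + b) + (i % 2) • a

namespace blockWalk

variable {G : Type*} [AddCommGroup G] {a b : G} {R : ℕ} (v₀ : G)

theorem apply_block (a b : G) (hR : 0 < R) (u : ℕ) {l e : ℕ} (hl : l < R) (he : e < 2) :
    blockWalk a b R v₀ (2 * R * u + (2 * l + e)) = v₀ + u • (a - b) + l • (a + b) + e • a := by
  have hlt : 2 * l + e < 2 * R := by omega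
  have h₁ : (2 * R * u + (2 * l + e)) / (2 * R) = u := by
    rw [Nat.mul_add_div (by omega), Nat.div_eq_of_lt hlt, add_zero]
  have h₂ : (2 * R * u + (2 * l + e)) % (2 * R) = 2 * l + e := by
    rw [Nat.mul_add_mod, Nat.mod_eq_of_lt hlt]
  have h₃ : (2 * R * u + (2 * l + e)) % 2 = e := by
    rw [mul_assoc, Nat.mul_add_mod]; omega
  rw [blockWalk, h₁, h₂, h₃, show (2 * l + e) / 2 = l by omega]

theorem exists_block (hR : 0 < R) (i : ℕ) :
    ∃ u l e, l < R ∧ e < 2 ∧ i = 2 * R * u + (2 * l + e) := by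
  have h := Nat.mod_lt i (show 0 < 2 * R by omega)
  refine ⟨i / (2 * R), i % (2 * R) / 2, i % (2 * R) % 2, by omega, by omega, ?_⟩
  rw [Nat.div_add_mod, Nat.div_add_mod]

theorem step_of_even {i : ℕ} (hR : 0 < R) (hi : i % 2 = 0) :
    blockWalk a b R v₀ (i + 1) - blockWalk a b R v₀ i = a := by
  obtain ⟨u, l, e, hl, he, rfl⟩ := exists_block hR i
  obtain rfl : e = 0 := by rw [mul_assoc] at hi; omega
  rw [show 2 * R * u + (2 * l + 0) + 1 = 2 * R * u + (2 * l + 1) by ring,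
    apply_block v₀ a b hR u hl (by omega), apply_block v₀ a b hR u hl (by omega)]
  module

theorem step_of_dvd {i : ℕ} (hR : 0 < R) (h : R • (a + b) = 0) (hi : 2 * R ∣ i + 1) :
    blockWalk a b R v₀ (i + 1) - blockWalk a b R v₀ i = a := by
  obtain ⟨u, hu⟩ := hi
  obtain ⟨u, rfl⟩ : ∃ w, u = w + 1 := ⟨u - 1, by
    rcases u with _ | u
    · simp at hu
    · simp⟩
  obtain ⟨R, rfl⟩ : ∃ r, R = r + 1 := ⟨R - 1, by omega⟩
  obtain rfl : i = 2 * (R + 1) * u + (2 * R + 1) := by linarith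
  rw [hu, show 2 * (R + 1) * (u + 1) = 2 * (R + 1) * (u + 1) + (2 * 0 + 0) by ring,
    apply_block v₀ a b hR _ hR (by omega), apply_block v₀ a b hR u (by omega) (by omega)]
  have h' : R • (a + b) = -(a + b) := by
    rw [add_smul, one_smul] at h
    exact eq_neg_of_add_eq_zero_left h
  rw [h']
  module

theorem step_of_odd {i : ℕ} (hR : 0 < R) (hi : i % 2 = 1) (hd : ¬ 2 * R ∣ i + 1) :
    blockWalk a b R v₀ (i + 1) - blockWalk a b R v₀ i = b := by
  obtain ⟨u, l, e, hl, he, rfl⟩ := exists_block hR i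
  obtain rfl : e = 1 := by rw [mul_assoc] at hi; omega
  have hl' : l + 1 < R := by
    refine lt_of_le_of_ne hl fun h => hd ⟨u + 1, ?_⟩
    subst h
    ring
  rw [show 2 * R * u + (2 * l + 1) + 1 = 2 * R * u + (2 * (l + 1) + 0) by ring,
    apply_block v₀ a b hR u hl' (by omega), apply_block v₀ a b hR u hl (by omega)]
  module

theorem step_mem (hR : 0 < R) (h : R • (a + b) = 0) (i : ℕ) :
    blockWalk a b R v₀ (i + 1) - blockWalk a b R v₀ i ∈ ({a, b} : Set G) := by
  rcases Nat.mod_two_eq_zero_or_one i with hi | hi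
  · exact Or.inl (step_of_even v₀ hR hi)
  · by_cases hd : 2 * R ∣ i + 1
    · exact Or.inl (step_of_dvd v₀ hR h hd)
    · exact Or.inr (step_of_odd v₀ hR hi hd)

/-- The walks for `(a, b)` from `D • (b - a)` and for `(b, a)` from `0` visit the same block ends,
in opposite orders. -/
theorem block_end_eq (a b : G) (hR : 0 < R) (h : R • (a + b) = 0) {D u w : ℕ}
    (huw : u + w + 1 = D) :
    blockWalk a b R (D • (b - a)) (2 * R * u + (2 * (R - 1) + 1)) =
      blockWalk b a R 0 (2 * R * w + (2 * (R - 1) + 1)) := by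
  obtain ⟨R, rfl⟩ : ∃ r, R = r + 1 := ⟨R - 1, by omega⟩
  have h' : R • (a + b) = -(a + b) := by
    rw [add_smul, one_smul] at h
    exact eq_neg_of_add_eq_zero_left h
  rw [apply_block _ a b hR u (by omega) (by omega), apply_block _ b a hR w (by omega) (by omega),
    ← huw, add_comm b a, Nat.add_sub_cancel, h']
  module

end blockWalk

section

variable {G : Type*} [AddCommGroup G]

theorem addOrderOf_mk_eq_index {a b : G} (K : AddSubgroup G)
    (hgen : AddSubgroup.closure {a, b} = ⊤)
    (hb : (b : G ⧸ K) ∈ AddSubgroup.zmultiples (a : G ⧸ K)) :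
    addOrderOf (a : G ⧸ K) = K.index := by
  have htop : AddSubgroup.zmultiples (a : G ⧸ K) = ⊤ := by
    rw [eq_top_iff, ← AddSubgroup.map_top_of_surjective (QuotientAddGroup.mk' K)
      (QuotientAddGroup.mk'_surjective K), ← hgen, AddMonoidHom.map_closure,
      AddSubgroup.closure_le]
    rintro _ ⟨x, rfl | rfl, rfl⟩
    · exact AddSubgroup.mem_zmultiples _
    · exact hb
  rw [← Nat.card_zmultiples, htop, AddSubgroup.card_top, AddSubgroup.index]

theorem mk_eq_of_zmultiples_sub (a b : G) :
    (b : G ⧸ AddSubgroup.zmultiples (a - b)) = a := by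
  rw [QuotientAddGroup.eq, neg_add_eq_sub]
  exact AddSubgroup.mem_zmultiples _

theorem mk_eq_neg_of_zmultiples_add (a b : G) :
    (b : G ⧸ AddSubgroup.zmultiples (a + b)) = -a := by
  rw [← QuotientAddGroup.mk_neg, QuotientAddGroup.eq, ← neg_add_rev, neg_mem_iff]
  exact AddSubgroup.mem_zmultiples _

theorem zsmul_mk_eq_zero_imp_even {a b : G} (hgen : AddSubgroup.closure {a, b} = ⊤)
    (hidx : Even (AddSubgroup.zmultiples (a - b)).index) {k : ℤ}
    (hk : k • (a : G ⧸ AddSubgroup.zmultiples (a - b)) = 0) : Even k := by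
  have hb : (b : G ⧸ AddSubgroup.zmultiples (a - b)) ∈ AddSubgroup.zmultiples
      (a : G ⧸ AddSubgroup.zmultiples (a - b)) := by
    rw [mk_eq_of_zmultiples_sub]
    exact AddSubgroup.mem_zmultiples _
  rw [← addOrderOf_mk_eq_index _ hgen hb] at hidx
  exact even_iff_two_dvd.2 ((Int.natCast_dvd_natCast.2 hidx.two_dvd).trans
    (addOrderOf_dvd_iff_zsmul_eq_zero.2 hk))

theorem addOrderOf_mk_zmultiples_add {a b : G} (hgen : AddSubgroup.closure {a, b} = ⊤) :
    addOrderOf (a : G ⧸ AddSubgroup.zmultiples (a + b)) =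
      (AddSubgroup.zmultiples (a + b)).index := by
  refine addOrderOf_mk_eq_index _ hgen ?_
  rw [mk_eq_neg_of_zmultiples_add]
  exact neg_mem (AddSubgroup.mem_zmultiples _)

theorem even_index_zmultiples_add {a b : G} (hgen : AddSubgroup.closure {a, b} = ⊤)
    (hidx : Even (AddSubgroup.zmultiples (a - b)).index) :
    Even (AddSubgroup.zmultiples (a + b)).index := by
  rw [← addOrderOf_mk_zmultiples_add hgen]
  set N := addOrderOf (a : G ⧸ AddSubgroup.zmultiples (a + b))
  have hN : N • (a : G ⧸ AddSubgroup.zmultiples (a + b)) = 0 := addOrderOf_nsmul_eq_zero _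
  rw [← QuotientAddGroup.mk_nsmul, QuotientAddGroup.eq_zero_iff] at hN
  obtain ⟨l, hl : l • (a + b) = N • a⟩ := hN
  have h := congrArg (QuotientAddGroup.mk (s := AddSubgroup.zmultiples (a - b))) hl
  rw [QuotientAddGroup.mk_zsmul, QuotientAddGroup.mk_nsmul, QuotientAddGroup.mk_add,
    mk_eq_of_zmultiples_sub] at h
  have h' := zsmul_mk_eq_zero_imp_even hgen hidx (k := N - 2 * l) (by
    rw [sub_smul, natCast_zsmul, ← h]
    module)
  rw [Int.even_sub] at h'
  exact_mod_cast h'.2 (even_two_mul l)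

theorem blockWalk_mk_sub (a b : G) {R : ℕ} (v₀ : G) (i : ℕ) :
    ((blockWalk a b R v₀ i : G) : G ⧸ AddSubgroup.zmultiples (a - b)) =
      v₀ + (2 * (i % (2 * R) / 2) + i % 2) • (a : G ⧸ AddSubgroup.zmultiples (a - b)) := by
  simp only [blockWalk, QuotientAddGroup.mk_add, QuotientAddGroup.mk_nsmul,
    QuotientAddGroup.mk_sub, mk_eq_of_zmultiples_sub]
  module

theorem blockWalk_mk_add (a b : G) {R : ℕ} (v₀ : G) (i : ℕ) :
    ((blockWalk a b R v₀ i : G) : G ⧸ AddSubgroup.zmultiples (a + b)) =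
      v₀ + (2 * (i / (2 * R)) + i % 2) • (a : G ⧸ AddSubgroup.zmultiples (a + b)) := by
  simp only [blockWalk, QuotientAddGroup.mk_add, QuotientAddGroup.mk_nsmul,
    QuotientAddGroup.mk_sub, mk_eq_neg_of_zmultiples_add]
  module

theorem blockWalk_injOn {a b : G} (hgen : AddSubgroup.closure {a, b} = ⊤) {D : ℕ}
    (hD : (AddSubgroup.zmultiples (a + b)).index = 2 * D) (hR : 0 < addOrderOf (a + b)) (v₀ : G) :
    Set.InjOn (blockWalk a b (addOrderOf (a + b)) v₀) (Set.Iio (2 * addOrderOf (a + b) * D)) := by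
  intro i hi j hj hij
  set R := addOrderOf (a + b) with hRdef
  have hu : i / (2 * R) < D := Nat.div_lt_of_lt_mul hi
  have hw : j / (2 * R) < D := Nat.div_lt_of_lt_mul hj
  have hmk := congrArg (QuotientAddGroup.mk (s := AddSubgroup.zmultiples (a + b))) hij
  rw [blockWalk_mk_add, blockWalk_mk_add, add_right_inj] at hmk
  have hord := addOrderOf_mk_zmultiples_add hgen
  rw [hD] at hord
  have hcoset := nsmul_injOn_Iio_addOrderOf (x := (a : G ⧸ AddSubgroup.zmultiples (a + b)))
    (Set.mem_Iio.2 (by omega)) (Set.mem_Iio.2 (by omega)) hmk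
  have hdiv : i / (2 * R) = j / (2 * R) := by omega
  have hmod : i % 2 = j % 2 := by omega
  simp only [blockWalk, hdiv, hmod, add_left_inj, add_right_inj] at hij
  have hmi := Nat.mod_lt i (show 0 < 2 * R by omega)
  have hmj := Nat.mod_lt j (show 0 < 2 * R by omega)
  have hl := nsmul_injOn_Iio_addOrderOf (Set.mem_Iio.2 (by omega)) (Set.mem_Iio.2 (by omega)) hij
  have hmi' := Nat.mod_mod_of_dvd i (Dvd.intro R rfl : 2 ∣ 2 * R)
  have hmj' := Nat.mod_mod_of_dvd j (Dvd.intro R rfl : 2 ∣ 2 * R)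
  rw [← Nat.div_add_mod i (2 * R), ← Nat.div_add_mod j (2 * R), hdiv]
  omega

theorem isHamPath_blockWalk [Fintype G] {a b : G} (hgen : AddSubgroup.closure {a, b} = ⊤) {D : ℕ}
    (hD : (AddSubgroup.zmultiples (a + b)).index = 2 * D)
    (hcard : Fintype.card G = 2 * addOrderOf (a + b) * D) (v₀ : G) :
    IsHamPath a b (Fintype.card G) fun i => blockWalk a b (addOrderOf (a + b)) v₀ i := by
  refine ⟨(Fintype.bijective_iff_injective_and_card _).2 ⟨fun i j hij => Fin.ext ?_, by simp⟩,
    fun i _ => blockWalk.step_mem v₀ (addOrderOf_pos _) (addOrderOf_nsmul_eq_zero _) i⟩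
  exact blockWalk_injOn hgen hD (addOrderOf_pos _) v₀ (hcard ▸ i.2) (hcard ▸ j.2) hij

theorem blockWalk_dvd_iff {a b : G} (hgen : AddSubgroup.closure {a, b} = ⊤) {D R : ℕ}
    (hD : (AddSubgroup.zmultiples (a + b)).index = 2 * D) (hRdef : R = addOrderOf (a + b))
    (hR : 0 < R) {i j : ℕ} (hi : i < 2 * R * D) (hj : j < 2 * R * D)
    (hij : blockWalk a b R (D • (b - a)) i = blockWalk b a R 0 j) :
    2 * R ∣ i + 1 ↔ 2 * R ∣ j + 1 := by
  have h₀ : R • (a + b) = 0 := hRdef ▸ addOrderOf_nsmul_eq_zero _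
  have key : ∀ k < 2 * R * D, 2 * R ∣ k + 1 → ∃ u w, u + w + 1 = D ∧
      k = 2 * R * u + (2 * (R - 1) + 1) := by
    rintro k hk ⟨_ | u, hu⟩
    · simp at hu
    · rw [mul_add_one] at hu
      have hlt : u < D := Nat.lt_of_mul_lt_mul_left (a := 2 * R) (by omega)
      exact ⟨u, D - u - 1, by omega, by omega⟩
  have hend : ∀ u, 2 * R ∣ 2 * R * u + (2 * (R - 1) + 1) + 1 := fun u =>
    ⟨u + 1, by rw [mul_add_one]; omega⟩
  have hlt : ∀ u < D, 2 * R * u + (2 * (R - 1) + 1) < 2 * R * D := fun u hu => by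
    have := Nat.mul_le_mul_left (2 * R) (Nat.succ_le_of_lt hu)
    rw [Nat.succ_eq_add_one, mul_add_one] at this
    omega
  constructor <;> intro hd
  · obtain ⟨u, w, huw, rfl⟩ := key i hi hd
    rw [blockWalk.block_end_eq a b hR h₀ huw] at hij
    have hinj := blockWalk_injOn (a := b) (b := a) (by rwa [Set.pair_comm])
      (by rwa [add_comm]) (by rwa [add_comm, ← hRdef]) 0
    rw [add_comm b a, ← hRdef] at hinj
    exact hinj (hlt w (by omega)) hj hij ▸ hend w
  · obtain ⟨w, u, huw, rfl⟩ := key j hj hd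
    rw [← blockWalk.block_end_eq a b hR h₀ (show u + w + 1 = D by omega)] at hij
    have hinj := blockWalk_injOn hgen hD (hRdef ▸ hR) (D • (b - a))
    rw [← hRdef] at hinj
    exact hinj hi (hlt u (by omega)) hij ▸ hend u

theorem blockWalk_mod_two_eq {a b : G} (hgen : AddSubgroup.closure {a, b} = ⊤)
    (hidx : Even (AddSubgroup.zmultiples (a - b)).index) {D R i j : ℕ}
    (hij : blockWalk a b R (D • (b - a)) i = blockWalk b a R 0 j) : i % 2 = j % 2 := by
  have h := congrArg (QuotientAddGroup.mk (s := AddSubgroup.zmultiples (a - b))) hij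
  rw [blockWalk_mk_sub] at h
  simp only [blockWalk, QuotientAddGroup.mk_add, QuotientAddGroup.mk_nsmul,
    QuotientAddGroup.mk_sub, mk_eq_of_zmultiples_sub, QuotientAddGroup.mk_zero] at h
  have hk := zsmul_mk_eq_zero_imp_even hgen hidx
    (k := (2 * (i % (2 * R) / 2) + i % 2 : ℕ) - (2 * (j % (2 * R) / 2) + j % 2 : ℕ)) (by
      rw [sub_smul, natCast_zsmul, natCast_zsmul, sub_eq_zero]
      rw [sub_self, smul_zero, zero_add] at h
      rw [h]
      module)
  rw [Int.even_sub, Int.even_coe_nat, Int.even_coe_nat, Nat.even_iff, Nat.even_iff] at hk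
  omega

end

/-- If `{a, b}` generates the finite abelian group `G`, with `a, b ≠ 0`, and the index
of the arc-forcing subgroup `⟨a − b⟩` is even, then `Cay(G; a, b)` has two arc-disjoint
hamiltonian paths. -/
theorem arc_disjoint_of_even_index {G : Type*} [AddCommGroup G] [Fintype G]
    (a b : G) (hab : a ≠ b) (ha : a ≠ 0) (hb : b ≠ 0)
    (hgen : AddSubgroup.closure {a, b} = ⊤)
    (hidx : Even (AddSubgroup.zmultiples (a - b)).index) :
    ∃ v v' : Fin (Fintype.card G) → G,
      IsHamPath a b (Fintype.card G) v ∧ IsHamPath a b (Fintype.card G) v' ∧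
      Disjoint (ArcSet (Fintype.card G) v) (ArcSet (Fintype.card G) v') := by
  obtain ⟨D, hD⟩ := (even_index_zmultiples_add hgen hidx).two_dvd
  have hcard : Fintype.card G = 2 * addOrderOf (a + b) * D := by
    rw [← Nat.card_eq_fintype_card, ← (AddSubgroup.zmultiples (a + b)).card_mul_index, hD,
      Nat.card_zmultiples]
    ring
  have hR : 0 < addOrderOf (a + b) := addOrderOf_pos _
  have h₀ : addOrderOf (a + b) • (a + b) = 0 := addOrderOf_nsmul_eq_zero _
  have hswap := isHamPath_blockWalk (a := b) (b := a) (by rwa [Set.pair_comm])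
    (by rwa [add_comm]) (by rwa [add_comm b a]) 0
  rw [IsHamPath, Set.pair_comm, add_comm b a] at hswap
  refine ⟨_, _, isHamPath_blockWalk hgen hD hcard (D • (b - a)), hswap, ?_⟩
  rw [Set.disjoint_left]
  rintro _ ⟨i, hi, rfl⟩ ⟨j, hj, hij⟩
  obtain ⟨h₁, h₂⟩ := Prod.mk.inj hij
  dsimp only at h₁ h₂
  have hstep := congrArg₂ (· - ·) h₂ h₁
  have hdvd := blockWalk_dvd_iff hgen hD rfl hR (by omega) (by omega) h₁
  have hpar := blockWalk_mod_two_eq hgen hidx h₁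
  have h₀' : addOrderOf (a + b) • (b + a) = 0 := by rwa [add_comm b a]
  refine hab ?_
  rcases Nat.mod_two_eq_zero_or_one i with hi₂ | hi₂
  · rwa [blockWalk.step_of_even _ hR hi₂, blockWalk.step_of_even _ hR (hpar ▸ hi₂)] at hstep
  · by_cases hd : 2 * addOrderOf (a + b) ∣ i + 1
    · rwa [blockWalk.step_of_dvd _ hR h₀ hd, blockWalk.step_of_dvd _ hR h₀' (hdvd.1 hd)] at hstep
    · rw [blockWalk.step_of_odd _ hR hi₂ hd,
        blockWalk.step_of_odd _ hR (hpar ▸ hi₂) (hdvd.not.1 hd)] at hstep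
      exact hstep.symm
end

section
/- For all integers m, n ≥ 300 and every integer e, the number of primitive lattice points lying in the interior of the triangle with vertices (0,0), (n,0), and (e,m) is greater than mn/4 (that is, greater than half the area of the triangle, which equals mn/2). -/
open Finset

/-- The lattice points in the interior of the triangle `(0,0)`, `(n,0)`, `(e,m)`, cut out by the
three edge inequalities. -/
noncomputable def trianglePoints (m n : ℕ) (e : ℤ) : Finset (ℤ × ℤ) :=
  {p ∈ Icc (-(|e| + n)) (|e| + n) ×ˢ Icc (0 : ℤ) m |
    0 < p.2 ∧ 0 < m * p.1 - e * p.2 ∧ m * p.1 - e * p.2 + n * p.2 < m * n}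

theorem mem_trianglePoints {m n : ℕ} {e : ℤ} (hm : 0 < m) (hn : 0 < n) {p : ℤ × ℤ} :
    p ∈ trianglePoints m n e ↔
      0 < p.2 ∧ 0 < m * p.1 - e * p.2 ∧ m * p.1 - e * p.2 + n * p.2 < m * n := by
  simp only [trianglePoints, mem_filter, mem_product, mem_Icc, and_iff_right_iff_imp]
  rintro ⟨h1, h2, h3⟩
  have hm' : (0 : ℤ) < m := by exact_mod_cast hm
  have hn' : (0 : ℤ) < n := by exact_mod_cast hn
  have hy : p.2 < m := by
    have : (n : ℤ) * p.2 < n * m := by linarith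
    exact lt_of_mul_lt_mul_left this hn'.le
  have he1 := neg_abs_le e
  have he2 := le_abs_self e
  have he3 := abs_nonneg e
  refine ⟨⟨?_, ?_⟩, h1.le, hy.le⟩
  · refine le_of_mul_le_mul_left (a := (m : ℤ)) ?_ hm'
    nlinarith [mul_nonneg (by linarith : 0 ≤ e + |e|) h1.le, mul_nonneg he3 (sub_nonneg.2 hy.le)]
  · refine le_of_mul_le_mul_left (a := (m : ℤ)) ?_ hm'
    nlinarith [mul_nonneg (by linarith : 0 ≤ |e| - e) h1.le, mul_nonneg he3 (sub_nonneg.2 hy.le)]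

theorem snd_lt_of_mem_trianglePoints {m n : ℕ} {e : ℤ} (hm : 0 < m) (hn : 0 < n) {p : ℤ × ℤ}
    (hp : p ∈ trianglePoints m n e) : p.2 < m := by
  obtain ⟨h1, h2, h3⟩ := (mem_trianglePoints hm hn).1 hp
  have : (n : ℤ) * p.2 < n * m := by linarith
  exact lt_of_mul_lt_mul_left this (by positivity)

theorem mem_interior_triangle {m n : ℕ} {e : ℤ} (hm : 0 < m) (hn : 0 < n) {p : ℤ × ℤ}
    (hp : p ∈ trianglePoints m n e) :
    (((p.1 : ℝ), (p.2 : ℝ)) : ℝ × ℝ) ∈ interior (convexHull ℝ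
      {((0 : ℝ), (0 : ℝ)), ((n : ℝ), (0 : ℝ)), ((e : ℝ), (m : ℝ))}) := by
  have hm' : (0 : ℝ) < m := by exact_mod_cast hm
  have hn' : (0 : ℝ) < n := by exact_mod_cast hn
  let U : Set (ℝ × ℝ) :=
    {q | 0 < q.2 ∧ 0 < m * q.1 - e * q.2 ∧ m * q.1 - e * q.2 + n * q.2 < m * n}
  have hU : IsOpen U := by
    refine IsOpen.and ?_ (IsOpen.and ?_ ?_)
    · exact isOpen_lt (by fun_prop) (by fun_prop)
    · exact isOpen_lt (by fun_prop) (by fun_prop)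
    · exact isOpen_lt (by fun_prop) (by fun_prop)
  refine interior_maximal (s := convexHull ℝ
      {((0 : ℝ), (0 : ℝ)), ((n : ℝ), (0 : ℝ)), ((e : ℝ), (m : ℝ))}) (t := U) ?_ hU ?_
  · rintro ⟨x, y⟩ ⟨h1, h2, h3⟩
    simp only at h1 h2 h3
    have hsum := (convex_convexHull ℝ
        {((0 : ℝ), (0 : ℝ)), ((n : ℝ), (0 : ℝ)), ((e : ℝ), (m : ℝ))}).sum_mem
      (t := univ) (w := ![1 - (m * x - e * y) / (m * n) - y / m, (m * x - e * y) / (m * n), y / m])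
      (z := ![((0 : ℝ), (0 : ℝ)), ((n : ℝ), (0 : ℝ)), ((e : ℝ), (m : ℝ))]) ?_ ?_ ?_
    · convert hsum using 1
      simp only [Fin.sum_univ_three, Matrix.cons_val_zero, Matrix.cons_val_one, Matrix.cons_val,
        Prod.smul_mk, Prod.mk_add_mk, smul_eq_mul]
      ext
      · field_simp; ring
      · field_simp; ring
    · have h4 : 0 ≤ 1 - (m * x - e * y) / (m * n) - y / m := by
        have : 1 - (m * x - e * y) / (m * n) - y / m =
            (m * n - (m * x - e * y + n * y)) / (m * n) := by field_simp; ring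
        rw [this]
        exact div_nonneg (by linarith) (by positivity)
      have h5 : 0 ≤ (m * x - e * y) / (m * n) := div_nonneg h2.le (by positivity)
      have h6 : 0 ≤ y / m := by positivity
      intro i _
      fin_cases i
      exacts [h4, h5, h6]
    · simp only [Fin.sum_univ_three, Matrix.cons_val_zero, Matrix.cons_val_one, Matrix.cons_val]
      ring
    · intro i _
      apply subset_convexHull
      fin_cases i <;> simp
  · obtain ⟨h1, h2, h3⟩ := (mem_trianglePoints hm hn).1 hp
    refine ⟨?_, ?_, ?_⟩
    · simp only; exact_mod_cast h1
    · simp only; exact_mod_cast h2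
    · simp only; exact_mod_cast h3

theorem finite_lattice_points_triangle (m n : ℕ) (e : ℤ) :
    {p : ℤ × ℤ | Int.gcd p.1 p.2 = 1 ∧ (((p.1 : ℝ), (p.2 : ℝ)) : ℝ × ℝ) ∈ interior (convexHull ℝ
      {((0 : ℝ), (0 : ℝ)), ((n : ℝ), (0 : ℝ)), ((e : ℝ), (m : ℝ))})}.Finite := by
  refine (Set.finite_Icc ((-(|e| + n), 0) : ℤ × ℤ) (|e| + n, m)).subset ?_
  rintro ⟨x, y⟩ ⟨-, h⟩
  have h := interior_subset h
  have hsub : convexHull ℝ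
      {((0 : ℝ), (0 : ℝ)), ((n : ℝ), (0 : ℝ)), ((e : ℝ), (m : ℝ))} ⊆
      Set.Icc ((-((|e| : ℤ) + n), 0) : ℝ × ℝ) ((|e| : ℤ) + n, m) := by
    refine convexHull_min ?_ (convex_Icc _ _)
    have he1 : (-(|e| : ℤ) : ℝ) ≤ e := by exact_mod_cast neg_abs_le e
    have he2 : (e : ℝ) ≤ (|e| : ℤ) := by exact_mod_cast le_abs_self e
    have he3 : (0 : ℝ) ≤ (|e| : ℤ) := by exact_mod_cast abs_nonneg e
    have hn : (0 : ℝ) ≤ n := by positivity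
    rintro q (rfl | rfl | rfl) <;> 
      refine ⟨⟨?_, ?_⟩, ?_, ?_⟩ <;> simp only <;> linarith
  obtain ⟨⟨h1, h2⟩, h3, h4⟩ := hsub h
  simp only at h1 h2 h3 h4
  refine ⟨⟨?_, ?_⟩, ?_, ?_⟩
  · exact_mod_cast h1
  · exact_mod_cast h2
  · exact_mod_cast h3
  · exact_mod_cast h4

theorem card_le_of_sub_le {α : Type*} {s : Finset α} {f : α → ℤ} (hf : Set.InjOn f s) {L : ℝ}
    (hL : 0 ≤ L) (h : ∀ p ∈ s, ∀ q ∈ s, ((f p - f q : ℤ) : ℝ) ≤ L) : (#s : ℝ) ≤ L + 1 := by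
  rcases s.eq_empty_or_nonempty with rfl | hs
  · simp; linarith
  obtain ⟨q, hq, hmin⟩ := exists_min_image s f hs
  have hle : #s ≤ #(Icc (f q) (f q + ⌊L⌋)) := by
    refine card_le_card_of_injOn f (fun p hp => ?_) hf
    have := Int.le_floor.2 (h p hp q hq)
    simp only [coe_Icc, Set.mem_Icc]
    exact ⟨hmin p hp, by linarith⟩
  have hfl := Int.floor_nonneg.2 hL
  rw [Int.card_Icc] at hle
  have : (#s : ℤ) ≤ ⌊L⌋ + 1 := by omega
  have h2 : (#s : ℝ) ≤ ⌊L⌋ + 1 := by exact_mod_cast this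
  linarith [Int.floor_le L]

theorem card_trianglePoints_ge {m n : ℕ} (hm : 0 < m) (hn : 0 < n) (e : ℤ) :
    (n * m / 2 - n / 2 - m : ℝ) ≤ #(trianglePoints m n e) := by
  have hm' : (0 : ℝ) < m := by exact_mod_cast hm
  have hmaps : ∀ p ∈ trianglePoints m n e, p.2.toNat ∈ range m := fun p hp => by
    have h1 := snd_lt_of_mem_trianglePoints hm hn hp
    have h2 := ((mem_trianglePoints hm hn).1 hp).1
    rw [mem_range]; omega
  rw [card_eq_sum_card_fiberwise hmaps, Nat.cast_sum]
  have key : ∀ y ∈ range m, (n * (m - y) / m - 1 - if y = 0 then (n : ℝ) else 0 : ℝ) ≤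
      #{p ∈ trianglePoints m n e | p.2.toNat = y} := by
    intro y hy
    rw [mem_range] at hy
    rcases Nat.eq_zero_or_pos y with rfl | hy0
    · have : (n * (m - (0 : ℕ)) / m : ℝ) = n := by field_simp; simp
      rw [this]; simp only [↓reduceIte]
      have : (0 : ℝ) ≤ #{p ∈ trianglePoints m n e | p.2.toNat = 0} := by positivity
      linarith
    rw [if_neg hy0.ne', sub_zero]
    set α : ℝ := e * y / m with hα
    set β : ℝ := (e * y + n * (m - y)) / m with hβ
    have hsub : #(Ioo ⌊α⌋ ⌈β⌉) ≤ #{p ∈ trianglePoints m n e | p.2.toNat = y} := by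
      refine card_le_card_of_injOn (fun x => (x, (y : ℤ))) (fun x hx => ?_) (fun a _ b _ h => ?_)
      · simp only [coe_Ioo, Set.mem_Ioo, Int.floor_lt, Int.lt_ceil] at hx
        obtain ⟨h1, h2⟩ := hx
        rw [hα, div_lt_iff₀ hm'] at h1
        rw [hβ, lt_div_iff₀ hm'] at h2
        have h1' : e * y < x * m := by exact_mod_cast h1
        have h2' : x * m < e * y + n * (m - y) := by exact_mod_cast h2
        simp only [coe_filter, Set.mem_ofPred_eq, mem_trianglePoints hm hn, Int.toNat_natCast,
          and_true]
        exact ⟨by exact_mod_cast hy0, by linarith, by linarith⟩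
      · exact (Prod.mk.inj h).1
    rw [Int.card_Ioo] at hsub
    have h3 : (⌈β⌉ - ⌊α⌋ - 1 : ℤ) ≤ (#{p ∈ trianglePoints m n e | p.2.toNat = y} : ℤ) := by omega
    have h4 : (⌈β⌉ - ⌊α⌋ - 1 : ℝ) ≤ (#{p ∈ trianglePoints m n e | p.2.toNat = y} : ℝ) := by
      exact_mod_cast h3
    have h5 : (n * (m - y) / m : ℝ) = β - α := by rw [hα, hβ]; field_simp; ring
    linarith [Int.le_ceil β, Int.floor_le α]
  refine le_trans (le_of_eq ?_) (sum_le_sum key)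
  have hg : (∑ y ∈ range m, (y : ℝ)) = m * (m - 1) / 2 := by
    clear * - 
    induction m with
    | zero => simp
    | succ k ih => rw [sum_range_succ, ih]; push_cast; ring
  rw [sum_sub_distrib, sum_sub_distrib, sum_ite_eq' (range m) 0, if_pos (mem_range.2 hm),
    ← sum_div, ← mul_sum, sum_sub_distrib, hg]
  simp only [sum_const, card_range, nsmul_eq_mul]
  field_simp
  ring

theorem card_dvd_trianglePoints_le {m n : ℕ} (hm : 0 < m) (hn : 0 < n) (e : ℤ) {d : ℕ}
    (hd : 0 < d) :
    (#{p ∈ trianglePoints m n e | (d : ℤ) ∣ p.1 ∧ (d : ℤ) ∣ p.2} : ℝ) ≤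
      n * m / 2 * (1 / d ^ 2) + m * (1 / d) := by
  have hm' : (0 : ℝ) < m := by exact_mod_cast hm
  have hn' : (0 : ℝ) < n := by exact_mod_cast hn
  have hd' : (0 : ℝ) < d := by exact_mod_cast hd
  set K := m / d with hK
  have hKd : (d * K : ℝ) ≤ m := by exact_mod_cast Nat.mul_div_le m d
  have hmaps : ∀ p ∈ ({p ∈ trianglePoints m n e | (d : ℤ) ∣ p.1 ∧ (d : ℤ) ∣ p.2} : Finset _),
      (p.2 / (d : ℤ)).toNat ∈ (range K).image (· + 1) := fun p hp => by
    rw [mem_filter] at hp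
    obtain ⟨hp, -, k, hk⟩ := hp
    have h1 := snd_lt_of_mem_trianglePoints hm hn hp
    have h2 := ((mem_trianglePoints hm hn).1 hp).1
    have hd'' : (0 : ℤ) < d := by exact_mod_cast hd
    rw [hk, Int.mul_ediv_cancel_left _ hd''.ne']
    rw [hk] at h1 h2
    have hk0 : 0 < k := pos_of_mul_pos_right h2 hd''.le
    lift k to ℕ using hk0.le
    have : k ≤ K := by
      rw [hK, Nat.le_div_iff_mul_le hd, mul_comm]
      exact_mod_cast h1.le
    simp only [mem_image, mem_range, Int.toNat_natCast]
    exact ⟨k - 1, by omega, by omega⟩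
  rw [card_eq_sum_card_fiberwise hmaps, Nat.cast_sum, sum_image (by simp)]
  have key : ∀ j ∈ range K, (#{p ∈ ({p ∈ trianglePoints m n e | (d : ℤ) ∣ p.1 ∧ (d : ℤ) ∣ p.2} :
      Finset _) | (p.2 / (d : ℤ)).toNat = j + 1} : ℝ) ≤ n * (m - d * (j + 1)) / (m * d) + 1 := by
    intro j hj
    have hj' : (j + 1 : ℝ) ≤ K := by exact_mod_cast mem_range.1 hj
    have hdj : (d * (j + 1) : ℝ) ≤ m := le_trans (by gcongr) hKd
    have hmem : ∀ p ∈ ({p ∈ ({p ∈ trianglePoints m n e | (d : ℤ) ∣ p.1 ∧ (d : ℤ) ∣ p.2} :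
        Finset _) | (p.2 / (d : ℤ)).toNat = j + 1} : Finset _), p.1 = d * (p.1 / d) ∧
        p.2 = d * (j + 1) ∧ p ∈ trianglePoints m n e := by
      intro p hp
      simp only [mem_filter] at hp
      obtain ⟨⟨h1, h2, h3⟩, h4⟩ := hp
      refine ⟨(Int.mul_ediv_cancel' h2).symm, ?_, h1⟩
      rw [← Int.mul_ediv_cancel' h3]
      congr 1; omega
    refine card_le_of_sub_le (f := fun p => p.1 / d) (fun p hp q hq h => ?_) ?_
      (fun p hp q hq => ?_)
    · obtain ⟨h1, h2, -⟩ := hmem p hp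
      obtain ⟨h3, h4, -⟩ := hmem q hq
      exact Prod.ext (by rw [h1, h3]; exact congrArg _ h) (h2.trans h4.symm)
    · exact div_nonneg (mul_nonneg hn'.le (by linarith)) (by positivity)
    · obtain ⟨h1, h2, h3⟩ := hmem p hp
      obtain ⟨h4, h5, h6⟩ := hmem q hq
      obtain ⟨-, -, h8⟩ := (mem_trianglePoints hm hn).1 h3
      obtain ⟨-, h9, -⟩ := (mem_trianglePoints hm hn).1 h6
      rw [h1, h2] at h8
      rw [h4, h5] at h9
      generalize p.1 / (d : ℤ) = u at *
      generalize q.1 / (d : ℤ) = v at *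
      have : (u - v) * (m * d) ≤ (n * (m - d * (j + 1)) : ℤ) := by nlinarith
      rw [le_div_iff₀ (by positivity)]
      exact_mod_cast this
  refine (sum_le_sum key).trans ?_
  have hg : ∀ k : ℕ, (∑ y ∈ range k, (y + 1 : ℝ)) = k * (k + 1) / 2 := by
    intro k
    induction k with
    | zero => simp
    | succ k ih => rw [sum_range_succ, ih]; push_cast; ring
  rw [sum_add_distrib, ← sum_div, ← mul_sum, sum_sub_distrib, ← mul_sum, hg]
  simp only [sum_const, card_range, nsmul_eq_mul, mul_one]
  have hK1 : (K : ℝ) ≤ m * (1 / d) := by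
    rw [mul_one_div, le_div_iff₀ hd']; linarith
  refine add_le_add ?_ hK1
  rw [div_le_iff₀ (by positivity)]
  have : (n * m / 2 * (1 / d ^ 2) * (m * d) : ℝ) = n * (m * m / (2 * d)) := by field_simp
  rw [this]
  gcongr
  rw [le_div_iff₀ (by positivity)]
  nlinarith [sq_nonneg (m - d * K : ℝ), mul_nonneg (mul_nonneg hd'.le hd'.le) (Nat.cast_nonneg (α := ℝ) K)]

theorem card_dvd_row_le {m n : ℕ} (hm : 0 < m) (hn : 0 < n) {e a b : ℤ} (hab : IsCoprime a b)
    {H : ℕ} (hH : 0 < H) (h1 : |a * n| = H ∨ |a * e + b * m| = H) {d : ℕ} (hd : 0 < d) (c : ℤ) :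
    (#{p ∈ trianglePoints m n e | ((d : ℤ) ∣ p.1 ∧ (d : ℤ) ∣ p.2) ∧ a * p.1 + b * p.2 = c} : ℝ) ≤
      m * n / (d * H) + 1 := by
  obtain ⟨u, v, huv⟩ := hab
  have hd' : (0 : ℤ) < d := by exact_mod_cast hd
  have hm' : (0 : ℤ) < m := by exact_mod_cast hm
  have hn' : (0 : ℤ) < n := by exact_mod_cast hn
  have hmem : ∀ p ∈ ({p ∈ trianglePoints m n e |
      ((d : ℤ) ∣ p.1 ∧ (d : ℤ) ∣ p.2) ∧ a * p.1 + b * p.2 = c} : Finset _),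
      u * p.2 - v * p.1 = d * ((u * p.2 - v * p.1) / d) := by
    intro p hp
    simp only [mem_filter] at hp
    exact (Int.mul_ediv_cancel' (dvd_sub (hp.2.1.2.mul_left u) (hp.2.1.1.mul_left v))).symm
  refine card_le_of_sub_le (f := fun p => (u * p.2 - v * p.1) / d) (fun p hp q hq h => ?_)
    (by positivity) (fun p hp q hq => ?_)
  · have hp' := hmem p hp
    have hq' := hmem q hq
    simp only [coe_filter, Set.mem_ofPred_eq] at hp hq h
    rw [h, ← hq'] at hp'
    obtain ⟨-, -, hp3⟩ := hp
    obtain ⟨-, -, hq3⟩ := hq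
    ext
    · linear_combination (q.1 - p.1) * huv + u * (hp3 - hq3) - b * hp'
    · linear_combination (q.2 - p.2) * huv + v * (hp3 - hq3) + a * hp'
  · have hp' := hmem p hp
    have hq' := hmem q hq
    simp only [mem_filter] at hp hq
    obtain ⟨hp1, -, hp3⟩ := hp
    obtain ⟨hq1, -, hq3⟩ := hq
    have hpy := snd_lt_of_mem_trianglePoints hm hn hp1
    have hqy := snd_lt_of_mem_trianglePoints hm hn hq1
    obtain ⟨hp4, hp5, hp6⟩ := (mem_trianglePoints hm hn).1 hp1
    obtain ⟨hq4, hq5, hq6⟩ := (mem_trianglePoints hm hn).1 hq1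
    generalize (u * p.2 - v * p.1) / d = k at *
    generalize (u * q.2 - v * q.1) / d = l at *
    have hx : p.1 - q.1 = -b * (d * (k - l)) := by
      linear_combination (q.1 - p.1) * huv + u * (hp3 - hq3) - b * (hp' - hq')
    have hy : p.2 - q.2 = a * (d * (k - l)) := by
      linear_combination (q.2 - p.2) * huv + v * (hp3 - hq3) + a * (hp' - hq')
    have key : (k - l) * (d * H) ≤ (m * n : ℤ) := by
      rcases h1 with h1 | h1
      · have h2 : |a * n| * |(k - l) * d| ≤ m * n := by
          rw [← abs_mul, show a * n * ((k - l) * d) = n * (p.2 - q.2) by rw [hy]; ring, abs_mul,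
            abs_of_pos hn', mul_comm]
          exact mul_le_mul_of_nonneg_right (abs_le.2 ⟨by linarith, by linarith⟩) hn'.le
        rw [h1] at h2
        nlinarith [le_abs_self ((k - l) * (d : ℤ))]
      · have h2 : |a * e + b * m| * |(k - l) * d| ≤ m * n := by
          rw [← abs_mul, show (a * e + b * m) * ((k - l) * d) =
            -((m * p.1 - e * p.2) - (m * q.1 - e * q.2)) by linear_combination m * hx - e * hy,
            abs_neg]
          have := mul_pos hn' hp4
          have := mul_pos hn' hq4
          exact abs_le.2 ⟨by linarith, by linarith⟩
        rw [h1] at h2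
        nlinarith [le_abs_self ((k - l) * (d : ℤ))]
    rw [le_div_iff₀ (by positivity)]
    exact_mod_cast key

theorem abs_linear_lt {m n : ℕ} (hm : 0 < m) (hn : 0 < n) {e a b : ℤ} {H : ℕ} (hH : 0 < H)
    (h1 : |a * n| ≤ H) (h2 : |a * e + b * m| ≤ H) {p : ℤ × ℤ} (hp : p ∈ trianglePoints m n e) :
    |a * p.1 + b * p.2| < H := by
  have hm' : (0 : ℤ) < m := by exact_mod_cast hm
  have hn' : (0 : ℤ) < n := by exact_mod_cast hn
  have hH' : (0 : ℤ) < H := by exact_mod_cast hH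
  obtain ⟨hp4, hp5, hp6⟩ := (mem_trianglePoints hm hn).1 hp
  have hmn := mul_pos hm' hn'
  refine lt_of_mul_lt_mul_left (a := (m * n : ℤ)) ?_ hmn.le
  calc (m * n : ℤ) * |a * p.1 + b * p.2|
      = |(m * p.1 - e * p.2) * (a * n) + (n * p.2) * (a * e + b * m)| := by
        nth_rw 1 [← abs_of_pos hmn]; rw [← abs_mul]; congr 1; ring
    _ ≤ (m * p.1 - e * p.2) * |a * n| + (n * p.2) * |a * e + b * m| := by
        refine (abs_add_le _ _).trans (le_of_eq ?_)
        rw [abs_mul (_ - _), abs_mul (_ * p.2), abs_of_pos hp5, abs_of_pos (mul_pos hn' hp4)]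
    _ ≤ (m * p.1 - e * p.2) * H + (n * p.2) * H := by
        have := (mul_pos hn' hp4).le
        gcongr
    _ < m * n * H := by rw [← add_mul]; exact mul_lt_mul_of_pos_right hp6 hH'

theorem card_dvd_off_row_le {m n : ℕ} (hm : 0 < m) (hn : 0 < n) {e a b : ℤ} (hab : IsCoprime a b)
    {H : ℕ} (hH : 0 < H) (h1 : |a * n| ≤ H) (h2 : |a * e + b * m| ≤ H)
    (h3 : |a * n| = H ∨ |a * e + b * m| = H) (hHmn : H ^ 2 ≤ m * n) {d : ℕ} (hd : 0 < d) :
    (#{p ∈ trianglePoints m n e | ((d : ℤ) ∣ p.1 ∧ (d : ℤ) ∣ p.2) ∧ a * p.1 + b * p.2 ≠ 0} : ℝ) ≤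
      4 * (n * m) * (1 / d ^ 2) := by
  set s : Finset (ℤ × ℤ) := {p ∈ trianglePoints m n e |
    ((d : ℤ) ∣ p.1 ∧ (d : ℤ) ∣ p.2) ∧ a * p.1 + b * p.2 ≠ 0} with hs
  have hd' : (0 : ℤ) < d := by exact_mod_cast hd
  have hdr : (0 : ℝ) < d := by exact_mod_cast hd
  have hHr : (0 : ℝ) < H := by exact_mod_cast hH
  have hHmn' : (H ^ 2 : ℝ) ≤ m * n := by exact_mod_cast hHmn
  set K := H / d with hK
  have hKd : (K * d : ℝ) ≤ H := by exact_mod_cast Nat.div_mul_le_self H d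
  have hmaps : ∀ p ∈ s, a * p.1 + b * p.2 ∈
      (((Icc (-K : ℤ) K).erase 0).image ((d : ℤ) * ·)) := by
    intro p hp
    simp only [hs, mem_filter] at hp
    obtain ⟨hp1, ⟨hp2, hp3⟩, hp4⟩ := hp
    obtain ⟨k, hk⟩ : (d : ℤ) ∣ a * p.1 + b * p.2 := dvd_add (hp2.mul_left a) (hp3.mul_left b)
    have hlt := abs_linear_lt hm hn hH h1 h2 hp1
    rw [hk] at hp4 ⊢
    rw [hk, abs_mul, abs_of_pos hd'] at hlt
    refine mem_image_of_mem _ (mem_erase.2 ⟨right_ne_zero_of_mul hp4, mem_Icc.2 (abs_le.1 ?_)⟩)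
    rw [hK, Int.natCast_div, Int.le_ediv_iff_mul_le hd']
    linarith
  have hcard := card_le_mul_card_image_of_maps_to hmaps (⌊(m * n / (d * H) : ℝ)⌋₊ + 1)
    (fun c _ => by
      have h := card_dvd_row_le hm hn hab hH h3 hd c
      rw [← Nat.floor_add_one (by positivity)]
      refine Nat.le_floor (le_trans ?_ h)
      rw [hs, filter_filter]
      refine Nat.cast_le.2 (card_le_card fun p hp => ?_)
      rw [mem_filter] at hp ⊢
      exact ⟨hp.1, hp.2.1.1, hp.2.2⟩)
  have hcard2 : #((((Icc (-K : ℤ) K).erase 0).image ((d : ℤ) * ·))) ≤ 2 * K := by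
    refine card_image_le.trans ?_
    rw [card_erase_of_mem (by simp), Int.card_Icc]
    omega
  have hcard3 := hcard.trans (Nat.mul_le_mul_left _ hcard2)
  have hcard4 : (#s : ℝ) ≤ (⌊(m * n / (d * H) : ℝ)⌋₊ + 1) * (2 * K) := by exact_mod_cast hcard3
  have hfl := Nat.floor_le (show (0 : ℝ) ≤ m * n / (d * H) by positivity)
  rcases Nat.eq_zero_or_pos K with hK0 | hK0
  · rw [hK0] at hcard4
    have : (0 : ℝ) ≤ 4 * (n * m) * (1 / d ^ 2) := by positivity
    rw [Nat.cast_zero, mul_zero, mul_zero] at hcard4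
    exact hcard4.trans this
  have hdH : (d : ℝ) ≤ H := by
    have : (1 : ℝ) ≤ K := by exact_mod_cast hK0
    nlinarith
  have hone : (1 : ℝ) ≤ m * n / (d * H) := by
    rw [le_div_iff₀ (by positivity)]
    nlinarith
  calc (#s : ℝ) ≤ (m * n / (d * H) + m * n / (d * H)) * (2 * (H / d)) := by
        refine hcard4.trans ?_
        have : (K : ℝ) ≤ H / d := by rw [le_div_iff₀ hdr]; exact hKd
        gcongr
    _ = 4 * (n * m) * (1 / d ^ 2) := by field_simp; ring

theorem exists_short_functional {m n : ℕ} (hm : 0 < m) (hn : 0 < n) (e : ℤ) :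
    ∃ a b : ℤ, IsCoprime a b ∧ (a * n) ^ 2 ≤ (m * n : ℤ) ∧ (a * e + b * m) ^ 2 ≤ (m * n : ℤ) := by
  rcases le_or_gt m n with h | h
  · refine ⟨0, 1, isCoprime_one_right, by rw [zero_mul]; positivity, ?_⟩
    have : (m : ℤ) ≤ n := by exact_mod_cast h
    nlinarith
  have hmr : (0 : ℝ) < m := by exact_mod_cast hm
  set Q := Nat.sqrt (m / n) with hQ
  have hQ0 : 0 < Q := Nat.sqrt_pos.2 (Nat.div_pos h.le hn)
  have hQ1 : Q * Q * n ≤ m :=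
    (Nat.mul_le_mul_right n (Nat.sqrt_le _)).trans (Nat.div_mul_le_self m n)
  have hQ2 : m < (Q + 1) * (Q + 1) * n := by
    rw [← Nat.div_lt_iff_lt_mul hn]; exact Nat.lt_succ_sqrt _
  obtain ⟨q, hq1, hq2⟩ := Real.exists_rat_abs_sub_le_and_den_le ((e : ℝ) / m) hQ0
  have hqd : (0 : ℝ) < q.den := by exact_mod_cast q.pos
  refine ⟨q.den, -q.num, ?_, ?_, ?_⟩
  · rw [IsCoprime.neg_right_iff, isCoprime_comm, Int.isCoprime_iff_gcd_eq_one]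
    simpa [Int.gcd] using q.reduced
  · have h3 : (q.den * n) ^ 2 ≤ m * n := by
      calc (q.den * n) ^ 2 ≤ (Q * n) ^ 2 := by gcongr
        _ = Q * Q * n * n := by ring
        _ ≤ m * n := by gcongr
    exact_mod_cast h3
  · have h4 : |(q.den * e - q.num * m : ℝ)| * (Q + 1) ≤ m := by
      have h5 : (q.den * e - q.num * m : ℝ) = (e / m - q) * (q.den * m) := by
        have : (q : ℝ) = q.num / q.den := by exact_mod_cast (Rat.num_div_den q).symm
        rw [this]; field_simp
      rw [h5, abs_mul, abs_of_pos (by positivity : (0 : ℝ) < q.den * m)]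
      calc |(e / m - q : ℝ)| * (q.den * m) * (Q + 1)
          ≤ 1 / ((Q + 1) * q.den) * (q.den * m) * (Q + 1) := by gcongr
        _ = m := by field_simp
    have h6 : |(q.den * e - q.num * m : ℤ)| * (Q + 1) ≤ m := by exact_mod_cast h4
    have h7 : (m : ℤ) < (Q + 1) * (Q + 1) * n := by exact_mod_cast hQ2
    have h8 : (0 : ℤ) < m := by exact_mod_cast hm
    have h9 : ((q.den : ℤ) * e + -q.num * m) ^ 2 = |(q.den * e - q.num * m : ℤ)| ^ 2 := by
      rw [sq_abs]; ring
    rw [h9]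
    set t := |(q.den * e - q.num * m : ℤ)|
    have ht : 0 ≤ t := abs_nonneg _
    have hQp : (0 : ℤ) < (Q + 1) * (Q + 1) := by positivity
    refine le_of_mul_le_mul_left (a := ((Q + 1) * (Q + 1) : ℤ)) ?_ hQp
    have h10 : (t * (Q + 1)) * (t * (Q + 1)) ≤ (m : ℤ) * m :=
      mul_le_mul h6 h6 (by positivity) h8.le
    nlinarith

theorem sum_one_div_le_sum_div_add_one (s : Finset ℕ) (f : ℕ → ℕ) {N : ℕ} (hN : 0 < N) :
    (∑ i ∈ s, (1 / f i : ℝ)) ≤ ((∑ i ∈ s, (N / f i + 1) : ℕ) : ℝ) / N := by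
  have hN' : (0 : ℝ) < N := by exact_mod_cast hN
  rw [Nat.cast_sum, sum_div]
  refine sum_le_sum fun i _ => ?_
  rcases Nat.eq_zero_or_pos (f i) with h | h
  · rw [h]; simp
  have h' : (0 : ℝ) < f i := by exact_mod_cast h
  rw [div_le_div_iff₀ h' hN', one_mul]
  exact_mod_cast ((Nat.lt_mul_div_succ N h).trans_eq (mul_comm _ _)).le

/-- The integers in `[2, 1000]` with no proper prime divisor up to `31`. -/
def primeSieve : Finset ℕ :=
  {k ∈ range 1001 | 2 ≤ k ∧ ∀ q ∈ ([2, 3, 5, 7, 11, 13, 17, 19, 23, 29, 31] : List ℕ), k % q = 0 → k = q}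

theorem mem_primeSieve {p : ℕ} (hp : p.Prime) (h : p ≤ 1000) : p ∈ primeSieve := by
  rw [primeSieve, mem_filter, mem_range]
  refine ⟨by omega, hp.two_le, fun q hq hpq => ?_⟩
  refine ((Nat.dvd_prime hp).1 (Nat.dvd_of_mod_eq_zero hpq)).elim (fun h => ?_) Eq.symm
  subst h
  simp at hq

theorem sum_primeSieve_inv_le : (∑ p ∈ primeSieve, (1 / p : ℝ)) ≤ 22 / 10 := by
  have h : ∑ p ∈ primeSieve, (10 ^ 6 / p + 1) ≤ 2200000 := by decide +kernel
  refine (sum_one_div_le_sum_div_add_one primeSieve id (N := 10 ^ 6) (by norm_num)).trans ?_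
  rw [div_le_iff₀ (by norm_num)]
  refine (Nat.cast_le.2 h).trans ?_
  norm_num

theorem sum_primeSieve_inv_sq_le : (∑ p ∈ primeSieve, (1 / p ^ 2 : ℝ)) ≤ 4525 / 10000 := by
  have h : ∑ p ∈ primeSieve, (10 ^ 8 / p ^ 2 + 1) ≤ 45250000 := by decide +kernel
  have h2 := sum_one_div_le_sum_div_add_one primeSieve (· ^ 2) (N := 10 ^ 8) (by norm_num)
  push_cast only [Nat.cast_pow] at h2
  refine h2.trans ?_
  rw [div_le_iff₀ (by norm_num)]
  refine (Nat.cast_le.2 h).trans ?_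
  norm_num

theorem nonprimitive_subset {m n : ℕ} (hm : 0 < m) (hn : 0 < n) (e a b : ℤ) {P : Finset ℕ}
    {B M : ℕ} (hP : ∀ p : ℕ, p.Prime → p ≤ B → p ∈ P) (hM : m ≤ M) :
    {p ∈ trianglePoints m n e | Int.gcd p.1 p.2 ≠ 1} ⊆
      (P.biUnion fun d => {p ∈ trianglePoints m n e | (d : ℤ) ∣ p.1 ∧ (d : ℤ) ∣ p.2}) ∪
      ({p ∈ trianglePoints m n e |
        (((1 : ℕ) : ℤ) ∣ p.1 ∧ ((1 : ℕ) : ℤ) ∣ p.2) ∧ a * p.1 + b * p.2 = 0} ∪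
      (Ioc B M).biUnion fun d =>
        {p ∈ trianglePoints m n e |
          ((d : ℤ) ∣ p.1 ∧ (d : ℤ) ∣ p.2) ∧ a * p.1 + b * p.2 ≠ 0}) := by
  intro p hp
  obtain ⟨hpT, hp⟩ := mem_filter.1 hp
  obtain ⟨q, hq, hqd⟩ := Nat.exists_prime_and_dvd hp
  have hq1 : (q : ℤ) ∣ p.1 := (Int.natCast_dvd_natCast.2 hqd).trans (Int.gcd_dvd_left ..)
  have hq2 : (q : ℤ) ∣ p.2 := (Int.natCast_dvd_natCast.2 hqd).trans (Int.gcd_dvd_right ..)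
  have hqm : q ≤ m := by
    have h1 := snd_lt_of_mem_trianglePoints hm hn hpT
    have h2 := Int.le_of_dvd ((mem_trianglePoints hm hn).1 hpT).1 hq2
    omega
  simp only [mem_union, mem_biUnion, mem_filter, mem_Ioc]
  by_cases hle : q ≤ B
  · exact Or.inl ⟨q, hP q hq hle, hpT, hq1, hq2⟩
  by_cases h0 : a * p.1 + b * p.2 = 0
  · exact Or.inr (Or.inl ⟨hpT, by simp, h0⟩)
  · exact Or.inr (Or.inr ⟨q, ⟨not_le.1 hle, hqm.trans hM⟩, hpT, ⟨hq1, hq2⟩, h0⟩)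

theorem card_nonprimitive_le {m n : ℕ} (hm : 300 ≤ m) (hn : 300 ≤ n) (e : ℤ) :
    (#{p ∈ trianglePoints m n e | Int.gcd p.1 p.2 ≠ 1} : ℝ) ≤
      n * m / 2 * (4525 / 10000) + m * (22 / 10) + (m * n / 300 + 1) + 4 * (n * m) * (1 / 1000) := by
  have hm0 : 0 < m := by omega
  have hn0 : 0 < n := by omega
  obtain ⟨a, b, hab, h1, h2⟩ := exists_short_functional hm0 hn0 e
  obtain ⟨H, hH1, hH2, hH3⟩ : ∃ H : ℕ, |a * n| ≤ H ∧ |a * e + b * m| ≤ H ∧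
      (|a * n| = H ∨ |a * e + b * m| = H) := by
    refine ⟨max (a * n).natAbs (a * e + b * m).natAbs, ?_⟩
    rw [Nat.cast_max, Int.natCast_natAbs, Int.natCast_natAbs]
    exact ⟨le_max_left _ _, le_max_right _ _, (max_choice _ _).imp Eq.symm Eq.symm⟩
  have hHmn : H ^ 2 ≤ m * n := by
    zify
    rcases hH3 with h | h <;> rw [← h, sq_abs] <;> assumption
  have hH300 : 300 ≤ H := by
    rcases eq_or_ne a 0 with rfl | ha
    · rw [isCoprime_zero_left, Int.isUnit_iff] at hab
      rcases hab with rfl | rfl <;> simp at hH2 <;> omega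
    · have : 1 * (n : ℤ) ≤ |a * n| := by
        rw [abs_mul, abs_of_nonneg (by positivity : (0 : ℤ) ≤ n)]
        exact mul_le_mul_of_nonneg_right (Int.one_le_abs ha) (by positivity)
      omega
  have hH0 : 0 < H := by omega
  have hcard := (card_le_card (nonprimitive_subset hm0 hn0 e a b
    (fun p hp hle => mem_primeSieve hp hle) (Nat.le_add_left m 1000))).trans
    ((card_union_le _ _).trans (Nat.add_le_add card_biUnion_le
      ((card_union_le _ _).trans (Nat.add_le_add_left card_biUnion_le _))))
  refine (Nat.cast_le (α := ℝ).2 hcard).trans ?_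
  rw [Nat.cast_add, Nat.cast_add, Nat.cast_sum, Nat.cast_sum]
  have hpos : ∀ d ∈ primeSieve, 0 < d := fun d hd => by
    have := (mem_filter.1 hd).2.1
    omega
  have hA := (sum_le_sum fun d hd => card_dvd_trianglePoints_le hm0 hn0 e (hpos d hd)).trans_eq
    sum_add_distrib
  rw [← mul_sum, ← mul_sum] at hA
  have hA1 := mul_le_mul_of_nonneg_left sum_primeSieve_inv_sq_le
    (by positivity : (0 : ℝ) ≤ n * m / 2)
  have hA2 := mul_le_mul_of_nonneg_left sum_primeSieve_inv_le (by positivity : (0 : ℝ) ≤ m)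
  have hB := card_dvd_row_le hm0 hn0 hab hH0 hH3 one_pos 0
  have hB1 : (m * n / ((1 : ℕ) * H) : ℝ) ≤ m * n / 300 := by
    have : (300 : ℝ) ≤ H := by exact_mod_cast hH300
    rw [Nat.cast_one, one_mul]
    gcongr
  have hC := sum_le_sum fun d (hd : d ∈ Ioc 1000 (1000 + m)) =>
    card_dvd_off_row_le hm0 hn0 hab hH0 hH1 hH2 hH3 hHmn
      (d := d) (by have := (mem_Ioc.1 hd).1; omega)
  rw [← mul_sum] at hC
  have hC1 : (∑ d ∈ Ioc 1000 (1000 + m), (1 / d ^ 2 : ℝ)) ≤ 1 / 1000 := by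
    have h := sum_Ioc_inv_sq_le_sub (α := ℝ) (k := 1000) (n := 1000 + m) (by norm_num) (by omega)
    have h' : (0 : ℝ) ≤ ((1000 + m : ℕ) : ℝ)⁻¹ := by positivity
    simp only [one_div]
    refine h.trans ?_
    push_cast at h' ⊢
    linarith
  have hC2 := mul_le_mul_of_nonneg_left hC1 (by positivity : (0 : ℝ) ≤ 4 * (n * m))
  linarith

/-- For `m, n ≥ 300` and any integer `e`, the number of primitive lattice points in the
interior of the triangle with vertices `(0,0)`, `(n,0)`, `(e,m)` is greater than `mn/4`
(that is, greater than half the area `mn/2` of the triangle). -/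
theorem primitive_lattice_points_in_triangle (m n : ℕ) (hm : 300 ≤ m) (hn : 300 ≤ n)
    (e : ℤ) :
    m * n < 4 * Nat.card {p : ℤ × ℤ //
      Int.gcd p.1 p.2 = 1 ∧
      (((p.1 : ℝ), (p.2 : ℝ)) : ℝ × ℝ) ∈
        interior (convexHull ℝ
          {((0 : ℝ), (0 : ℝ)), ((n : ℝ), (0 : ℝ)), ((e : ℝ), (m : ℝ))})} := by
  have hm0 : 0 < m := by omega
  have hn0 : 0 < n := by omega
  have hsub : #{p ∈ trianglePoints m n e | Int.gcd p.1 p.2 = 1} ≤ Nat.card {p : ℤ × ℤ //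
      Int.gcd p.1 p.2 = 1 ∧ (((p.1 : ℝ), (p.2 : ℝ)) : ℝ × ℝ) ∈ interior (convexHull ℝ
          {((0 : ℝ), (0 : ℝ)), ((n : ℝ), (0 : ℝ)), ((e : ℝ), (m : ℝ))})} := by
    rw [← Set.ncard_coe_finset]
    refine Set.ncard_le_ncard (fun p hp => ?_) (finite_lattice_points_triangle m n e)
    obtain ⟨hp1, hp2⟩ := mem_filter.1 (mem_coe.1 hp)
    exact ⟨hp2, mem_interior_triangle hm0 hn0 hp1⟩
  have hsplit := card_filter_add_card_filter_not (s := trianglePoints m n e)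
    (fun p => Int.gcd p.1 p.2 = 1)
  have hsplit' : (#{p ∈ trianglePoints m n e | Int.gcd p.1 p.2 = 1} : ℝ) +
      #{p ∈ trianglePoints m n e | Int.gcd p.1 p.2 ≠ 1} = #(trianglePoints m n e) := by
    exact_mod_cast hsplit
  have hT := card_trianglePoints_ge hm0 hn0 e
  have hN := card_nonprimitive_le hm hn e
  refine lt_of_lt_of_le ?_ (Nat.mul_le_mul_left 4 hsub)
  have hmr : (300 : ℝ) ≤ m := by exact_mod_cast hm
  have hnr : (300 : ℝ) ≤ n := by exact_mod_cast hn
  have hlt : (m * n : ℝ) < 4 * #{p ∈ trianglePoints m n e | Int.gcd p.1 p.2 = 1} := by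
    nlinarith [mul_le_mul_of_nonneg_right hnr (by linarith : (0 : ℝ) ≤ m),
      mul_le_mul_of_nonneg_right hmr (by linarith : (0 : ℝ) ≤ n)]
  exact_mod_cast hlt
end
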